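/- Let M, N be positive integers and consider the Hamiltonian system y₁' = (N+1)α_{0,N+1}(z) y₂^N + Σ_{(i,j)∈I} j α_{ij}(z) y₁^i y₂^{j−1}, y₂' = −(M+1)α_{M+1,0}(z) y₁^M − Σ_{(i,j)∈I} i α_{ij}(z) y₁^{i−1} y₂^j. Suppose that at every point z₀ ∈ Ω \ Φ the system admits formal series solutions y₁(z) = Σ_{k≥−N−1} c_{1,k}(z−z₀)^{k/(MN−1)}, y₂(z) = Σ_{k≥−M−1} c_{2,k}(z−z₀)^{k/(MN−1)} for every pair of leading coefficients (c_{1,−N−1}, c_{2,−M−1}) satisfying c_{1,−N−1}^{MN−1} = −(α_{0,N+1}(z₀) α_{M+1,0}(z₀)^N (MN−1)^{N+1})^{−1} and c_{2,−M−1} = (MN−1) α_{M+1,0}(z₀) c_{1,−N−1}^M. Let γ ⊂ Ω be a finite-length curve with endpoint z_∞ ∈ Ω \ Φ such that a solution (y₁, y₂) can be analytically continued along γ up to, but not including, z_∞. Then, with d = gcd{M+1, N+1, MN−1}, the solution is represented near z_∞ by convergent series y₁(z) = Σ_{k≥−(N+1)/d} C_{1,k}(z−z_∞)^{kd/(MN−1)}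 and y₂(z) = Σ_{k≥−(M+1)/d} C_{2,k}(z−z_∞)^{kd/(MN−1)} in some punctured branched neighbourhood of z_∞; in particular every movable singularity of a solution reached along a rectifiable curve is at most an algebraic branch point. -/

import Mathlib

open scoped Topology
open Asymptotics Filter Metric

/-- The index set `I = {(i,j) ∈ ℕ² : i(N+1) + j(M+1) < (N+1)(M+1)}`. -/
def idxI (M N : ℕ) : Finset (ℕ × ℕ) :=
  (Finset.range (M + 2) ×ˢ Finset.range (N + 2)).filter
    fun p => p.1 * (N + 1) + p.2 * (M + 1) < (N + 1) * (M + 1)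

/-- Right-hand side `∂H/∂y₂` of the first Hamiltonian equation. -/
noncomputable def F₁ (M N : ℕ) (α : ℕ × ℕ → ℂ → ℂ) (z y₁ y₂ : ℂ) : ℂ :=
  ((N : ℂ) + 1) * α (0, N + 1) z * y₂ ^ N +
    ∑ p ∈ idxI M N, (p.2 : ℂ) * α p z * y₁ ^ p.1 * y₂ ^ (p.2 - 1)

/-- Right-hand side `−∂H/∂y₁` of the second Hamiltonian equation. -/
noncomputable def F₂ (M N : ℕ) (α : ℕ × ℕ → ℂ → ℂ) (z y₁ y₂ : ℂ) : ℂ :=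
  -(((M : ℂ) + 1) * α (M + 1, 0) z * y₁ ^ M) -
    ∑ p ∈ idxI M N, (p.1 : ℂ) * α p z * y₁ ^ (p.1 - 1) * y₂ ^ p.2

/-- Truncation of a formal series `∑_{k ≥ k₀} c_k t^k` (with `t` a local uniformising
variable, `z = z₀ + t^(MN−1)`), keeping the terms `k₀ ≤ k ≤ k₀ + m`. -/
noncomputable def trunc (k₀ : ℤ) (c : ℤ → ℂ) (m : ℕ) (t : ℂ) : ℂ :=
  ∑ k ∈ Finset.range (m + 1), c (k₀ + k) * t ^ (k₀ + (k : ℤ))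

/-- The coefficient sequences `c₁` (supported in `k ≥ −(N+1)`) and `c₂` (supported in
`k ≥ −(M+1)`) constitute a formal series solution
`y_i(z) = ∑_k c_{i,k} (z−z₀)^{k/(MN−1)}` of the Hamiltonian system at `z₀`:
in the local variable `t` with `z = z₀ + t^{MN−1}`, the truncations satisfy both
equations of the system to arbitrarily high order as `t → 0`. -/
def IsFormalSolution (M N : ℕ) (α : ℕ × ℕ → ℂ → ℂ) (z₀ : ℂ) (c₁ c₂ : ℤ → ℂ) : Prop :=
  (∀ k : ℤ, k < -((N : ℤ) + 1) → c₁ k = 0) ∧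
  (∀ k : ℤ, k < -((M : ℤ) + 1) → c₂ k = 0) ∧
  ∀ e : ℕ, ∃ m : ℕ,
    ((fun t : ℂ =>
        deriv (trunc (-((N : ℤ) + 1)) c₁ m) t -
          ((M * N - 1 : ℕ) : ℂ) * t ^ (M * N - 2) *
            F₁ M N α (z₀ + t ^ (M * N - 1))
              (trunc (-((N : ℤ) + 1)) c₁ m t) (trunc (-((M : ℤ) + 1)) c₂ m t))
        =O[𝓝[≠] (0 : ℂ)] fun t => t ^ e) ∧
    ((fun t : ℂ =>
        deriv (trunc (-((M : ℤ) + 1)) c₂ m) t -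
          ((M * N - 1 : ℕ) : ℂ) * t ^ (M * N - 2) *
            F₂ M N α (z₀ + t ^ (M * N - 1))
              (trunc (-((N : ℤ) + 1)) c₁ m t) (trunc (-((M : ℤ) + 1)) c₂ m t))
        =O[𝓝[≠] (0 : ℂ)] fun t => t ^ e)


lemma mv_ball {E : Type*} [NormedAddCommGroup E] [NormedSpace ℂ E] {c : ℂ} {r : ℝ}
    {g g' : ℂ → E} {C : ℝ} (hg : ∀ x ∈ ball c r, HasDerivAt g (g' x) x)
    (hC : ∀ x ∈ ball c r, ‖g' x‖ ≤ C) {x y : ℂ} (hx : x ∈ ball c r) (hy : y ∈ ball c r) :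
    ‖g y - g x‖ ≤ C * ‖y - x‖ :=
  (convex_ball c r).norm_image_sub_le_of_norm_hasDerivWithin_le
    (fun z hz => (hg z hz).hasDerivWithinAt) hC hx hy

lemma ode_exists {E : Type*} [NormedAddCommGroup E] [NormedSpace ℂ E] [CompleteSpace E]
    (f : ℂ × E → E) (a : ℂ) (b : E) (hf : AnalyticAt ℂ f (a, b)) :
    ∃ ρ > (0 : ℝ), ∃ R > (0 : ℝ), ∃ L : ℝ, 0 ≤ L ∧
      (∀ x ∈ ball a ρ, ∀ y ∈ closedBall b R, ∀ y' ∈ closedBall b R,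
        ‖f (x, y) - f (x, y')‖ ≤ L * ‖y - y'‖) ∧
      ∀ x₀ ∈ ball a ρ, ∀ y₀ ∈ ball b (R / 2), ∃ Y : ℂ → E, Y x₀ = y₀ ∧
        ∀ x ∈ ball a ρ, HasDerivAt Y (f (x, Y x)) x ∧ Y x ∈ ball b R := by
  obtain ⟨L, s, hs, hL⟩ := (hf.contDiffAt (n := 1)).exists_lipschitzOnWith
  have hd : ∀ᶠ p in 𝓝 (a, b), DifferentiableAt ℂ f p :=
    hf.eventually_analyticAt.mono fun p hp => hp.differentiableAt
  have hbd : ∀ᶠ p in 𝓝 (a, b), ‖f p‖ ≤ ‖f (a, b)‖ + 1 := by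
    have := hf.continuousAt.norm
    exact (this.eventually (eventually_lt_nhds (b := ‖f (a, b)‖ + 1) (by simp))).mono
      fun p hp => hp.le
  obtain ⟨R', hR', hball⟩ := Metric.eventually_nhds_iff_ball.1
    ((hd.and hbd).and (eventually_mem_set.2 hs))
  set K := ‖f (a, b)‖ + 1 with hK
  have hKpos : 0 < K := by positivity
  set R := R' / 2
  have hR : 0 < R := by positivity
  have hRR' : R < R' := by simp only [R]; linarith
  obtain ⟨ρ, hρ, hρR, hρK, hρL⟩ : ∃ ρ > 0, ρ ≤ R ∧ ρ * (2 * K) < R / 2 ∧ ρ * (2 * L) ≤ 1 / 2 := by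
    refine ⟨min R (min (R / (8 * K)) (1 / (8 * (L + 1)))), by positivity, min_le_left _ _, ?_, ?_⟩
    · have h1 : min R (min (R / (8 * K)) (1 / (8 * ((L:ℝ) + 1)))) ≤ R / (8 * K) :=
        (min_le_right _ _).trans (min_le_left _ _)
      calc _ ≤ R / (8 * K) * (2 * K) := by gcongr
        _ = R / 4 := by field_simp; norm_num
        _ < R / 2 := by linarith
    · have h1 : min R (min (R / (8 * K)) (1 / (8 * ((L:ℝ) + 1)))) ≤ 1 / (8 * ((L:ℝ) + 1)) :=
        (min_le_right _ _).trans (min_le_right _ _)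
      have hL0 : (0:ℝ) ≤ L := L.2
      calc _ ≤ 1 / (8 * ((L:ℝ) + 1)) * (2 * L) := by gcongr
        _ ≤ 1 / (8 * ((L:ℝ) + 1)) * (2 * (L + 1)) := by gcongr; linarith
        _ = 1 / 4 := by field_simp; norm_num
        _ ≤ 1 / 2 := by norm_num
  have hmem : ∀ x ∈ ball a ρ, ∀ y ∈ closedBall b R, (x, y) ∈ ball (a, b) R' := by
    intro x hx y hy
    rw [mem_ball, Prod.dist_eq, max_lt_iff]
    exact ⟨lt_of_lt_of_le hx (hρR.trans hRR'.le), lt_of_le_of_lt hy hRR'⟩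
  have hLip : ∀ x ∈ ball a ρ, ∀ y ∈ closedBall b R, ∀ y' ∈ closedBall b R,
        ‖f (x, y) - f (x, y')‖ ≤ L * ‖y - y'‖ := by
    intro x hx y hy y' hy'
    have := hL.dist_le_mul _ (hball _ (hmem x hx y hy)).2 _ (hball _ (hmem x hx y' hy')).2
    rw [dist_eq_norm] at this
    refine this.trans ?_
    rw [Prod.dist_eq, dist_self, dist_eq_norm]
    simp
  refine ⟨ρ, hρ, R, hR, L, L.2, hLip, ?_⟩
  intro x₀ hx₀ y₀ hy₀
  let G := {u : ℂ → E // DifferentiableOn ℂ u (ball a ρ) ∧ ∀ x ∈ ball a ρ, u x ∈ ball b R}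
  have hdist : ∀ x ∈ ball a ρ, ∀ x' ∈ ball a ρ, ‖x - x'‖ ≤ 2 * ρ := by
    intro x hx x' hx'
    rw [mem_ball] at hx hx'
    rw [← dist_eq_norm]
    have := dist_triangle_right x x' a
    linarith
  have step : ∀ u : G, ∃ v : G, v.1 x₀ = y₀ ∧
      ∀ x ∈ ball a ρ, HasDerivAt v.1 (f (x, u.1 x)) x := by
    rintro ⟨u, hu, hub⟩
    have h1 : DifferentiableOn ℂ (fun x => f (x, u x)) (ball a ρ) := by
      intro x hx
      have h2 : DifferentiableAt ℂ f (x, u x) :=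
        (hball _ (hmem x hx _ (ball_subset_closedBall (hub x hx)))).1.1
      have h3 : DifferentiableAt ℂ u x := hu.differentiableAt (isOpen_ball.mem_nhds hx)
      exact (h2.comp x (differentiableAt_id.prodMk h3)).differentiableWithinAt
    obtain ⟨g, hg0, hg⟩ := h1.isExactOn_ball.with_val_at x₀ y₀
    refine ⟨⟨g, fun x hx => (hg x hx).differentiableAt.differentiableWithinAt, ?_⟩, hg0, hg⟩
    intro x hx
    have h4 : ‖g x - g x₀‖ ≤ K * ‖x - x₀‖ := mv_ball hg
      (fun x hx => (hball _ (hmem x hx _ (ball_subset_closedBall (hub x hx)))).1.2) hx₀ hx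
    rw [hg0, ← dist_eq_norm] at h4
    have h5 : K * ‖x - x₀‖ ≤ K * (2 * ρ) := by gcongr; exact hdist x hx x₀ hx₀
    rw [mem_ball] at hy₀ ⊢
    have := dist_triangle (g x) y₀ b
    nlinarith
  choose nx hnx0 hnx using step
  let u0 : G := ⟨fun _ => b, by fun_prop, fun x _ => by simp [hR]⟩
  let u : ℕ → G := fun k => nx^[k] u0
  have hu : ∀ k, u (k+1) = nx (u k) := fun k => Function.iterate_succ_apply' _ _ _
  have hdiff : ∀ k, ∀ x ∈ ball a ρ, ‖(u (k+1)).1 x - (u k).1 x‖ ≤ (2 * R) * (1/2)^k := by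
    intro k
    induction k with
    | zero =>
      intro x hx
      have h1 := (u 1).2.2 x hx
      have h2 := (u 0).2.2 x hx
      rw [mem_ball] at h1 h2
      rw [← dist_eq_norm]
      have := dist_triangle_right ((u 1).1 x) ((u 0).1 x) b
      simp only [pow_zero, mul_one, zero_add]
      linarith
    | succ k ih =>
      intro x hx
      have h1 : ∀ x ∈ ball a ρ, HasDerivAt (fun x => (u (k+1+1)).1 x - (u (k+1)).1 x)
          (f (x, (u (k+1)).1 x) - f (x, (u k).1 x)) x := by
        intro x hx
        rw [hu (k+1)]
        have := (hnx (u (k+1)) x hx).sub (hnx (u k) x hx)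
        rw [← hu k] at this
        exact this
      have h2 := mv_ball (C := L * (2 * R * (1/2)^k)) h1 (fun x hx => (hLip x hx _
        (ball_subset_closedBall ((u (k+1)).2.2 x hx)) _
        (ball_subset_closedBall ((u k).2.2 x hx))).trans (by gcongr; exact ih x hx)) hx₀ hx
      have e1 : (u (k+1+1)).1 x₀ - (u (k+1)).1 x₀ = 0 := by
        rw [hu (k+1), hnx0, hu k, hnx0, sub_self]
      rw [e1, sub_zero] at h2
      refine h2.trans ?_
      have h3 := hdist x hx x₀ hx₀
      calc _ ≤ L * (2 * R * (1/2)^k) * (2 * ρ) := by gcongr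
        _ = (ρ * (2 * L)) * (2 * R * (1/2)^k) := by ring
        _ ≤ 1/2 * (2 * R * (1/2)^k) := by gcongr
        _ = _ := by ring
  have hlim : ∀ x ∈ ball a ρ, ∃ y, Tendsto (fun k => (u k).1 x) atTop (𝓝 y) := by
    intro x hx
    refine cauchySeq_tendsto_of_complete (cauchySeq_of_le_geometric (1/2) (2 * R) (by norm_num) ?_)
    intro k
    rw [dist_comm, dist_eq_norm]
    exact hdiff k x hx
  choose! Y hY using hlim
  have hYu : ∀ k, ∀ x ∈ ball a ρ, dist ((u k).1 x) (Y x) ≤ 2 * R * (1/2)^k / (1 - 1/2) := by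
    intro k x hx
    refine dist_le_of_le_geometric_of_tendsto (1/2) (2 * R) (by norm_num) ?_ (hY x hx) k
    intro k
    rw [dist_comm, dist_eq_norm]
    exact hdiff k x hx
  have hYR : ∀ x ∈ ball a ρ, Y x ∈ closedBall b R := fun x hx =>
    isClosed_closedBall.mem_of_tendsto (hY x hx)
      (Eventually.of_forall fun k => ball_subset_closedBall ((u k).2.2 x hx))
  have hYx0 : Y x₀ = y₀ := by
    refine tendsto_nhds_unique (hY x₀ hx₀) ?_
    refine tendsto_const_nhds.congr' ?_
    filter_upwards [eventually_ge_atTop 1] with k hk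
    obtain ⟨j, rfl⟩ := Nat.exists_eq_add_of_le' hk
    rw [hu j, hnx0]
  have hYd : ∀ x ∈ ball a ρ, HasDerivAt Y (f (x, Y x)) x := by
    intro x hx
    have hunif : TendstoUniformlyOn (fun k x => f (x, (u k).1 x)) (fun x => f (x, Y x)) atTop
        (ball a ρ) := by
      rw [Metric.tendstoUniformlyOn_iff]
      intro ε hε
      have ht : Tendsto (fun k : ℕ => L * (2 * R * (1/2)^k / (1 - 1/2))) atTop (𝓝 0) := by
        have := (tendsto_pow_atTop_nhds_zero_of_lt_one (r := (1/2:ℝ)) (by norm_num) (by norm_num))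
        have := ((this.const_mul (2 * R)).div_const (1 - 1/2)).const_mul (L : ℝ)
        simpa using this
      filter_upwards [ht.eventually (eventually_lt_nhds hε)] with k hk x hx
      rw [dist_comm, dist_eq_norm]
      refine lt_of_le_of_lt (hLip x hx _ (ball_subset_closedBall ((u k).2.2 x hx)) _ (hYR x hx)) ?_
      refine lt_of_le_of_lt ?_ hk
      rw [← dist_eq_norm]
      gcongr
      exact hYu k x hx
    have h1 := hasDerivAt_of_tendstoUniformlyOn (f := fun k => (u (k+1)).1) (g := Y) isOpen_ball
      hunif (Eventually.of_forall fun k x hx => by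
        have := hnx (u k) x hx
        rw [← hu k] at this
        exact this) (fun x hx => ((tendsto_add_atTop_iff_nat 1).2 (hY x hx))) hx
    exact h1
  refine ⟨Y, hYx0, fun x hx => ⟨hYd x hx, ?_⟩⟩
  have h4 : ‖Y x - Y x₀‖ ≤ K * ‖x - x₀‖ := mv_ball hYd
      (fun x hx => (hball _ (hmem x hx _ (hYR x hx))).1.2) hx₀ hx
  rw [hYx0, ← dist_eq_norm] at h4
  have h5 : K * ‖x - x₀‖ ≤ K * (2 * ρ) := by gcongr; exact hdist x hx x₀ hx₀
  rw [mem_ball] at hy₀ ⊢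
  have := dist_triangle (Y x) y₀ b
  nlinarith



lemma local_uniq {E : Type*} [NormedAddCommGroup E] [NormedSpace ℂ E] {e e' : ℂ → E} {z₀ : ℂ}
    {C : ℝ} (hC : 0 ≤ C) (h : ∀ᶠ z in 𝓝 z₀, HasDerivAt e (e' z) z ∧ ‖e' z‖ ≤ C * ‖e z‖) (h0 : e z₀ = 0) :
    ∀ᶠ z in 𝓝 z₀, e z = 0 := by
  have hcont : ContinuousAt e z₀ := h.self_of_nhds.1.continuousAt
  have hb : ∀ᶠ z in 𝓝 z₀, ‖e z‖ < 1 := by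
    have := hcont.norm
    rw [ContinuousAt, h0, norm_zero] at this
    exact this.eventually (eventually_lt_nhds one_pos)
  obtain ⟨r, hr, hball⟩ := Metric.eventually_nhds_iff_ball.1 (h.and hb)
  obtain ⟨r', hr', hr'r, hrC⟩ : ∃ r' > 0, r' ≤ r ∧ C * r' ≤ 1/2 := by
    refine ⟨min r (1 / (2 * (C+1))), by positivity, min_le_left _ _, ?_⟩
    calc _ ≤ (C+1) * (1 / (2 * (C+1))) := by
          gcongr
          · linarith
          · exact min_le_right _ _
      _ = 1/2 := by field_simp
  have hsub : ball z₀ r' ⊆ ball z₀ r := ball_subset_ball hr'r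
  have key : ∀ k : ℕ, ∀ z ∈ ball z₀ r', ‖e z‖ ≤ (1/2)^k := by
    intro k
    induction k with
    | zero => intro z hz; simpa using (hball z (hsub hz)).2.le
    | succ k ih =>
      intro z hz
      have := mv_ball (C := C * (1/2)^k) (fun z hz => (hball z (hsub hz)).1.1)
        (fun z hz => (hball z (hsub hz)).1.2.trans (by gcongr; exact ih z hz)) (mem_ball_self hr') hz
      rw [h0, sub_zero] at this
      have hz' : ‖z - z₀‖ ≤ r' := by rw [← dist_eq_norm]; exact (mem_ball.1 hz).le
      calc ‖e z‖ ≤ C * (1/2)^k * ‖z - z₀‖ := this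
        _ ≤ C * (1/2)^k * r' := by gcongr
        _ = (C * r') * (1/2)^k := by ring
        _ ≤ 1/2 * (1/2)^k := by gcongr
        _ = _ := by ring
  filter_upwards [ball_mem_nhds z₀ hr'] with z hz
  have h1 : ‖e z‖ ≤ 0 := ge_of_tendsto'
    (tendsto_pow_atTop_nhds_zero_of_lt_one (r := (1/2:ℝ)) (by norm_num) (by norm_num))
    (fun k => key k z hz)
  simpa using h1

lemma painleve {E : Type*} [NormedAddCommGroup E] [NormedSpace ℂ E] [CompleteSpace E]
    (f : ℂ × E → E) (a : ℂ) (b : E) (hf : AnalyticAt ℂ f (a, b))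
    (γ : ℝ → ℂ) (s₀ : ℝ) (hs₀ : s₀ < 1) (hγ : ContinuousOn γ (Set.Ico s₀ 1))
    (x x' : ℂ → ℂ) (y : ℂ → E)
    (hloc : ∀ s ∈ Set.Ico s₀ 1, ∀ᶠ z in 𝓝 (γ s),
      HasDerivAt x (x' z) z ∧ HasDerivAt y (x' z • f (x z, y z)) z)
    (hx : Tendsto (fun s => x (γ s)) (𝓝[<] 1) (𝓝 a))
    (hy : MapClusterPt b (𝓝[<] (1:ℝ)) (fun s => y (γ s))) :
    ∃ Y : ℂ → E, AnalyticAt ℂ Y a ∧ (∀ᶠ x in 𝓝 a, HasDerivAt Y (f (x, Y x)) x) ∧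
      ∀ᶠ s in 𝓝[<] (1:ℝ), y (γ s) = Y (x (γ s)) := by
  obtain ⟨ρ, hρ, R, hR, L, hL, hLip, hex⟩ := ode_exists f a b hf
  have h1 : ∀ᶠ s in 𝓝[<] (1:ℝ), x (γ s) ∈ ball a ρ := hx.eventually (ball_mem_nhds a hρ)
  obtain ⟨s₁, hs₁, hs₁'⟩ := (mem_nhdsLT_iff_exists_Ioo_subset).1 h1
  have h2 : ∃ᶠ s in 𝓝[<] (1:ℝ), y (γ s) ∈ ball b (R/2) :=
    hy.frequently (ball_mem_nhds b (by positivity))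
  have h3 : ∀ᶠ s in 𝓝[<] (1:ℝ), s ∈ Set.Ioo (max s₀ s₁) 1 :=
    Ioo_mem_nhdsLT (max_lt hs₀ hs₁)
  obtain ⟨s₂, hy2, hs2⟩ := (h2.and_eventually h3).exists
  have hs2' : s₀ < s₂ ∧ s₁ < s₂ := max_lt_iff.1 hs2.1
  have hxb : ∀ s ∈ Set.Ico s₂ 1, x (γ s) ∈ ball a ρ := fun s hs =>
    hs₁' ⟨hs2'.2.trans_le hs.1, hs.2⟩
  obtain ⟨Y, hY0, hY⟩ := hex _ (hxb s₂ ⟨le_rfl, hs2.2⟩) _ hy2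
  have hYan : AnalyticAt ℂ Y a := by
    refine DifferentiableOn.analyticAt (s := ball a ρ) ?_ (ball_mem_nhds a hρ)
    exact fun x hx => (hY x hx).1.differentiableAt.differentiableWithinAt
  refine ⟨Y, hYan, ?_, ?_⟩
  · filter_upwards [ball_mem_nhds a hρ] with x hx using (hY x hx).1
  have hsub : Set.Ico s₂ 1 ⊆ Set.Ico s₀ 1 := Set.Ico_subset_Ico_left hs2'.1.le
  have hxc : ∀ s ∈ Set.Ico s₂ 1, ContinuousAt x (γ s) := fun s hs =>
    (hloc s (hsub hs)).self_of_nhds.1.continuousAt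
  have hyc : ∀ s ∈ Set.Ico s₂ 1, ContinuousAt y (γ s) := fun s hs =>
    (hloc s (hsub hs)).self_of_nhds.2.continuousAt
  have hYc : ∀ s ∈ Set.Ico s₂ 1, ContinuousAt Y (x (γ s)) := fun s hs =>
    (hY _ (hxb s hs)).1.continuousAt
  have hprop : ∀ s ∈ Set.Ico s₂ 1, y (γ s) = Y (x (γ s)) →
      ∀ᶠ z in 𝓝 (γ s), y z = Y (x z) := by
    intro s hs heq
    have e1 : ∀ᶠ z in 𝓝 (γ s), x z ∈ ball a ρ :=
      (hxc s hs).eventually (isOpen_ball.mem_nhds (hxb s hs))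
    have e2 : ∀ᶠ z in 𝓝 (γ s), y z ∈ ball b R :=
      (hyc s hs).eventually (isOpen_ball.mem_nhds (by rw [heq]; exact (hY _ (hxb s hs)).2))
    have hxan : AnalyticAt ℂ x (γ s) := by
      rw [Complex.analyticAt_iff_eventually_differentiableAt]
      exact (hloc s (hsub hs)).mono fun z hz => hz.1.differentiableAt
    have e3 : ∀ᶠ z in 𝓝 (γ s), ‖x' z‖ ≤ ‖deriv x (γ s)‖ + 1 := by
      have := hxan.deriv.continuousAt.norm
      filter_upwards [this.eventually (eventually_lt_nhds (b := ‖deriv x (γ s)‖ + 1) (by simp)),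
        hloc s (hsub hs)] with z hz hz2
      rw [← hz2.1.deriv]; exact hz.le
    have key : ∀ᶠ z in 𝓝 (γ s), (fun z => y z - Y (x z)) z = 0 := by
      refine local_uniq (e' := fun z => x' z • f (x z, y z) - x' z • f (x z, Y (x z)))
        (C := (‖deriv x (γ s)‖ + 1) * L) (by positivity) ?_ (by simp [heq])
      filter_upwards [e1, e2, e3, hloc s (hsub hs)] with z z1 z2 z3 z4
      refine ⟨z4.2.sub ((hY _ z1).1.scomp z z4.1), ?_⟩
      rw [← smul_sub, norm_smul, mul_assoc]
      gcongr
      exact hLip _ z1 _ (ball_subset_closedBall z2) _ (ball_subset_closedBall (hY _ z1).2)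
    filter_upwards [key] with z hz
    exact sub_eq_zero.1 hz
  have hall : ∀ s ∈ Set.Ico s₂ 1, y (γ s) = Y (x (γ s)) := by
    intro s₃ hs₃
    have hsub3 : Set.Icc s₂ s₃ ⊆ Set.Ico s₂ 1 := fun s hs => ⟨hs.1, hs.2.trans_lt hs₃.2⟩
    have hγc : ContinuousOn γ (Set.Icc s₂ s₃) := hγ.mono (hsub3.trans hsub)
    have hcl : IsClosed ({s | y (γ s) = Y (x (γ s))} ∩ Set.Icc s₂ s₃) := by
      have hc1 : ContinuousOn (fun s => y (γ s)) (Set.Icc s₂ s₃) := fun s hs =>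
        (hyc s (hsub3 hs)).comp_continuousWithinAt (hγc s hs)
      have hc2 : ContinuousOn (fun s => Y (x (γ s))) (Set.Icc s₂ s₃) := fun s hs => by
        have h0 : ContinuousWithinAt (fun s => x (γ s)) (Set.Icc s₂ s₃) s :=
          (hxc s (hsub3 hs)).comp_continuousWithinAt (hγc s hs)
        exact ContinuousAt.comp_continuousWithinAt (f := fun s => x (γ s)) (hYc s (hsub3 hs)) h0
      have := (hc1.sub hc2).preimage_isClosed_of_isClosed isClosed_Icc (isClosed_singleton (x := (0:E)))
      convert this using 1
      ext s
      simp [sub_eq_zero, and_comm]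
    have := hcl.Icc_subset_of_forall_mem_nhdsWithin (by simpa using hY0.symm) ?_
    · exact this ⟨hs₃.1, le_rfl⟩
    · rintro s ⟨hs, hs'⟩
      have hγs : Tendsto γ (𝓝[>] s) (𝓝 (γ s)) := by
        have : ContinuousWithinAt γ (Set.Ico s₀ 1) s := hγ s (hsub (hsub3 (Set.Ico_subset_Icc_self hs')))
        refine (this.mono_of_mem_nhdsWithin ?_).tendsto
        have : Set.Ioo s 1 ∈ 𝓝[>] s := Ioo_mem_nhdsGT (hs'.2.trans hs₃.2)
        refine mem_of_superset this fun t ht => ⟨?_, ht.2⟩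
        exact (hs2'.1.le.trans hs'.1).trans ht.1.le
      exact hγs.eventually (hprop s (hsub3 (Set.Ico_subset_Icc_self hs')) hs)
  filter_upwards [Ioo_mem_nhdsLT hs2.2] with s hs using hall s ⟨hs.1.le, hs.2⟩



lemma analytic_hasSum {Φ : ℂ → ℂ} (h : AnalyticAt ℂ Φ 0) :
    ∃ C : ℕ → ℂ, ∃ r > (0:ℝ), ∀ t : ℂ, ‖t‖ < r → HasSum (fun k => C k * t ^ k) (Φ t) := by
  obtain ⟨p, r, hp⟩ := h
  refine ⟨p.coeff, min r.toReal 1 |> fun x => if r = ⊤ then 1 else r.toReal, ?_, ?_⟩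
  · dsimp
    split_ifs with h
    · norm_num
    · exact ENNReal.toReal_pos hp.r_pos.ne' h
  · intro t ht
    have hmem : t ∈ eball (0:ℂ) r := by
      rw [mem_eball, edist_zero_right]
      dsimp at ht
      split_ifs at ht with h
      · rw [h]; exact enorm_lt_top
      · rw [← ofReal_norm]
        exact (ENNReal.ofReal_lt_iff_lt_toReal (norm_nonneg _) h).2 ht
    have := hp.hasSum hmem
    simp only [zero_add] at this
    have he : (fun k => p.coeff k * t ^ k) = fun n => (p n) fun _ => t := by
      funext k
      rw [FormalMultilinearSeries.apply_eq_pow_smul_coeff, smul_eq_mul, mul_comm]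
    rw [he]; exact this

lemma output_lemma (κ a1 a2 : ℕ) (γ : ℝ → ℂ) (u1 u2 : ℝ → ℂ) (τ : ℝ → ℂ) (Φ1 Φ2 : ℂ → ℂ)
    (hΦ1 : AnalyticAt ℂ Φ1 0) (hΦ2 : AnalyticAt ℂ Φ2 0)
    (hτ0 : Tendsto τ (𝓝[<] 1) (𝓝 0))
    (h : ∀ᶠ s in 𝓝[<] (1:ℝ), ContinuousAt τ s ∧ τ s ≠ 0 ∧ τ s ^ κ = γ s - γ 1 ∧
      u1 s * τ s ^ a1 = Φ1 (τ s) ∧ u2 s * τ s ^ a2 = Φ2 (τ s)) :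
    ∃ r > (0 : ℝ), ∃ C₁ C₂ : ℕ → ℂ,
      (∀ t : ℂ, ‖t‖ < r →
        Summable (fun k : ℕ => C₁ k * t ^ k) ∧ Summable fun k : ℕ => C₂ k * t ^ k) ∧
      ∃ δ ∈ Set.Ioo (0 : ℝ) 1, ∃ τ : ℝ → ℂ,
        ContinuousOn τ (Set.Ico (1 - δ) 1) ∧
        ∀ s ∈ Set.Ico (1 - δ) 1,
          τ s ≠ 0 ∧ ‖τ s‖ < r ∧
          τ s ^ κ = γ s - γ 1 ∧
          HasSum (fun k : ℕ => C₁ k * τ s ^ k) (u1 s * τ s ^ a1) ∧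
          HasSum (fun k : ℕ => C₂ k * τ s ^ k) (u2 s * τ s ^ a2) := by
  obtain ⟨C₁, r₁, hr₁, h₁⟩ := analytic_hasSum hΦ1
  obtain ⟨C₂, r₂, hr₂, h₂⟩ := analytic_hasSum hΦ2
  refine ⟨min r₁ r₂, lt_min hr₁ hr₂, C₁, C₂, fun t ht =>
    ⟨(h₁ t (ht.trans_le (min_le_left _ _))).summable, (h₂ t (ht.trans_le (min_le_right _ _))).summable⟩, ?_⟩
  have h3 : ∀ᶠ s in 𝓝[<] (1:ℝ), τ s ∈ ball 0 (min r₁ r₂) :=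
    hτ0.eventually (ball_mem_nhds _ (lt_min hr₁ hr₂))
  obtain ⟨s₁, hs₁, hs₁'⟩ := (mem_nhdsLT_iff_exists_Ioo_subset).1 (h.and h3)
  have hs₁2 : s₁ < 1 := hs₁
  refine ⟨(min (1 - s₁) 1) / 2, ⟨?_, ?_⟩, τ, ?_, ?_⟩
  · have : 0 < 1 - s₁ := by linarith
    positivity
  · have := min_le_right (1 - s₁) 1
    linarith
  all_goals
    have key : ∀ s ∈ Set.Ico (1 - (min (1 - s₁) 1) / 2) 1, s ∈ Set.Ioo s₁ 1 := by
      intro s hs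
      refine ⟨?_, hs.2⟩
      have := min_le_left (1 - s₁) 1
      have := hs.1
      linarith
  · exact fun s hs => (hs₁' (key s hs)).1.1.continuousWithinAt
  · intro s hs
    obtain ⟨⟨_, a, b, c, d⟩, e⟩ := hs₁' (key s hs)
    rw [mem_ball_zero_iff] at e
    refine ⟨a, e, b, ?_, ?_⟩
    · rw [c]; exact h₁ _ (e.trans_le (min_le_left _ _))
    · rw [d]; exact h₂ _ (e.trans_le (min_le_right _ _))

lemma pow_tendsto_zero {ι : Type*} {l : Filter ι} {τ : ι → ℂ} {κ : ℕ} (hκ : κ ≠ 0)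
    (h : Tendsto (fun s => τ s ^ κ) l (𝓝 0)) : Tendsto τ l (𝓝 0) := by
  rw [tendsto_zero_iff_norm_tendsto_zero] at h ⊢
  simp only [norm_pow] at h
  rw [Metric.tendsto_nhds] at h ⊢
  intro ε hε
  filter_upwards [h (ε ^ κ) (by positivity)] with s hs
  simp only [dist_zero_right, norm_pow, norm_norm] at hs ⊢
  exact lt_of_pow_lt_pow_left₀ κ hε.le hs

lemma root_lift (κ : ℕ) (hκ : κ ≠ 0) (γ : ℝ → ℂ) (hγ : ContinuousOn γ (Set.Icc 0 1))
    (hne : ∀ s ∈ Set.Ico (0 : ℝ) 1, γ s ≠ γ 1) :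
    ∃ τ : ℝ → ℂ, Tendsto τ (𝓝[<] 1) (𝓝 0) ∧ ∀ s ∈ Set.Ioo (0:ℝ) 1,
      ContinuousAt τ s ∧ τ s ≠ 0 ∧ τ s ^ κ = γ s - γ 1 := by
  have hsc : IsSimplyConnected (Set.Ioo (0:ℝ) 1) := by
    have hc := (convex_Ioo (0:ℝ) 1).contractibleSpace ⟨1/2, by norm_num⟩
    unfold IsSimplyConnected
    infer_instance
  obtain ⟨τ, hτc, hτ⟩ := Complex.exists_continuousOn_pow_eq (g := fun s => γ s - γ 1) hsc isOpen_Ioo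
    ((hγ.mono Set.Ioo_subset_Icc_self).sub continuousOn_const)
    (by rintro ⟨s, hs, h⟩; exact hne s ⟨hs.1.le, hs.2⟩ (sub_eq_zero.1 h)) hκ
  refine ⟨τ, ?_, ?_⟩
  · apply pow_tendsto_zero hκ
    simp only [hτ]
    have : ContinuousWithinAt γ (Set.Icc 0 1) 1 := hγ 1 (by norm_num)
    have h2 : ContinuousWithinAt γ (Set.Iio 1) 1 := by
      apply this.mono_of_mem_nhdsWithin
      exact Icc_mem_nhdsLT (by norm_num)
    have := h2.tendsto.sub_const (γ 1)
    simpa using this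
  · intro s hs
    refine ⟨hτc.continuousAt (Ioo_mem_nhds hs.1 hs.2), ?_, hτ s⟩
    intro h0
    have := hτ s
    simp only [h0, zero_pow hκ] at this
    exact hne s ⟨hs.1.le, hs.2⟩ (sub_eq_zero.1 this.symm)



lemma loc_antitone (g : ℝ → ℝ) (a b : ℝ) (hab : a ≤ b)
    (h : ∀ x ∈ Set.Icc a b, ∀ᶠ t in 𝓝 x, t ∈ Set.Icc a b → (x ≤ t → g t ≤ g x) ∧ (t ≤ x → g x ≤ g t)) :
    g b ≤ g a := by
  set S := {s ∈ Set.Icc a b | g s ≤ g a} with hS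
  have haS : a ∈ S := ⟨⟨le_rfl, hab⟩, le_rfl⟩
  have hbdd : BddAbove S := ⟨b, fun s hs => hs.1.2⟩
  set c := sSup S with hc
  have hcm : c ∈ Set.Icc a b := ⟨le_csSup hbdd haS, csSup_le ⟨a, haS⟩ fun s hs => hs.1.2⟩
  obtain ⟨ε, hε, hb⟩ := Metric.eventually_nhds_iff.1 (h c hcm)
  have hcS : g c ≤ g a := by
    obtain ⟨s, hs, hsc⟩ := exists_lt_of_lt_csSup ⟨a, haS⟩ (show c - ε < sSup S by linarith)
    have hsc' : s ≤ c := le_csSup hbdd hs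
    exact ((hb (by rw [Real.dist_eq, abs_lt]; constructor <;> linarith) hs.1).2 hsc').trans hs.2
  rcases hcm.2.eq_or_lt with h1 | h1
  · rw [← h1]; exact hcS
  · exfalso
    set t := min b (c + ε/2) with ht
    have ht1 : c < t := lt_min h1 (by linarith)
    have ht2 : t ≤ c + ε/2 := min_le_right _ _
    have htm : t ∈ Set.Icc a b := ⟨hcm.1.trans ht1.le, min_le_left _ _⟩
    have := (hb (y := t) (by rw [Real.dist_eq, abs_lt]; constructor <;> linarith) htm).1 ht1.le
    have : t ∈ S := ⟨htm, this.trans hcS⟩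
    have := le_csSup hbdd this
    linarith

lemma path_gronwall (γ : ℝ → ℂ) (s₀ : ℝ) (hs₀ : s₀ < 1) (hγ : ContinuousOn γ (Set.Ico s₀ 1))
    (hvar : eVariationOn γ (Set.Icc s₀ 1) ≠ ⊤) (W : ℂ → ℂ) (C : ℝ) (hC : 0 ≤ C)
    (hW : ∀ s ∈ Set.Ico s₀ 1, ∀ᶠ z in 𝓝 (γ s), ‖W z - W (γ s)‖ ≤ C * (‖W (γ s)‖ + 1) * ‖z - γ s‖) :
    ∃ K, ∀ s ∈ Set.Ico s₀ 1, ‖W (γ s)‖ ≤ K := by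
  set v : ℝ → ℝ := fun s => (eVariationOn γ (Set.Icc s₀ s)).toReal with hv
  have hfin : ∀ s t, s₀ ≤ s → t ≤ 1 → eVariationOn γ (Set.Icc s t) ≠ ⊤ := fun s t hs ht =>
    ne_top_of_le_ne_top hvar (eVariationOn.mono _ (Set.Icc_subset_Icc hs ht))
  have hvd : ∀ s t, s₀ ≤ s → s ≤ t → t ≤ 1 → ‖γ t - γ s‖ ≤ v t - v s := by
    intro s t h1 h2 h3
    have := eVariationOn.Icc_add_Icc γ (s := Set.univ) h1 h2 trivial
    simp only [Set.univ_inter] at this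
    have e2 : v t = v s + (eVariationOn γ (Set.Icc s t)).toReal := by
      rw [hv]; dsimp
      rw [← this, ENNReal.toReal_add (hfin _ _ le_rfl (h2.trans h3)) (hfin _ _ h1 h3)]
    have e3 := eVariationOn.edist_le γ (s := Set.Icc s t) (x := t) (y := s) ⟨h2, le_rfl⟩ ⟨le_rfl, h2⟩
    have e4 := ENNReal.toReal_mono (hfin _ _ h1 h3) e3
    rw [← dist_eq_norm, dist_edist]
    linarith
  have hcW : ∀ s ∈ Set.Ico s₀ 1, ContinuousAt W (γ s) := by
    intro s hs
    rw [ContinuousAt, tendsto_iff_norm_sub_tendsto_zero]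
    have h0 : Tendsto (fun z => C * (‖W (γ s)‖ + 1) * ‖z - γ s‖) (𝓝 (γ s)) (𝓝 0) := by
      have : ContinuousAt (fun z => C * (‖W (γ s)‖ + 1) * ‖z - γ s‖) (γ s) := by fun_prop
      simpa [ContinuousAt] using this
    exact squeeze_zero' (Eventually.of_forall fun z => norm_nonneg _) (hW s hs) h0
  set φ : ℝ → ℝ := fun s => Real.log (1 + ‖W (γ s)‖) with hφ
  have hlog : ∀ x y : ℝ, 0 ≤ x → 0 ≤ y → Real.log (1 + y) - Real.log (1 + x) ≤ (y - x) / (1 + x) := by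
    intro x y hx hy
    rw [← Real.log_div (by positivity) (by positivity)]
    have := Real.log_le_sub_one_of_pos (show 0 < (1+y)/(1+x) by positivity)
    refine this.trans (le_of_eq ?_)
    field_simp; ring
  have hmain : ∀ s ∈ Set.Ico s₀ 1, φ s - 2 * C * v s ≤ φ s₀ - 2 * C * v s₀ := by
    intro b hb
    refine loc_antitone (fun s => φ s - 2 * C * v s) s₀ b hb.1 ?_
    intro x hx
    have hx' : x ∈ Set.Ico s₀ 1 := ⟨hx.1, hx.2.trans_lt hb.2⟩
    have hsub : Set.Icc s₀ b ⊆ Set.Ico s₀ 1 := fun s hs => ⟨hs.1, hs.2.trans_lt hb.2⟩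
    have hγx : ContinuousWithinAt γ (Set.Icc s₀ b) x := (hγ x hx').mono hsub
    have hn : ∀ᶠ z in 𝓝 (γ x), ‖W (γ x)‖ + 1 ≤ 2 * (1 + ‖W z‖) := by
      have := (hcW x hx').norm
      filter_upwards [this.eventually (eventually_gt_nhds (show ‖W (γ x)‖ - 1/2 < ‖W (γ x)‖ by linarith))] with z hz
      have := norm_nonneg (W z)
      linarith
    have := hγx.eventually ((hW x hx').and hn)
    rw [eventually_nhdsWithin_iff] at this
    filter_upwards [this] with t ht htm
    obtain ⟨h1, h2⟩ := ht htm
    have hp : (0:ℝ) < 1 + ‖W (γ x)‖ := by positivity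
    have hp' : (0:ℝ) < 1 + ‖W (γ t)‖ := by positivity
    refine ⟨fun hxt => ?_, fun hxt => ?_⟩
    · have a1 := hvd x t hx.1 hxt (htm.2.trans hb.2.le)
      have a2 := hlog ‖W (γ x)‖ ‖W (γ t)‖ (norm_nonneg _) (norm_nonneg _)
      have a3 : (‖W (γ t)‖ - ‖W (γ x)‖) / (1 + ‖W (γ x)‖) ≤ C * ‖γ t - γ x‖ := by
        rw [div_le_iff₀ hp]
        calc _ ≤ _ := norm_sub_norm_le _ _
          _ ≤ _ := h1
          _ = _ := by ring
      have a4 : C * ‖γ t - γ x‖ ≤ C * (v t - v x) := by gcongr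
      have a5 : 0 ≤ C * ‖γ t - γ x‖ := by positivity
      simp only [hφ]
      nlinarith
    · have a1 := hvd t x htm.1 hxt hx'.2.le
      have a2 := hlog ‖W (γ t)‖ ‖W (γ x)‖ (norm_nonneg _) (norm_nonneg _)
      have a3 : (‖W (γ x)‖ - ‖W (γ t)‖) / (1 + ‖W (γ t)‖) ≤ 2 * C * ‖γ x - γ t‖ := by
        rw [div_le_iff₀ hp', norm_sub_rev]
        calc _ ≤ _ := norm_sub_norm_le _ _
          _ ≤ C * (‖W (γ x)‖ + 1) * ‖γ t - γ x‖ := by rw [norm_sub_rev]; exact h1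
          _ ≤ C * (2 * (1 + ‖W (γ t)‖)) * ‖γ t - γ x‖ := by gcongr
          _ = _ := by ring
      have a4 : 2 * C * ‖γ x - γ t‖ ≤ 2 * C * (v x - v t) := by gcongr
      simp only [hφ]
      nlinarith
  refine ⟨Real.exp (φ s₀ - 2 * C * v s₀ + 2 * C * (eVariationOn γ (Set.Icc s₀ 1)).toReal), fun s hs => ?_⟩
  have h1 := hmain s hs
  have h2 : v s ≤ (eVariationOn γ (Set.Icc s₀ 1)).toReal :=
    ENNReal.toReal_mono hvar (eVariationOn.mono _ (Set.Icc_subset_Icc le_rfl hs.2.le))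
  have h3 : φ s ≤ φ s₀ - 2 * C * v s₀ + 2 * C * (eVariationOn γ (Set.Icc s₀ 1)).toReal := by
    have : 2 * C * v s ≤ 2 * C * (eVariationOn γ (Set.Icc s₀ 1)).toReal := by gcongr
    linarith
  have hp : (0:ℝ) < 1 + ‖W (γ s)‖ := by positivity
  have := (Real.log_le_iff_le_exp hp).1 h3
  linarith



noncomputable def algR {A : Type*} [CommRing A] (n κ e2 : ℕ) (Δ : Polynomial A →+ Polynomial A)
    (h : Polynomial (Polynomial A)) (P : Polynomial A) : Polynomial A :=
  Polynomial.X * Polynomial.derivative (h.eval P) - (n : Polynomial A) * h.eval P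
    - Polynomial.X ^ κ * P ^ e2 * Δ P

lemma algR_step {A : Type*} [CommRing A] [Algebra ℂ A] (n κ e2 : ℕ) (hκ : 1 ≤ κ)
    (Δ : Polynomial A →+ Polynomial A)
    (hΔ : ∀ k p, Polynomial.X ^ k ∣ Δ (Polynomial.C p * Polynomial.X ^ k))
    (h : Polynomial (Polynomial A)) (P : Polynomial A) (k : ℕ) (hk : 1 ≤ k) (p : A) :
    ∃ U, algR n κ e2 Δ h (P + Polynomial.C p * Polynomial.X ^ k) = algR n κ e2 Δ h P
      + ((k : Polynomial A) - (n : Polynomial A)) * h.derivative.eval P * (Polynomial.C p * Polynomial.X ^ k)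
      + Polynomial.X ^ (k+1) * U := by
  obtain ⟨w, hw⟩ := hΔ k p
  set c := Polynomial.C p * Polynomial.X ^ k with hc
  obtain ⟨s, hs⟩ := h.binomExpansion P c
  obtain ⟨κ', rfl⟩ : ∃ κ', κ = κ' + 1 := ⟨κ - 1, by omega⟩
  obtain ⟨k', rfl⟩ : ∃ k', k = k' + 1 := ⟨k - 1, by omega⟩
  obtain ⟨g, hg⟩ := sub_dvd_pow_sub_pow (P + c) P e2
  have hg' : (P + c)^e2 = P^e2 + c * g := by linear_combination hg
  have hcd : Polynomial.X * Polynomial.derivative c = ((k'+1 : ℕ) : Polynomial A) * c := by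
    rw [hc, Polynomial.derivative_C_mul_X_pow]
    simp only [add_tsub_cancel_right, map_mul, Polynomial.C_eq_natCast, pow_succ]
    ring
  have hc2 : c = Polynomial.X ^ (k'+1) * Polynomial.C p := by rw [hc, mul_comm]
  unfold algR
  rw [hs, map_add Δ, hw, hg']
  simp only [Polynomial.derivative_add, Polynomial.derivative_mul, Polynomial.derivative_pow]
  refine ⟨Polynomial.derivative (h.derivative.eval P) * Polynomial.C p
    + Polynomial.derivative s * Polynomial.X^(k'+1) * Polynomial.C p ^ 2
    + s * (2 * Polynomial.C p * Polynomial.C p * ((k' : Polynomial A)+1) * Polynomial.X ^ k')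
    - (n : Polynomial A) * s * Polynomial.X^k' * Polynomial.C p ^ 2
    - Polynomial.X ^ κ' * (P^e2 * w + Polynomial.C p * g * Δ P + Polynomial.X^(k'+1) * Polynomial.C p * g * w), ?_⟩
  push_cast at hcd ⊢
  have ee1 : Polynomial.X * (s * (Polynomial.C 2 * c ^ (2 - 1) * Polynomial.derivative c))
     = s * (2 * c * (((k' : Polynomial A)+1) * c)) := by
    rw [← hcd, show (Polynomial.C (2:A)) = 2 from rfl]; ring
  have ee2 : Polynomial.X * (Polynomial.eval P (Polynomial.derivative h) * Polynomial.derivative c)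
     = Polynomial.eval P (Polynomial.derivative h) * (((k' : Polynomial A)+1) * c) := by
    rw [← hcd]; ring
  simp only [mul_add, ee1, ee2]
  rw [hc2]
  ring

lemma alg_exists {A : Type*} [CommRing A] [Algebra ℂ A] (n κ e2 : ℕ) (hκ : 1 ≤ κ) (hκn : κ ≤ n)
    (Δ : Polynomial A →+ Polynomial A)
    (hΔ : ∀ k p, Polynomial.X ^ k ∣ Δ (Polynomial.C p * Polynomial.X ^ k))
    (h : Polynomial (Polynomial A)) (p0 : A)
    (hunit : ∀ P : Polynomial A, P.coeff 0 = p0 → IsUnit ((h.derivative.eval P).coeff 0))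
    (hstart : (h.eval (Polynomial.C p0)).coeff 0 = 0)
    (hres : ∀ P S : Polynomial A, P.coeff 0 = p0 →
      algR n κ e2 Δ h P = Polynomial.X ^ n * S → S.coeff 0 = 0) :
    ∃ P S Q1 : Polynomial A, P.coeff 0 = p0 ∧ algR n κ e2 Δ h P = Polynomial.X ^ (n + κ) * S ∧
      h.eval P = Polynomial.X ^ κ * Q1 := by
  have key : ∀ k, ∃ P S : Polynomial A, P.coeff 0 = p0 ∧
      algR n κ e2 Δ h P = Polynomial.X ^ (k+1) * S := by
    intro k
    induction k with
    | zero =>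
      refine ⟨Polynomial.C p0, ?_⟩
      have : Polynomial.X ∣ algR n κ e2 Δ h (Polynomial.C p0) := by
        unfold algR
        refine dvd_sub (dvd_sub (dvd_mul_right _ _) ?_) ?_
        · exact Dvd.dvd.mul_left (Polynomial.X_dvd_iff.2 hstart) _
        · rw [mul_assoc]; exact Dvd.dvd.mul_right (dvd_pow_self _ (by omega)) _
      obtain ⟨S, hS⟩ := this
      exact ⟨S, by simp, by simpa using hS⟩
    | succ k ih =>
      obtain ⟨P, S, hP, hS⟩ := ih
      have hSd : Polynomial.X ∣ S - Polynomial.C (S.coeff 0) := by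
        rw [Polynomial.X_dvd_iff]; simp
      obtain ⟨S', hS'⟩ := hSd
      by_cases hkn : k + 1 = n
      · have := hres P S hP (by rw [hS, hkn])
        rw [this] at hS'
        refine ⟨P, S', hP, ?_⟩
        rw [hS, show S = Polynomial.X * S' by simpa using hS']
        ring
      · set H0 := (h.derivative.eval P).coeff 0 with hH0
        have hHd : Polynomial.X ∣ h.derivative.eval P - Polynomial.C H0 := by
          rw [Polynomial.X_dvd_iff]; simp [hH0]
        obtain ⟨H', hH'⟩ := hHd
        obtain ⟨u, hu⟩ := hunit P hP
        set r : ℂ := ((k+1 : ℕ) : ℂ) - n with hr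
        have hr0 : r ≠ 0 := by
          rw [hr, sub_ne_zero]; exact_mod_cast hkn
        set p : A := - (S.coeff 0) * ((u⁻¹ : Aˣ) : A) * algebraMap ℂ A r⁻¹ with hp
        obtain ⟨U, hU⟩ := algR_step n κ e2 hκ Δ hΔ h P (k+1) (by omega) p
        have hrA : (((k+1 : ℕ) : Polynomial A) - (n : Polynomial A)) = Polynomial.C (algebraMap ℂ A r) := by
          rw [hr]; simp
        have hpeq : Polynomial.C (S.coeff 0) + Polynomial.C (algebraMap ℂ A r) * Polynomial.C H0 * Polynomial.C p = 0 := by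
          rw [← Polynomial.C_mul, ← Polynomial.C_mul, ← Polynomial.C_add]
          have : algebraMap ℂ A r * algebraMap ℂ A r⁻¹ = 1 := by
            rw [← map_mul, mul_inv_cancel₀ hr0, map_one]
          have h2 : H0 * ((u⁻¹ : Aˣ) : A) = 1 := by rw [hH0, ← hu]; simp
          rw [hp]
          convert Polynomial.C_0 using 2
          linear_combination (-(S.coeff 0)) * (H0 * ((u⁻¹ : Aˣ) : A)) * this - (S.coeff 0) * h2
        refine ⟨P + Polynomial.C p * Polynomial.X ^ (k+1),
          S' + Polynomial.C (algebraMap ℂ A r) * H' * Polynomial.C p + U, by simp [hP], ?_⟩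
        rw [hU, hS, hrA]
        linear_combination (Polynomial.X ^ (k+1)) * hS' + Polynomial.C (algebraMap ℂ A r) * (Polynomial.C p * Polynomial.X ^ (k+1)) * hH' + (Polynomial.X ^ (k+1)) * hpeq
  obtain ⟨P, S, hP, hS⟩ := key (n + κ - 1)
  rw [show n + κ - 1 + 1 = n + κ by omega] at hS
  have hQ : Polynomial.X ^ κ ∣ h.eval P := by
    rw [Polynomial.X_pow_dvd_iff]
    intro j hj
    have := congrArg (fun q => Polynomial.coeff q j) hS
    simp only [algR, Polynomial.coeff_sub, mul_assoc, Polynomial.coeff_X_pow_mul', Polynomial.coeff_natCast_mul] at this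
    rw [if_neg (by omega), if_neg (by omega), sub_zero] at this
    have h2 : (Polynomial.X * Polynomial.derivative (h.eval P)).coeff j = (j : A) * (h.eval P).coeff j := by
      rcases j with _ | j
      · simp
      · rw [Polynomial.coeff_X_mul, Polynomial.coeff_derivative]; push_cast; ring
    rw [h2, ← sub_mul] at this
    set r : ℂ := (j : ℂ) - n with hr
    have hr0 : r ≠ 0 := by
      rw [hr, sub_ne_zero]; exact_mod_cast (by omega)
    have h3 : ((j : A) - (n:A)) = algebraMap ℂ A r := by rw [hr]; simp
    have h4 : algebraMap ℂ A r⁻¹ * algebraMap ℂ A r = 1 := by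
      rw [← map_mul, inv_mul_cancel₀ hr0, map_one]
    calc _ = algebraMap ℂ A r⁻¹ * (algebraMap ℂ A r * (h.eval P).coeff j) := by
            rw [← mul_assoc, h4, one_mul]
      _ = 0 := by rw [← h3, this, mul_zero]
  obtain ⟨Q1, hQ1⟩ := hQ
  exact ⟨P, S, Q1, hP, hS, hQ1⟩



open Classical in
noncomputable def retr (B : Set ℂ) (c z : ℂ) : ℂ := if z ∈ B then z else c

lemma retr_mem {B : Set ℂ} {c : ℂ} (hc : c ∈ B) (z : ℂ) : retr B c z ∈ B := by
  unfold retr; split_ifs <;> assumption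

lemma retr_of_mem {B : Set ℂ} {c z : ℂ} (hz : z ∈ B) : retr B c z = z := by
  unfold retr; simp [hz]

/-- Analytic functions on B, extended by a constant. -/
noncomputable def AnB (B : Set ℂ) (c : ℂ) : Subalgebra ℂ (ℂ → ℂ) where
  carrier := {f | AnalyticOnNhd ℂ f B ∧ ∀ z, f (retr B c z) = f z}
  mul_mem' := fun {f g} hf hg => ⟨hf.1.mul hg.1, fun z => by simp [hf.2 z, hg.2 z]⟩
  add_mem' := fun {f g} hf hg => ⟨hf.1.add hg.1, fun z => by simp [hf.2 z, hg.2 z]⟩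
  algebraMap_mem' := fun r => ⟨fun _ _ => analyticAt_const, fun z => rfl⟩

lemma retr_retr {B : Set ℂ} {c : ℂ} (hc : c ∈ B) (z : ℂ) : retr B c (retr B c z) = retr B c z :=
  retr_of_mem (retr_mem hc z)

noncomputable def mkAn {B : Set ℂ} {c : ℂ} (hB : IsOpen B) (hc : c ∈ B) (g : ℂ → ℂ) (hg : AnalyticOnNhd ℂ g B) :
    AnB B c := ⟨fun z => g (retr B c z), by
  refine ⟨?_, fun z => by dsimp only; rw [retr_retr hc]⟩
  intro z hz
  refine (hg z hz).congr ?_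
  filter_upwards [hB.mem_nhds hz] with w hw
  rw [retr_of_mem hw]⟩

lemma mkAn_apply {B : Set ℂ} {c : ℂ} (hB : IsOpen B) (hc : c ∈ B) (g : ℂ → ℂ) (hg : AnalyticOnNhd ℂ g B)
    (z : ℂ) : (mkAn hB hc g hg).1 z = g (retr B c z) := rfl

noncomputable def evAn (B : Set ℂ) (c z : ℂ) : AnB B c →+* ℂ :=
  (Pi.evalRingHom (fun _ : ℂ => ℂ) z).comp (AnB B c).val.toRingHom

lemma evAn_apply {B : Set ℂ} {c z : ℂ} (f : AnB B c) : evAn B c z f = f.1 z := rfl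

noncomputable def dAn {B : Set ℂ} {c : ℂ} (hB : IsOpen B) (hc : c ∈ B) : AnB B c →+ AnB B c where
  toFun f := mkAn hB hc (deriv f.1) f.2.1.deriv
  map_zero' := by
    apply Subtype.ext; funext z
    simp only [mkAn_apply]
    simp
  map_add' := fun f g => by
    apply Subtype.ext; funext z
    simp only [mkAn_apply]
    have h1 := (f.2.1 _ (retr_mem hc z)).differentiableAt
    have h2 := (g.2.1 _ (retr_mem hc z)).differentiableAt
    exact deriv_add h1 h2

noncomputable def DAn {B : Set ℂ} {c : ℂ} (hB : IsOpen B) (hc : c ∈ B) :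
    Polynomial (AnB B c) →+ Polynomial (AnB B c) where
  toFun P := P.sum fun k a => Polynomial.C (dAn hB hc a) * Polynomial.X ^ k
  map_zero' := by simp
  map_add' := fun P Q => by
    rw [Polynomial.sum_add_index]
    · intro i; simp
    · intro i a b; rw [map_add, Polynomial.C_add, add_mul]

lemma DAn_CX {B : Set ℂ} {c : ℂ} (hB : IsOpen B) (hc : c ∈ B) (p : AnB B c) (k : ℕ) :
    DAn hB hc (Polynomial.C p * Polynomial.X ^ k) = Polynomial.C (dAn hB hc p) * Polynomial.X ^ k := by
  show (Polynomial.sum (Polynomial.C p * Polynomial.X ^ k) fun k a => Polynomial.C (dAn hB hc a) * Polynomial.X ^ k) = _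
  rw [Polynomial.C_mul_X_pow_eq_monomial, Polynomial.sum_monomial_index]
  simp

/-- evaluation -/
noncomputable def pe {B : Set ℂ} {c : ℂ} (P : Polynomial (AnB B c)) (z V : ℂ) : ℂ :=
  Polynomial.eval₂RingHom (evAn B c z) V P

lemma pe_analytic {B : Set ℂ} {c : ℂ} (P : Polynomial (AnB B c)) (z V : ℂ) (hz : z ∈ B) :
    AnalyticAt ℂ (fun x : ℂ × ℂ => pe P x.1 x.2) (z, V) := by
  induction P using Polynomial.induction_on' with
  | add P Q hP hQ =>
    simp only [pe, map_add] at hP hQ ⊢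
    exact hP.add hQ
  | monomial k a =>
    simp only [pe, Polynomial.coe_eval₂RingHom, Polynomial.eval₂_monomial, evAn_apply]
    have h1 : AnalyticAt ℂ (fun x : ℂ × ℂ => a.1 x.1) (z, V) :=
      AnalyticAt.comp (f := fun x : ℂ × ℂ => x.1) (a.2.1 z hz) analyticAt_fst
    exact h1.mul (analyticAt_snd.pow k)

lemma pe_chain {B : Set ℂ} {c : ℂ} (hB : IsOpen B) (hc : c ∈ B) (P : Polynomial (AnB B c))
    (x y : ℂ → ℂ) (x' y' t : ℂ) (hx : HasDerivAt x x' t) (hy : HasDerivAt y y' t) (hz : x t ∈ B) :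
    HasDerivAt (fun t => pe P (x t) (y t))
      (pe (DAn hB hc P) (x t) (y t) * x' + pe (Polynomial.derivative P) (x t) (y t) * y') t := by
  induction P using Polynomial.induction_on' with
  | add P Q hP hQ =>
    simp only [pe, map_add] at hP hQ ⊢
    refine (hP.add hQ).congr_deriv ?_
    ring
  | monomial k a =>
    rw [← Polynomial.C_mul_X_pow_eq_monomial, DAn_CX]
    simp only [pe, Polynomial.coe_eval₂RingHom, Polynomial.C_mul_X_pow_eq_monomial, Polynomial.eval₂_monomial, evAn_apply, Polynomial.derivative_monomial]
    have h1 : HasDerivAt (fun t => a.1 (x t)) (deriv a.1 (x t) * x') t :=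
      HasDerivAt.comp t (a.2.1 _ hz).differentiableAt.hasDerivAt hx
    have h2 := h1.mul (hy.pow k)
    refine h2.congr_deriv ?_
    have : (dAn hB hc a).1 (x t) = deriv a.1 (x t) := by
      show deriv a.1 (retr B c (x t)) = _
      rw [retr_of_mem hz]
    rw [this]
    have : ((a * (k : AnB B c)) : AnB B c).1 (x t) = a.1 (x t) * k := rfl
    rw [this, Pi.pow_apply]
    ring



noncomputable def hs (J : Finset (ℕ × ℕ)) (k l : ℕ × ℕ → ℕ) (c : ℕ × ℕ → ℂ) (V X : ℂ) : ℂ :=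
  ∑ p ∈ J, c p * V ^ k p * X ^ l p

noncomputable def hX (J : Finset (ℕ × ℕ)) (k l : ℕ × ℕ → ℕ) (c : ℕ × ℕ → ℂ) (V X : ℂ) : ℂ :=
  ∑ p ∈ J, c p * V ^ k p * (l p * X ^ (l p - 1))

/-- V ∂_V h -/
noncomputable def hE (J : Finset (ℕ × ℕ)) (k l : ℕ × ℕ → ℕ) (c : ℕ × ℕ → ℂ) (V X : ℂ) : ℂ :=
  ∑ p ∈ J, c p * (k p * V ^ k p) * X ^ l p

def An2 (B : Set ℂ) (F : ℂ → ℂ → ℂ) : Prop :=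
  ∀ z ∈ B, ∀ V, AnalyticAt ℂ (fun x : ℂ × ℂ => F x.1 x.2) (z, V)

def HD (B : Set ℂ) (P Pz PV : ℂ → ℂ → ℂ) : Prop :=
  An2 B P ∧ An2 B Pz ∧ An2 B PV ∧ ∀ (x y : ℂ → ℂ) (x' y' t : ℂ), HasDerivAt x x' t → HasDerivAt y y' t →
    x t ∈ B → HasDerivAt (fun t => P (x t) (y t)) (Pz (x t) (y t) * x' + PV (x t) (y t) * y') t

/-- the residual -/
noncomputable def resid (J : Finset (ℕ × ℕ)) (k l : ℕ × ℕ → ℕ) (α : ℕ × ℕ → ℂ → ℂ) (n κ e2 : ℕ)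
    (P Pz PV : ℂ → ℂ → ℂ) (z V : ℂ) : ℂ :=
  hE J k l (fun p => α p z) V (P z V) + V * (hX J k l (fun p => α p z) V (P z V) * PV z V)
    - n * hs J k l (fun p => α p z) V (P z V) - V ^ κ * P z V ^ e2 * Pz z V

lemma algR_map {A : Type*} [CommRing A] (n κ e2 : ℕ) (Δ : Polynomial A →+ Polynomial A)
    (h : Polynomial (Polynomial A)) (P : Polynomial A) (φ : Polynomial A →+* ℂ) :
    φ (algR n κ e2 Δ h P) = φ (Polynomial.X * Polynomial.derivative (h.eval P)) - n * φ (h.eval P)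
      - φ Polynomial.X ^ κ * φ P ^ e2 * φ (Δ P) := by
  unfold algR
  simp only [map_sub, map_mul, map_pow, map_natCast]

lemma exists_P (B : Set ℂ) (c : ℂ) (hB : IsOpen B) (hc : c ∈ B) (J : Finset (ℕ × ℕ)) (α : ℕ × ℕ → ℂ → ℂ)
    (hα : ∀ p ∈ J, AnalyticOnNhd ℂ (α p) B) (k l : ℕ × ℕ → ℕ) (n κ e2 : ℕ) (hκ : 1 ≤ κ) (hκn : κ ≤ n)
    (p0 : ℂ → ℂ) (hp0 : AnalyticOnNhd ℂ p0 B)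
    (h0 : ∀ z ∈ B, hs J k l (fun p => α p z) 0 (p0 z) = 0)
    (hu : ∀ z ∈ B, hX J k l (fun p => α p z) 0 (p0 z) ≠ 0)
    (hres : ∀ P Pz PV S, HD B P Pz PV → An2 B S → (∀ z ∈ B, P z 0 = p0 z) →
      (∀ z ∈ B, ∀ V, resid J k l α n κ e2 P Pz PV z V = V ^ n * S z V) → ∀ z ∈ B, S z 0 = 0) :
    ∃ P Pz PV S Q1, HD B P Pz PV ∧ An2 B S ∧ An2 B Q1 ∧ (∀ z ∈ B, P z 0 = p0 z) ∧
      (∀ z ∈ B, ∀ V, resid J k l α n κ e2 P Pz PV z V = V ^ (n + κ) * S z V) ∧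
      (∀ z ∈ B, ∀ V, hs J k l (fun p => α p z) V (P z V) = V ^ κ * Q1 z V) := by
  have hex : ∀ p, ∃ a : AnB B c, p ∈ J → ∀ z ∈ B, a.1 z = α p z := by
    intro p
    by_cases hp : p ∈ J
    · exact ⟨mkAn hB hc (α p) (hα p hp), fun _ z hz => by rw [mkAn_apply, retr_of_mem hz]⟩
    · exact ⟨0, fun h => absurd h hp⟩
  choose a ha using hex
  set h : Polynomial (Polynomial (AnB B c)) :=
    ∑ p ∈ J, Polynomial.C (Polynomial.C (a p) * Polynomial.X ^ k p) * Polynomial.X ^ l p with hh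
  set q0 : AnB B c := mkAn hB hc p0 hp0 with hq0
  have ev : ∀ P : Polynomial (AnB B c), h.eval P = ∑ p ∈ J, Polynomial.C (a p) * Polynomial.X ^ k p * P ^ l p := by
    intro P
    simp [hh, Polynomial.eval_finsetSum]
  have evd : ∀ P : Polynomial (AnB B c), h.derivative.eval P =
      ∑ p ∈ J, Polynomial.C (a p) * Polynomial.X ^ k p * ((l p : Polynomial (AnB B c)) * P ^ (l p - 1)) := by
    intro P
    simp only [hh, Polynomial.derivative_sum, Polynomial.derivative_C_mul_X_pow, Polynomial.eval_finsetSum]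
    refine Finset.sum_congr rfl fun p _ => ?_
    simp; ring
  have pe_h : ∀ (P : Polynomial (AnB B c)), ∀ z ∈ B, ∀ V, pe (h.eval P) z V = hs J k l (fun p => α p z) V (pe P z V) := by
    intro P z hz V
    rw [ev, pe, map_sum, hs]
    refine Finset.sum_congr rfl fun p hp => ?_
    rw [map_mul, map_pow]
    simp [evAn_apply, ha p hp z hz, pe]
  have pe_hX : ∀ (P : Polynomial (AnB B c)), ∀ z ∈ B, ∀ V, pe (h.derivative.eval P) z V = hX J k l (fun p => α p z) V (pe P z V) := by
    intro P z hz V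
    rw [evd, pe, map_sum, hX]
    refine Finset.sum_congr rfl fun p hp => ?_
    rw [map_mul, map_mul _ ((l p : Polynomial (AnB B c))), map_pow]
    simp [evAn_apply, ha p hp z hz, pe]
  have pe_hd : ∀ (P : Polynomial (AnB B c)), ∀ z ∈ B, ∀ V, pe (Polynomial.X * Polynomial.derivative (h.eval P)) z V
      = hE J k l (fun p => α p z) V (pe P z V) + V * (hX J k l (fun p => α p z) V (pe P z V) * pe (Polynomial.derivative P) z V) := by
    intro P z hz V
    have : Polynomial.X * Polynomial.derivative (h.eval P) =
        (∑ p ∈ J, Polynomial.C (a p) * ((k p : Polynomial (AnB B c)) * Polynomial.X ^ k p) * P ^ l p) +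
        Polynomial.X * (h.derivative.eval P * Polynomial.derivative P) := by
      rw [ev, evd, Polynomial.derivative_sum, Finset.mul_sum, Finset.sum_mul, Finset.mul_sum, ← Finset.sum_add_distrib]
      refine Finset.sum_congr rfl fun p _ => ?_
      rw [Polynomial.derivative_mul, Polynomial.derivative_C_mul_X_pow, Polynomial.derivative_pow]
      rcases hk : k p with _ | j
      · simp; ring
      · simp; ring
    rw [this]
    have e1 := pe_hX P z hz V
    unfold pe at *
    rw [map_add, map_mul _ Polynomial.X, map_mul, e1, map_sum, hE]
    congr 1
    · refine Finset.sum_congr rfl fun p hp => ?_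
      rw [map_mul, map_mul, map_pow]
      simp [evAn_apply, ha p hp z hz]
    · simp
  have pe_R : ∀ (P : Polynomial (AnB B c)), ∀ z ∈ B, ∀ V, pe (algR n κ e2 (DAn hB hc) h P) z V
      = resid J k l α n κ e2 (pe P) (pe (DAn hB hc P)) (pe (Polynomial.derivative P)) z V := by
    intro P z hz V
    have e1 := pe_hd P z hz V
    have e3 := pe_h P z hz V
    unfold resid
    rw [← e1, ← e3]
    unfold pe
    rw [algR_map]
    simp
  have pe_0 : ∀ (P : Polynomial (AnB B c)) z, pe P z 0 = (P.coeff 0).1 z := by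
    intro P z
    simp only [pe, Polynomial.coe_eval₂RingHom, Polynomial.eval₂_at_zero]
    rfl
  have hHD : ∀ P : Polynomial (AnB B c), HD B (pe P) (pe (DAn hB hc P)) (pe (Polynomial.derivative P)) :=
    fun P => ⟨fun z hz V => pe_analytic P z V hz, fun z hz V => pe_analytic _ z V hz,
      fun z hz V => pe_analytic _ z V hz, fun x y x' y' t h1 h2 h3 => pe_chain hB hc P x y x' y' t h1 h2 h3⟩
  have q0z : ∀ z ∈ B, q0.1 z = p0 z := fun z hz => by rw [hq0, mkAn_apply, retr_of_mem hz]
  have ext0 : ∀ f : AnB B c, (∀ z ∈ B, f.1 z = 0) → f = 0 := by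
    intro f hf
    apply Subtype.ext; funext z
    rw [← f.2.2 z]; exact hf _ (retr_mem hc z)
  have g1 : ∀ P : Polynomial (AnB B c), P.coeff 0 = q0 → IsUnit ((h.derivative.eval P).coeff 0) := by
    intro P hP
    set f := (h.derivative.eval P).coeff 0 with hf
    have hfz : ∀ z ∈ B, f.1 z ≠ 0 := by
      intro z hz
      rw [hf, ← pe_0, pe_hX P z hz, pe_0, hP, q0z z hz]
      exact hu z hz
    have hfi : AnalyticOnNhd ℂ (fun z => (f.1 z)⁻¹) B := fun z hz => (f.2.1 z hz).inv (hfz z hz)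
    refine IsUnit.of_mul_eq_one (mkAn hB hc _ hfi) ?_
    apply Subtype.ext; funext z
    show f.1 z * (f.1 (retr B c z))⁻¹ = 1
    rw [f.2.2 z, mul_inv_cancel₀]
    rw [← f.2.2 z]; exact hfz _ (retr_mem hc z)
  have g2 : (h.eval (Polynomial.C q0)).coeff 0 = 0 := by
    apply ext0
    intro z hz
    rw [← pe_0, pe_h _ z hz, pe_0, Polynomial.coeff_C_zero, q0z z hz]
    exact h0 z hz
  have g3 : ∀ P S : Polynomial (AnB B c), P.coeff 0 = q0 → algR n κ e2 (DAn hB hc) h P = Polynomial.X ^ n * S → S.coeff 0 = 0 := by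
    intro P S hP hS
    apply ext0
    intro z hz
    rw [← pe_0]
    refine hres (pe P) (pe (DAn hB hc P)) (pe (Polynomial.derivative P)) (pe S) (hHD P)
      (fun z hz V => pe_analytic S z V hz) ?_ ?_ z hz
    · intro z hz; rw [pe_0, hP, q0z z hz]
    · intro z hz V
      rw [← pe_R P z hz V, hS]; simp [pe]
  obtain ⟨P, S, Q1, r1, r2, r3⟩ := alg_exists n κ e2 hκ hκn (DAn hB hc)
    (fun k p => by rw [DAn_CX]; exact dvd_mul_left _ _) h q0 g1 g2 g3
  · refine ⟨pe P, pe (DAn hB hc P), pe (Polynomial.derivative P), pe S, pe Q1, hHD P,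
      fun z hz V => pe_analytic S z V hz, fun z hz V => pe_analytic Q1 z V hz, ?_, ?_, ?_⟩
    · intro z hz; rw [pe_0, r1, q0z z hz]
    · intro z hz V
      rw [← pe_R P z hz V, r2]; simp [pe]
    · intro z hz V
      rw [← pe_h P z hz V, r3]; simp [pe]



structure Par (M N d a1 a2 n κ e f e2 : ℕ) : Prop where
  hN1 : N + 1 = d * a1
  hM1 : M + 1 = d * a2
  hn : n = d * a1 * a2
  hκ : κ + a1 + a2 = n
  hef : e * a1 = 1 + f * a2
  he2 : e2 + 1 = e + f
  he : 1 ≤ e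
  hd : 1 ≤ d
  ha1 : 1 ≤ a1
  ha2 : 1 ≤ a2
  hκ1 : 1 ≤ κ

def JJ (M N : ℕ) : Finset (ℕ × ℕ) := insert (M + 1, 0) (insert (0, N + 1) (idxI M N))
def kk (n a1 a2 : ℕ) (p : ℕ × ℕ) : ℕ := n - (p.1 * a1 + p.2 * a2)
def ll (e f : ℕ) (p : ℕ × ℕ) : ℕ := f * p.1 + e * p.2

lemma par_exists (M N : ℕ) (hM : 0 < M) (hN : 0 < N) (hMN : 1 < M * N) :
    ∃ n κ e f e2, Par M N (Nat.gcd (Nat.gcd (M + 1) (N + 1)) (M * N - 1))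
      ((N + 1) / Nat.gcd (Nat.gcd (M + 1) (N + 1)) (M * N - 1))
      ((M + 1) / Nat.gcd (Nat.gcd (M + 1) (N + 1)) (M * N - 1)) n κ e f e2 ∧
      κ = (M * N - 1) / Nat.gcd (Nat.gcd (M + 1) (N + 1)) (M * N - 1) ∧
      M * N - 1 = Nat.gcd (Nat.gcd (M + 1) (N + 1)) (M * N - 1) * κ := by
  set g := Nat.gcd (M + 1) (N + 1) with hg
  have hgM : g ∣ M + 1 := Nat.gcd_dvd_left _ _
  have hgN : g ∣ N + 1 := Nat.gcd_dvd_right _ _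
  have hq : M * N - 1 + (M + 1) + (N + 1) = (M + 1) * (N + 1) := by
    have : M * N - 1 + 1 = M * N := Nat.sub_add_cancel hMN.le
    nlinarith
  have hgq : g ∣ M * N - 1 := by
    have h1 : g ∣ (M + 1) + (N + 1) := dvd_add hgM hgN
    have h2 : g ∣ (M * N - 1) + ((M + 1) + (N + 1)) := by
      rw [← add_assoc, hq]; exact hgM.mul_right _
    exact (Nat.dvd_add_left h1).1 h2
  have hd : Nat.gcd g (M * N - 1) = g := Nat.gcd_eq_left hgq
  rw [hd]
  have hgpos : 0 < g := Nat.gcd_pos_of_pos_left _ (by omega)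
  set a1 := (N + 1) / g with ha1
  set a2 := (M + 1) / g with ha2
  set κ := (M * N - 1) / g with hκ
  have e1 : N + 1 = g * a1 := (Nat.mul_div_cancel' hgN).symm
  have e2 : M + 1 = g * a2 := (Nat.mul_div_cancel' hgM).symm
  have e3 : M * N - 1 = g * κ := (Nat.mul_div_cancel' hgq).symm
  have hcop : Nat.Coprime a1 a2 := (Nat.coprime_div_gcd_div_gcd (m := M+1) (n := N+1) hgpos).symm
  have ha1p : 1 ≤ a1 := by
    rcases Nat.eq_zero_or_pos a1 with h | h
    · rw [h] at e1; omega
    · exact h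
  have ha2p : 1 ≤ a2 := by
    rcases Nat.eq_zero_or_pos a2 with h | h
    · rw [h] at e2; omega
    · exact h
  have hκp : 1 ≤ κ := by
    rcases Nat.eq_zero_or_pos κ with h | h
    · rw [h] at e3; omega
    · exact h
  obtain ⟨e, f, hef, he⟩ : ∃ e f, e * a1 = 1 + f * a2 ∧ 1 ≤ e := by
    rcases Nat.lt_or_ge 1 a2 with h | h
    · obtain ⟨m, hm⟩ := Nat.exists_mul_mod_eq_one_of_coprime hcop h
      refine ⟨m, a1 * m / a2, ?_, ?_⟩
      · rw [mul_comm m a1]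
        have := Nat.mod_add_div (a1 * m) a2
        rw [hm.2] at this
        rw [mul_comm (a1 * m / a2) a2]
        exact this.symm
      · rcases Nat.eq_zero_or_pos m with h | h
        · rw [h] at hm; simp at hm
        · exact h
    · have : a2 = 1 := by omega
      rw [this]
      exact ⟨1, a1 - 1, by omega, le_rfl⟩
  refine ⟨g * a1 * a2, κ, e, f, e + f - 1, ⟨e1, e2, rfl, ?_, hef, by omega, he, hgpos, ha1p, ha2p, hκp⟩, rfl, e3⟩
  rw [e1, e2, e3] at hq
  have : g * (κ + a1 + a2) = g * (g * a1 * a2) := by linarith [hq]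
  exact Nat.eq_of_mul_eq_mul_left hgpos this

section
variable {M N d a1 a2 n κ e f e2 : ℕ}

local notation "PAR" => Par M N d a1 a2 n κ e f e2
lemma par_idx (h : PAR) {p : ℕ × ℕ} (hp : p ∈ idxI M N) : p.1 * a1 + p.2 * a2 < n := by
  simp only [idxI, Finset.mem_filter] at hp
  have := hp.2
  rw [h.hN1, h.hM1] at this
  have : d * (p.1 * a1 + p.2 * a2) < d * n := by rw [h.hn]; linarith
  exact lt_of_mul_lt_mul_left this (Nat.zero_le _)

lemma par_kk (h : PAR) {p : ℕ × ℕ} (hp : p ∈ JJ M N) : kk n a1 a2 p + (p.1 * a1 + p.2 * a2) = n := by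
  have : p.1 * a1 + p.2 * a2 ≤ n := by
    simp only [JJ, Finset.mem_insert] at hp
    rcases hp with rfl | rfl | hp
    · simp only [h.hM1, h.hn]; apply le_of_eq; ring
    · simp only [h.hN1, h.hn]; apply le_of_eq; ring
    · exact (par_idx h hp).le
  unfold kk; omega

lemma par_sum (h : PAR) (g : ℕ × ℕ → ℂ) : ∑ p ∈ JJ M N, g p = g (M+1, 0) + (g (0, N+1) + ∑ p ∈ idxI M N, g p) := by
  rw [JJ, Finset.sum_insert, Finset.sum_insert]
  · intro hp
    have := par_idx h hp
    simp only [h.hN1, h.hn] at this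
    nlinarith
  · intro hp
    rcases Finset.mem_insert.1 hp with h1 | hp
    · simp at h1
    · have := par_idx h hp
      simp only [h.hM1, h.hn] at this
      nlinarith

lemma F1_sum (h : PAR) (α : ℕ × ℕ → ℂ → ℂ) (z y1 y2 : ℂ) :
    F₁ M N α z y1 y2 = ∑ p ∈ JJ M N, (p.2 : ℂ) * α p z * y1 ^ p.1 * y2 ^ (p.2 - 1) := by
  rw [par_sum h]; simp [F₁]

lemma F2_sum (h : PAR) (α : ℕ × ℕ → ℂ → ℂ) (z y1 y2 : ℂ) :
    F₂ M N α z y1 y2 = -∑ p ∈ JJ M N, (p.1 : ℂ) * α p z * y1 ^ (p.1 - 1) * y2 ^ p.2 := by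
  rw [par_sum h]; simp [F₂]; ring




noncomputable def Vc (e f : ℕ) (y1 y2 : ℂ) : ℂ := y2 ^ f / y1 ^ e
noncomputable def Xc (a1 a2 : ℕ) (y1 y2 : ℂ) : ℂ := y2 ^ a1 / y1 ^ a2
noncomputable def mon (M N : ℕ) (c : ℕ × ℕ → ℂ) (y1 y2 : ℂ) : ℂ := ∑ p ∈ JJ M N, c p * (y1 ^ p.1 * y2 ^ p.2)


local notation "Vq" => Vc e f
local notation "Xq" => Xc a1 a2
lemma chart1 (h : PAR) {y1 y2 : ℂ} (h1 : y1 ≠ 0) (h2 : y2 ≠ 0) :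
    Vq y1 y2 ^ a1 * y1 = Xq y1 y2 ^ f := by
  unfold Vc Xc
  rw [div_pow, div_pow, ← pow_mul, ← pow_mul, ← pow_mul, ← pow_mul, h.hef, mul_comm a1 f, mul_comm a2 f]
  field_simp
  ring

lemma chart2 (h : PAR) {y1 y2 : ℂ} (h1 : y1 ≠ 0) (h2 : y2 ≠ 0) :
    Vq y1 y2 ^ a2 * y2 = Xq y1 y2 ^ e := by
  unfold Vc Xc
  rw [div_pow, div_pow, ← pow_mul, ← pow_mul, ← pow_mul, ← pow_mul, mul_comm a1 e, mul_comm a2 e, h.hef]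
  field_simp
  ring

lemma Vc_ne {e f : ℕ} {y1 y2 : ℂ} (h1 : y1 ≠ 0) (h2 : y2 ≠ 0) : Vc e f y1 y2 ≠ 0 :=
  div_ne_zero (pow_ne_zero _ h2) (pow_ne_zero _ h1)
lemma Xc_ne {a1 a2 : ℕ} {y1 y2 : ℂ} (h1 : y1 ≠ 0) (h2 : y2 ≠ 0) : Xc a1 a2 y1 y2 ≠ 0 :=
  div_ne_zero (pow_ne_zero _ h2) (pow_ne_zero _ h1)

local notation "HSS" => hs (JJ M N) (kk n a1 a2) (ll e f)
lemma chart_mon (h : PAR) (c : ℕ × ℕ → ℂ) {y1 y2 : ℂ} (h1 : y1 ≠ 0) (h2 : y2 ≠ 0) :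
    Vq y1 y2 ^ n * mon M N c y1 y2 =
      HSS c (Vq y1 y2) (Xq y1 y2) := by
  unfold mon hs
  rw [Finset.mul_sum]
  refine Finset.sum_congr rfl fun p hp => ?_
  have e1 := chart1 h h1 h2
  have e2 := chart2 h h1 h2
  have e3 := par_kk h hp
  set V := Vq y1 y2
  set X := Xq y1 y2
  calc V ^ n * (c p * (y1 ^ p.1 * y2 ^ p.2))
      = V ^ (kk n a1 a2 p + (p.1 * a1 + p.2 * a2)) * (c p * (y1 ^ p.1 * y2 ^ p.2)) := by rw [e3]
    _ = c p * V ^ kk n a1 a2 p * ((V^a1 * y1) ^ p.1 * (V ^ a2 * y2) ^ p.2) := by ring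
    _ = c p * V ^ kk n a1 a2 p * X ^ ll e f p := by rw [e1, e2]; unfold ll; ring

lemma yF1 (h : PAR) (α : ℕ × ℕ → ℂ → ℂ) (z y1 y2 : ℂ) :
    y2 * F₁ M N α z y1 y2 = mon M N (fun p => p.2 * α p z) y1 y2 := by
  rw [F1_sum h, mon, Finset.mul_sum]
  refine Finset.sum_congr rfl fun p _ => ?_
  rcases p with ⟨i, _ | j⟩
  · simp
  · simp; ring

lemma yF2 (h : PAR) (α : ℕ × ℕ → ℂ → ℂ) (z y1 y2 : ℂ) :
    y1 * F₂ M N α z y1 y2 = -mon M N (fun p => p.1 * α p z) y1 y2 := by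
  rw [F2_sum h, mon, mul_neg, Finset.mul_sum]
  congr 1
  refine Finset.sum_congr rfl fun p _ => ?_
  rcases p with ⟨_ | i, j⟩
  · simp
  · simp; ring

lemma chart_y12 (h : PAR) {y1 y2 : ℂ} (h1 : y1 ≠ 0) (h2 : y2 ≠ 0) :
    Vq y1 y2 ^ n * (y1 * y2) = Vq y1 y2 ^ κ * Xq y1 y2 ^ e2 * Xq y1 y2 := by
  have e1 := chart1 h h1 h2
  have e3 := chart2 h h1 h2
  have : Xq y1 y2 ^ e2 * Xq y1 y2 = Xq y1 y2 ^ f * Xq y1 y2 ^ e := by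
    rw [← pow_succ, h.he2, pow_add]; ring
  rw [mul_assoc, this, ← e1, ← e3, ← h.hκ]
  ring

lemma mon_lin (c c' : ℕ × ℕ → ℂ) (A B y1 y2 : ℂ) :
    A * mon M N c y1 y2 + B * mon M N c' y1 y2 = mon M N (fun p => A * c p + B * c' p) y1 y2 := by
  unfold mon
  rw [Finset.mul_sum, Finset.mul_sum, ← Finset.sum_add_distrib]
  exact Finset.sum_congr rfl fun p _ => by ring

local notation "HXX" => hX (JJ M N) (kk n a1 a2) (ll e f)
lemma flowV (h : PAR) (α : ℕ × ℕ → ℂ → ℂ) (z : ℂ) {y1 y2 : ℂ} (h1 : y1 ≠ 0) (h2 : y2 ≠ 0) :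
    Vq y1 y2 ^ κ * Xq y1 y2 ^ e2 * (Vq y1 y2 * (f * F₂ M N α z y1 y2 / y2 - e * F₁ M N α z y1 y2 / y1))
    = - Vq y1 y2 * HXX (fun p => α p z) (Vq y1 y2) (Xq y1 y2) := by
  have hX0 := Xc_ne (a1 := a1) (a2 := a2) h1 h2
  have e12 := chart_y12 h h1 h2
  have e1 := yF1 h α z y1 y2
  have e3 := yF2 h α z y1 y2
  have e4 := chart_mon h (fun p => (ll e f p : ℂ) * α p z) h1 h2
  set V := Vq y1 y2
  set X := Xq y1 y2
  have e5 : X * HXX (fun p => α p z) V X =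
      HSS (fun p => (ll e f p : ℂ) * α p z) V X := by
    unfold hX hs
    rw [Finset.mul_sum]
    refine Finset.sum_congr rfl fun p _ => ?_
    beta_reduce
    generalize ll e f p = m
    rcases m with _ | j
    · simp
    · simp; ring
  have e6 : (f : ℂ) * (y1 * F₂ M N α z y1 y2) - e * (y2 * F₁ M N α z y1 y2) = - mon M N (fun p => (ll e f p : ℂ) * α p z) y1 y2 := by
    rw [e1, e3]
    have := mon_lin (M := M) (N := N) (fun p => (p.1 : ℂ) * α p z) (fun p => (p.2 : ℂ) * α p z) (-f) (-e) y1 y2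
    have h3 : mon M N (fun p => (ll e f p : ℂ) * α p z) y1 y2 = - mon M N (fun p => -(f : ℂ) * ((p.1 : ℂ) * α p z) + -e * ((p.2 : ℂ) * α p z)) y1 y2 := by
      unfold mon
      rw [← Finset.sum_neg_distrib]
      exact Finset.sum_congr rfl fun p _ => by unfold ll; push_cast; ring
    rw [h3, ← this]; ring
  have e7 : V * (f * F₂ M N α z y1 y2 / y2 - e * F₁ M N α z y1 y2 / y1) * (y1 * y2) = - (V * mon M N (fun p => (ll e f p : ℂ) * α p z) y1 y2) := by
    rw [← mul_neg, ← e6]; field_simp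
  apply mul_right_cancel₀ hX0
  linear_combination V^n * e7 - (V * (f * F₂ M N α z y1 y2 / y2 - e * F₁ M N α z y1 y2 / y1)) * e12 - V * e4 + V * e5

local notation "HEE" => hE (JJ M N) (kk n a1 a2) (ll e f)
lemma flowX (h : PAR) (α : ℕ × ℕ → ℂ → ℂ) (z : ℂ) {y1 y2 : ℂ} (h1 : y1 ≠ 0) (h2 : y2 ≠ 0) :
    Vq y1 y2 ^ κ * Xq y1 y2 ^ e2 * (Xq y1 y2 * (a1 * F₂ M N α z y1 y2 / y2 - a2 * F₁ M N α z y1 y2 / y1))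
    = HEE (fun p => α p z) (Vq y1 y2) (Xq y1 y2)
      - n * HSS (fun p => α p z) (Vq y1 y2) (Xq y1 y2) := by
  have hX0 := Xc_ne (a1 := a1) (a2 := a2) h1 h2
  have e12 := chart_y12 h h1 h2
  have e1 := yF1 h α z y1 y2
  have e3 := yF2 h α z y1 y2
  have e4 := chart_mon h (fun p => ((kk n a1 a2 p : ℂ) - n) * α p z) h1 h2
  set V := Vq y1 y2
  set X := Xq y1 y2
  have e5 : HEE (fun p => α p z) V X
      - n * HSS (fun p => α p z) V X =
      HSS (fun p => ((kk n a1 a2 p : ℂ) - n) * α p z) V X := by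
    unfold hE hs
    rw [Finset.mul_sum, ← Finset.sum_sub_distrib]
    exact Finset.sum_congr rfl fun p _ => by ring
  have e6 : (a1 : ℂ) * (y1 * F₂ M N α z y1 y2) - a2 * (y2 * F₁ M N α z y1 y2) = mon M N (fun p => ((kk n a1 a2 p : ℂ) - n) * α p z) y1 y2 := by
    rw [e1, e3]
    have := mon_lin (M := M) (N := N) (fun p => (p.1 : ℂ) * α p z) (fun p => (p.2 : ℂ) * α p z) (-a1) (-a2) y1 y2
    have h3 : mon M N (fun p => ((kk n a1 a2 p : ℂ) - n) * α p z) y1 y2 = mon M N (fun p => -(a1 : ℂ) * ((p.1 : ℂ) * α p z) + -a2 * ((p.2 : ℂ) * α p z)) y1 y2 := by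
      unfold mon
      refine Finset.sum_congr rfl fun p hp => ?_
      have := par_kk h hp
      have h4 : ((kk n a1 a2 p : ℂ) + (p.1 * a1 + p.2 * a2)) = n := by exact_mod_cast this
      linear_combination (α p z * (y1 ^ p.1 * y2 ^ p.2)) * h4
    rw [h3, ← this]; ring
  have e7 : X * (a1 * F₂ M N α z y1 y2 / y2 - a2 * F₁ M N α z y1 y2 / y1) * (y1 * y2) = X * mon M N (fun p => ((kk n a1 a2 p : ℂ) - n) * α p z) y1 y2 := by
    rw [← e6]; field_simp
  apply mul_right_cancel₀ hX0
  linear_combination V^n * e7 - (X * (a1 * F₂ M N α z y1 y2 / y2 - a2 * F₁ M N α z y1 y2 / y1)) * e12 + X * e4 - X * e5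

lemma quot_deriv (i j : ℕ) {y1 y2 : ℂ → ℂ} {y1' y2' t : ℂ} (h1 : HasDerivAt y1 y1' t) (h2 : HasDerivAt y2 y2' t)
    (n1 : y1 t ≠ 0) (n2 : y2 t ≠ 0) :
    HasDerivAt (fun t => y2 t ^ i / y1 t ^ j) (y2 t ^ i / y1 t ^ j * (i * y2' / y2 t - j * y1' / y1 t)) t := by
  have := (h2.pow i).div (h1.pow j) (by simpa using pow_ne_zero j n1)
  refine this.congr_deriv ?_
  simp only [Pi.pow_apply]
  rcases i with _ | i <;> rcases j with _ | j <;> simp <;> field_simp <;> ring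

lemma mon_deriv (α : ℕ × ℕ → ℂ → ℂ) (y1 y2 : ℂ → ℂ) (h : PAR) (z : ℂ)
    (hα : ∀ p ∈ JJ M N, DifferentiableAt ℂ (α p) z)
    (h1 : HasDerivAt y1 (F₁ M N α z (y1 z) (y2 z)) z) (h2 : HasDerivAt y2 (F₂ M N α z (y1 z) (y2 z)) z) :
    HasDerivAt (fun z => mon M N (fun p => α p z) (y1 z) (y2 z)) (mon M N (fun p => deriv (α p) z) (y1 z) (y2 z)) z := by
  unfold mon
  have : ∀ p ∈ JJ M N, HasDerivAt (fun z => α p z * (y1 z ^ p.1 * y2 z ^ p.2))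
      (deriv (α p) z * (y1 z ^ p.1 * y2 z ^ p.2) + ((p.1 * α p z * y1 z ^ (p.1 - 1) * y2 z ^ p.2) * F₁ M N α z (y1 z) (y2 z)
      + (p.2 * α p z * y1 z ^ p.1 * y2 z ^ (p.2 - 1)) * F₂ M N α z (y1 z) (y2 z))) z := by
    intro p hp
    have := (hα p hp).hasDerivAt.mul ((h1.pow p.1).mul (h2.pow p.2))
    refine this.congr_deriv ?_
    simp only [Pi.pow_apply, Pi.mul_apply]
    ring
  have := HasDerivAt.fun_sum this
  refine this.congr_deriv ?_
  rw [Finset.sum_add_distrib, Finset.sum_add_distrib, ← Finset.sum_mul, ← Finset.sum_mul, ← F1_sum h]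
  have := F2_sum h α z (y1 z) (y2 z)
  linear_combination F₁ M N α z (y1 z) (y2 z) * this



lemma order_lemma (r A B : ℂ → ℂ) (D : ℕ) (L : ℂ) (hr : AnalyticAt ℂ r 0)
    (hA : Tendsto A (𝓝[≠] 0) (𝓝 (D:ℂ))) (hB : Tendsto B (𝓝[≠] 0) (𝓝 L))
    (h : ∀ᶠ t in 𝓝[≠] (0:ℂ), t * deriv r t = A t * r t + B t * t ^ D) : L = 0 := by
  have hne : ∀ᶠ t in 𝓝[≠] (0:ℂ), t ≠ 0 := eventually_mem_nhdsWithin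
  by_cases h0 : ∀ᶠ t in 𝓝 (0:ℂ), r t = 0
  · have h1 : ∀ᶠ t in 𝓝[≠] (0:ℂ), B t = 0 := by
      have hd : ∀ᶠ t in 𝓝 (0:ℂ), deriv r t = 0 := by
        filter_upwards [eventually_eventually_nhds.2 h0] with t ht
        have : r =ᶠ[𝓝 t] fun _ => 0 := ht
        rw [this.deriv_eq]; simp
      filter_upwards [h, hne, h0.filter_mono nhdsWithin_le_nhds, hd.filter_mono nhdsWithin_le_nhds] with t h1 h2 h3 h4
      rw [h3, h4] at h1
      simpa [h2] using h1.symm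
    exact tendsto_nhds_unique (hB.congr' h1) tendsto_const_nhds
  · obtain ⟨m, ρ, hρ, hρ0, hrρ⟩ := hr.exists_eventuallyEq_pow_smul_nonzero_iff.2 h0
    simp only [sub_zero, smul_eq_mul] at hrρ
    have hd : ∀ᶠ t in 𝓝 (0:ℂ), t * deriv r t = t ^ m * (m * ρ t + t * deriv ρ t) := by
      filter_upwards [eventually_eventually_nhds.2 hrρ, hρ.eventually_analyticAt] with t ht ht2
      have : r =ᶠ[𝓝 t] fun z => z ^ m * ρ z := ht
      rw [this.deriv_eq]
      have h3 := (hasDerivAt_pow m t).mul ht2.differentiableAt.hasDerivAt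
      rw [show (fun z => z ^ m * ρ z) = (fun z => z ^ m) * ρ from rfl, h3.deriv]
      rcases m with _ | m
      · simp
      · simp; ring
    have hlim : Tendsto (fun t => m * ρ t + t * deriv ρ t - A t * ρ t) (𝓝[≠] 0) (𝓝 ((m - D) * ρ 0)) := by
      have e1 : Tendsto ρ (𝓝[≠] 0) (𝓝 (ρ 0)) := hρ.continuousAt.tendsto.mono_left nhdsWithin_le_nhds
      have e2 : Tendsto (deriv ρ) (𝓝[≠] 0) (𝓝 (deriv ρ 0)) := hρ.deriv.continuousAt.tendsto.mono_left nhdsWithin_le_nhds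
      have e3 : Tendsto (fun t : ℂ => t) (𝓝[≠] 0) (𝓝 0) := tendsto_id.mono_left nhdsWithin_le_nhds
      have := ((e1.const_mul (m:ℂ)).add (e3.mul e2)).sub (hA.mul e1)
      convert this using 2; ring
    have hpow : ∀ j : ℕ, Tendsto (fun t : ℂ => t ^ j) (𝓝[≠] 0) (𝓝 (0 ^ j)) := fun j =>
      (continuous_pow j).continuousAt.tendsto.mono_left nhdsWithin_le_nhds
    have heq : ∀ᶠ t in 𝓝[≠] (0:ℂ), t ^ m * (m * ρ t + t * deriv ρ t - A t * ρ t) = B t * t ^ D := by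
      filter_upwards [h, hrρ.filter_mono nhdsWithin_le_nhds, hd.filter_mono nhdsWithin_le_nhds] with t h1 h2 h3
      rw [h3, h2] at h1
      linear_combination h1
    rcases lt_or_ge m D with hmD | hmD
    · exfalso
      obtain ⟨j, rfl⟩ : ∃ j, D = m + (j+1) := ⟨D - m - 1, by omega⟩
      have h5 : ∀ᶠ t in 𝓝[≠] (0:ℂ), m * ρ t + t * deriv ρ t - A t * ρ t = B t * t ^ (j+1) := by
        filter_upwards [heq, hne] with t h1 h2
        apply mul_left_cancel₀ (pow_ne_zero m h2)
        rw [h1]; ring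
      have := tendsto_nhds_unique (hlim.congr' h5) (hB.mul (hpow (j+1)))
      simp only [ne_eq, Nat.add_eq_zero_iff, one_ne_zero, and_false, not_false_eq_true, zero_pow, mul_zero, mul_eq_zero] at this
      rcases this with h6 | h6
      · push_cast at h6
        have : ((j : ℂ) + 1) = 0 := by linear_combination -h6
        exact (Nat.cast_add_one_ne_zero j) this
      · exact hρ0 h6
    · obtain ⟨j, rfl⟩ : ∃ j, m = D + j := ⟨m - D, by omega⟩
      have h5 : ∀ᶠ t in 𝓝[≠] (0:ℂ), t ^ j * (((D + j : ℕ) : ℂ) * ρ t + t * deriv ρ t - A t * ρ t) = B t := by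
        filter_upwards [heq, hne] with t h1 h2
        apply mul_left_cancel₀ (pow_ne_zero D h2)
        rw [mul_comm _ (B t), ← h1]; ring
      have := tendsto_nhds_unique (((hpow j).mul hlim).congr' h5) hB
      rw [← this]
      rcases j with _ | j
      · simp
      · simp

/-- divided differences -/
noncomputable def dd (m : ℕ) (x y : ℂ) : ℂ := ∑ i ∈ Finset.range m, x ^ i * y ^ (m - 1 - i)
lemma dd_mul (m : ℕ) (x y : ℂ) : x ^ m - y ^ m = (x - y) * dd m x y := by
  rw [mul_comm]; exact (Commute.geom_sum₂_mul (Commute.all x y) m).symm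
lemma dd_self (m : ℕ) (x : ℂ) : dd m x x = m * x ^ (m-1) := geom_sum₂_self x m

noncomputable def hD (J : Finset (ℕ × ℕ)) (k l : ℕ × ℕ → ℕ) (c : ℕ × ℕ → ℂ) (V x y : ℂ) : ℂ :=
  ∑ p ∈ J, c p * V ^ k p * dd (l p) x y
lemma hD_mul (J : Finset (ℕ × ℕ)) (k l : ℕ × ℕ → ℕ) (c : ℕ × ℕ → ℂ) (V x y : ℂ) :
    hs J k l c V x - hs J k l c V y = (x - y) * hD J k l c V x y := by
  unfold hs hD
  rw [← Finset.sum_sub_distrib, Finset.mul_sum]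
  refine Finset.sum_congr rfl fun p _ => ?_
  linear_combination (c p * V ^ k p) * dd_mul (l p) x y
lemma hD_self (J : Finset (ℕ × ℕ)) (k l : ℕ × ℕ → ℕ) (c : ℕ × ℕ → ℂ) (V x : ℂ) :
    hD J k l c V x x = hX J k l c V x := by
  unfold hD hX; simp only [dd_self]
lemma hX_eq (J : Finset (ℕ × ℕ)) (k l : ℕ × ℕ → ℕ) (c : ℕ × ℕ → ℂ) (V X : ℂ) :
    hX J k l c V X = hs J k (fun p => l p - 1) (fun p => c p * l p) V X := by
  unfold hs hX; exact Finset.sum_congr rfl fun p _ => by ring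
lemma hE_eq (J : Finset (ℕ × ℕ)) (k l : ℕ × ℕ → ℕ) (c : ℕ × ℕ → ℂ) (V X : ℂ) :
    hE J k l c V X = hs J k l (fun p => c p * k p) V X := by
  unfold hs hE; exact Finset.sum_congr rfl fun p _ => by ring

section
variable {E : Type*} [NormedAddCommGroup E] [NormedSpace ℂ E] {x₀ : E}
lemma dd_an (m : ℕ) {x y : E → ℂ} (hx : AnalyticAt ℂ x x₀) (hy : AnalyticAt ℂ y x₀) :
    AnalyticAt ℂ (fun t => dd m (x t) (y t)) x₀ := by
  unfold dd
  exact Finset.analyticAt_fun_sum _ fun i _ => (hx.pow i).mul (hy.pow _)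
lemma hs_an {J : Finset (ℕ × ℕ)} (k l : ℕ × ℕ → ℕ) {c : E → ℕ × ℕ → ℂ} {V x : E → ℂ}
    (hc : ∀ p ∈ J, AnalyticAt ℂ (fun t => c t p) x₀) (hV : AnalyticAt ℂ V x₀) (hx : AnalyticAt ℂ x x₀) :
    AnalyticAt ℂ (fun t => hs J k l (c t) (V t) (x t)) x₀ := by
  unfold hs
  exact Finset.analyticAt_fun_sum _ fun p hp => ((hc p hp).mul (hV.pow _)).mul (hx.pow _)
lemma hX_an {J : Finset (ℕ × ℕ)} (k l : ℕ × ℕ → ℕ) {c : E → ℕ × ℕ → ℂ} {V x : E → ℂ}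
    (hc : ∀ p ∈ J, AnalyticAt ℂ (fun t => c t p) x₀) (hV : AnalyticAt ℂ V x₀) (hx : AnalyticAt ℂ x x₀) :
    AnalyticAt ℂ (fun t => hX J k l (c t) (V t) (x t)) x₀ := by
  unfold hX
  exact Finset.analyticAt_fun_sum _ fun p hp => ((hc p hp).mul (hV.pow _)).mul (analyticAt_const.mul (hx.pow _))
lemma hE_an {J : Finset (ℕ × ℕ)} (k l : ℕ × ℕ → ℕ) {c : E → ℕ × ℕ → ℂ} {V x : E → ℂ}
    (hc : ∀ p ∈ J, AnalyticAt ℂ (fun t => c t p) x₀) (hV : AnalyticAt ℂ V x₀) (hx : AnalyticAt ℂ x x₀) :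
    AnalyticAt ℂ (fun t => hE J k l (c t) (V t) (x t)) x₀ := by
  unfold hE
  exact Finset.analyticAt_fun_sum _ fun p hp => ((hc p hp).mul (analyticAt_const.mul (hV.pow _))).mul (hx.pow _)
lemma hD_an {J : Finset (ℕ × ℕ)} (k l : ℕ × ℕ → ℕ) {c : E → ℕ × ℕ → ℂ} {V x y : E → ℂ}
    (hc : ∀ p ∈ J, AnalyticAt ℂ (fun t => c t p) x₀) (hV : AnalyticAt ℂ V x₀) (hx : AnalyticAt ℂ x x₀)
    (hy : AnalyticAt ℂ y x₀) :
    AnalyticAt ℂ (fun t => hD J k l (c t) (V t) (x t) (y t)) x₀ := by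
  unfold hD
  exact Finset.analyticAt_fun_sum _ fun p hp => ((hc p hp).mul (hV.pow _)).mul (dd_an _ hx hy)
end




lemma par_kk1 (h : PAR) : kk n a1 a2 (M+1, 0) = 0 := by
  unfold kk; simp only [h.hM1, h.hn]
  have : d * a2 * a1 = d * a1 * a2 := by ring
  omega
lemma par_kk2 (h : PAR) : kk n a1 a2 (0, N+1) = 0 := by
  unfold kk; simp only [h.hN1, h.hn]; omega
lemma par_kk3 (h : PAR) {p : ℕ × ℕ} (hp : p ∈ idxI M N) : kk n a1 a2 p ≠ 0 := by
  have := par_idx h hp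
  unfold kk; omega
lemma par_ll (h : PAR) : e * (N+1) = f * (M+1) + d := by
  rw [h.hN1, h.hM1]
  calc e * (d * a1) = d * (e * a1) := by ring
    _ = d * (1 + f * a2) := by rw [h.hef]
    _ = _ := by ring

lemma hs_zero (h : PAR) (c : ℕ × ℕ → ℂ) (X : ℂ) :
    HSS c 0 X = X ^ (f * (M+1)) * (c (M+1, 0) + c (0, N+1) * X ^ d) := by
  unfold hs
  rw [par_sum h, par_kk1 h, par_kk2 h]
  rw [Finset.sum_eq_zero (fun p hp => by rw [zero_pow (par_kk3 h hp)]; ring)]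
  simp only [ll, mul_zero, zero_add, add_zero, pow_zero, mul_one, par_ll h, pow_add]
  ring

lemma X_hX (J : Finset (ℕ × ℕ)) (k l : ℕ × ℕ → ℕ) (c : ℕ × ℕ → ℂ) (V X : ℂ) :
    X * hX J k l c V X = hs J k l (fun p => c p * l p) V X := by
  unfold hX hs
  rw [Finset.mul_sum]
  refine Finset.sum_congr rfl fun p _ => ?_
  beta_reduce
  generalize l p = L
  rcases L with _ | m
  · simp
  · simp only [Nat.add_sub_cancel, pow_succ]; ring

lemma hX_root (h : PAR) (c : ℕ × ℕ → ℂ) (X : ℂ) (hr : c (0, N+1) * X ^ d + c (M+1, 0) = 0) :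
    X * HXX c 0 X = d * c (0, N+1) * X ^ (e * (N+1)) := by
  rw [X_hX, hs_zero h]
  simp only [ll, mul_zero, zero_add, add_zero]
  rw [par_ll h]; push_cast; rw [pow_add]
  linear_combination ((f:ℂ) * (M+1) * X ^ (f * (M+1))) * hr

lemma hED_zero (J : Finset (ℕ × ℕ)) (k l : ℕ × ℕ → ℕ) (c : ℕ × ℕ → ℂ) (x y : ℂ) :
    hD J k l (fun p => c p * k p) 0 x y = 0 := by
  unfold hD
  refine Finset.sum_eq_zero fun p _ => ?_
  rcases Nat.eq_zero_or_pos (k p) with h | h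
  · simp [h]
  · rw [zero_pow h.ne']; ring

local notation "AC" => AnalyticAt ℂ
lemma res_core (h : Par M N d a1 a2 n κ e f e2) (hq : M * N - 1 = d * κ) (α : ℕ × ℕ → ℂ → ℂ) (z0 : ℂ)
    (hα : ∀ p ∈ JJ M N, AC (α p) z0) (g1 g2 : ℂ → ℂ) (hg1 : AC g1 0) (hg2 : AC g2 0)
    (g10 : g1 0 ≠ 0) (g20 : g2 0 ≠ 0) (X0 G0 : ℂ) (hX0 : X0 = Xc a1 a2 (g1 0) (g2 0)) (hG0 : G0 = Vc e f (g1 0) (g2 0))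
    (R1 : (d:ℂ) * (G0 ^ κ * X0 ^ e2) = -(((M * N - 1 : ℕ) : ℂ) * hX (JJ M N) (kk n a1 a2) (ll e f) (fun p => α p z0) 0 X0))
    (E1 E2 : ℂ → ℂ) (hE1 : E1 =O[𝓝[≠] 0] fun t => t ^ (d * n)) (hE2 : E2 =O[𝓝[≠] 0] fun t => t ^ (d * n))
    (hy1 : ∀ᶠ t in 𝓝[≠] (0:ℂ), HasDerivAt (fun t => g1 t / t ^ (N+1)) (((M * N - 1 : ℕ) : ℂ) * t ^ (M * N - 2) *
      F₁ M N α (z0 + t ^ (M * N - 1)) (g1 t / t ^ (N+1)) (g2 t / t ^ (M+1)) + E1 t) t)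
    (hy2 : ∀ᶠ t in 𝓝[≠] (0:ℂ), HasDerivAt (fun t => g2 t / t ^ (M+1)) (((M * N - 1 : ℕ) : ℂ) * t ^ (M * N - 2) *
      F₂ M N α (z0 + t ^ (M * N - 1)) (g1 t / t ^ (N+1)) (g2 t / t ^ (M+1)) + E2 t) t)
    (B : Set ℂ) (hB : IsOpen B) (hz0 : z0 ∈ B) (P Pz PV S : ℂ → ℂ → ℂ) (hP : HD B P Pz PV) (hS : An2 B S)
    (hP0 : P z0 0 = X0)
    (hres : ∀ z ∈ B, ∀ V, resid (JJ M N) (kk n a1 a2) (ll e f) α n κ e2 P Pz PV z V = V ^ n * S z V) : S z0 0 = 0 := by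
  obtain ⟨m, hm⟩ : ∃ m, M * N - 1 = m + 1 := ⟨d * κ - 1, by have := Nat.mul_pos h.hd h.hκ1; omega⟩
  have hm2 : M * N - 2 = m := by omega
  set q : ℂ := ((M * N - 1 : ℕ) : ℂ) with hqdef
  set J := JJ M N
  set k := kk n a1 a2
  set l := ll e f
  set G : ℂ → ℂ := fun t => Vc e f (g1 t) (g2 t) with hGdef
  set X : ℂ → ℂ := fun t => Xc a1 a2 (g1 t) (g2 t) with hXdef
  set V : ℂ → ℂ := fun t => t ^ d * G t with hVdef
  set Z : ℂ → ℂ := fun t => z0 + t ^ (M * N - 1) with hZdef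
  have hGan : AC G 0 := (hg2.pow f).div (hg1.pow e) (pow_ne_zero _ g10)
  have hXan : AC X 0 := (hg2.pow a1).div (hg1.pow a2) (pow_ne_zero _ g10)
  have hVan : AC V 0 := (analyticAt_id.pow d).mul hGan
  have hZan : AC Z 0 := analyticAt_const.add (analyticAt_id.pow _)
  have hV0 : V 0 = 0 := by simp [hVdef, zero_pow (by have := h.hd; omega : d ≠ 0)]
  have hZ0 : Z 0 = z0 := by simp [hZdef, hm]
  have hX00 : X 0 = X0 := hX0.symm
  have hG00 : G 0 = G0 := hG0.symm
  have hX0ne : X0 ≠ 0 := by rw [hX0]; exact Xc_ne g10 g20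
  have hG0ne : G0 ≠ 0 := by rw [hG0]; exact Vc_ne g10 g20
  have comp2 : ∀ F : ℂ → ℂ → ℂ, An2 B F → AC (fun t => F (Z t) (V t)) 0 := by
    intro F hF
    have h1 := hF z0 hz0 0
    have h2 : AC (fun t => (Z t, V t)) 0 := AnalyticAt.prod hZan hVan
    have h3 : AC (fun x : ℂ × ℂ => F x.1 x.2) ((fun t => (Z t, V t)) 0) := by
      simp only [hZ0, hV0]; exact h1
    exact AnalyticAt.comp (f := fun t => (Z t, V t)) h3 h2
  have hPan := comp2 P hP.1
  have hPzan := comp2 Pz hP.2.1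
  have hPVan := comp2 PV hP.2.2.1
  have hSan := comp2 S hS
  have hcan : ∀ p ∈ J, AC (fun t => α p (Z t)) 0 := by
    intro p hp
    have h3 : AC (α p) (Z 0) := by rw [hZ0]; exact hα p hp
    exact h3.comp hZan
  set c : ℂ → ℕ × ℕ → ℂ := fun t p => α p (Z t) with hcdef
  set u : ℂ → ℂ := fun t => G t ^ κ * X t ^ e2 with hudef
  have huan : AC u 0 := (hGan.pow κ).mul (hXan.pow e2)
  have hu0 : u 0 ≠ 0 := by
    simp only [hudef, hG00, hX00]
    exact mul_ne_zero (pow_ne_zero _ hG0ne) (pow_ne_zero _ hX0ne)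
  set T1 : ℂ → ℂ := fun t => hD J k l (fun p => c t p * k p) (V t) (X t) (P (Z t) (V t))
    - n * hD J k l (c t) (V t) (X t) (P (Z t) (V t))
    + V t * hD J k (fun p => l p - 1) (fun p => c t p * l p) (V t) (X t) (P (Z t) (V t)) * PV (Z t) (V t)
    - V t ^ κ * dd e2 (X t) (P (Z t) (V t)) * Pz (Z t) (V t) with hT1
  have hT1an : AC T1 0 := by
    refine ((AnalyticAt.sub ?_ ?_).add ?_).sub ?_
    · exact hD_an k l (fun p hp => (hcan p hp).mul analyticAt_const) hVan hXan hPan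
    · exact analyticAt_const.mul (hD_an k l hcan hVan hXan hPan)
    · exact (hVan.mul (hD_an k _ (fun p hp => (hcan p hp).mul analyticAt_const) hVan hXan hPan)).mul hPVan
    · exact ((hVan.pow κ).mul (dd_an _ hXan hPan)).mul hPzan
  have hT10 : T1 0 = - (n * hX J k l (fun p => α p z0) 0 X0) := by
    simp only [hT1, hV0, hZ0, hX00, hP0, hED_zero, hcdef]
    rw [hD_self, zero_pow (by have := h.hκ1; omega)]; ring
  -- limits
  have lim : ∀ F : ℂ → ℂ, AC F 0 → Tendsto F (𝓝[≠] 0) (𝓝 (F 0)) := fun F hF =>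
    hF.continuousAt.tendsto.mono_left nhdsWithin_le_nhds
  have hne : ∀ᶠ t in 𝓝[≠] (0:ℂ), t ≠ 0 := eventually_mem_nhdsWithin
  have lid : Tendsto (fun t : ℂ => t) (𝓝[≠] 0) (𝓝 0) := lim _ analyticAt_id
  have lE : ∀ E : ℂ → ℂ, E =O[𝓝[≠] 0] (fun t => t ^ (d * n)) → Tendsto (fun t => t * (E t / t ^ (d * n))) (𝓝[≠] 0) (𝓝 0) := by
    intro E hE
    have h1 : (fun t => E t / t ^ (d * n)) =O[𝓝[≠] 0] fun _ => (1:ℂ) := by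
      have h2 := hE.mul (isBigO_refl (fun t : ℂ => (t ^ (d * n))⁻¹) (𝓝[≠] 0))
      refine h2.congr' (Eventually.of_forall fun t => by simp [div_eq_mul_inv]) ?_
      filter_upwards [hne] with t ht
      exact mul_inv_cancel₀ (pow_ne_zero _ ht)
    have h3 := ((isLittleO_one_iff ℂ).2 lid).mul_isBigO h1
    refine (isLittleO_one_iff ℂ).1 ?_
    simpa using h3
  refine (mul_eq_zero.1 (?_ : (q * G0 ^ n / u 0) * S z0 0 = 0)).resolve_left ?_
  swap
  · refine div_ne_zero (mul_ne_zero ?_ (pow_ne_zero _ hG0ne)) hu0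
    rw [hqdef, hm]; exact_mod_cast Nat.succ_ne_zero m
  set ε : ℂ → ℂ := fun t => X t * (a1 * (t * (E2 t / t ^ (d * n))) * (t ^ (M+1) / g2 t) - a2 * (t * (E1 t / t ^ (d * n))) * (t ^ (N+1) / g1 t))
    - PV (Z t) (V t) * V t * (f * (t * (E2 t / t ^ (d * n))) * (t ^ (M+1) / g2 t) - e * (t * (E1 t / t ^ (d * n))) * (t ^ (N+1) / g1 t)) with hε
  have hε0 : Tendsto ε (𝓝[≠] 0) (𝓝 0) := by
    have t1 := lE E1 hE1
    have t2 := lE E2 hE2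
    have t3 := lim (fun t => t ^ (M+1) / g2 t) ((analyticAt_id.pow _).div hg2 g20)
    have t4 := lim (fun t => t ^ (N+1) / g1 t) ((analyticAt_id.pow _).div hg1 g10)
    have t5 := lim X hXan
    have t6 := lim (fun t => PV (Z t) (V t) * V t) (hPVan.mul hVan)
    have := (t5.mul (((t2.const_mul (a1:ℂ)).mul t3).sub ((t1.const_mul (a2:ℂ)).mul t4))).sub
      (t6.mul (((t2.const_mul (f:ℂ)).mul t3).sub ((t1.const_mul (e:ℂ)).mul t4)))
    convert this using 2
    simp
  refine order_lemma (fun t => X t - P (Z t) (V t)) (fun t => q * T1 t / u t)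
    (fun t => q * G t ^ n * S (Z t) (V t) / u t + ε t) (d * n) _ (hXan.sub hPan) ?_ ?_ ?_
  · have := lim (fun t => q * T1 t / u t) ((analyticAt_const.mul hT1an).div huan hu0)
    convert this using 2
    simp only [hT10]
    rw [eq_div_iff hu0]
    simp only [hudef, hG00, hX00]
    push_cast
    linear_combination (n:ℂ) * R1
  · have := (lim (fun t => q * G t ^ n * S (Z t) (V t) / u t) (((analyticAt_const.mul (hGan.pow n)).mul hSan).div huan hu0)).add hε0
    convert this using 2
    simp only [hG00, hZ0, hV0]
    ring
  · have ev1 : ∀ᶠ t in 𝓝 (0:ℂ), g1 t ≠ 0 := hg1.continuousAt.eventually_ne g10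
    have ev2 : ∀ᶠ t in 𝓝 (0:ℂ), g2 t ≠ 0 := hg2.continuousAt.eventually_ne g20
    have ev3 : ∀ᶠ t in 𝓝 (0:ℂ), u t ≠ 0 := huan.continuousAt.eventually_ne hu0
    have ev4 : ∀ᶠ t in 𝓝 (0:ℂ), Z t ∈ B := hZan.continuousAt.eventually_mem (by rw [hZ0]; exact hB.mem_nhds hz0)
    filter_upwards [hne, hy1, hy2, ev1.filter_mono nhdsWithin_le_nhds, ev2.filter_mono nhdsWithin_le_nhds,
      ev3.filter_mono nhdsWithin_le_nhds, ev4.filter_mono nhdsWithin_le_nhds, eventually_mem_nhdsWithin] with t t0 dy1 dy2 n1 n2 un hZB _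
    set Y1 := g1 t / t ^ (N+1) with hY1
    set Y2 := g2 t / t ^ (M+1) with hY2
    have Y1n : Y1 ≠ 0 := div_ne_zero n1 (pow_ne_zero _ t0)
    have Y2n : Y2 ≠ 0 := div_ne_zero n2 (pow_ne_zero _ t0)
    have eX : ∀ t : ℂ, t ≠ 0 → Xc a1 a2 (g1 t / t ^ (N+1)) (g2 t / t ^ (M+1)) = X t := by
      intro t t0
      simp only [hXdef, Xc, div_pow, ← pow_mul]
      have : (M+1) * a1 = (N+1) * a2 := by rw [h.hM1, h.hN1]; ring
      rw [this]
      have := pow_ne_zero ((N+1)*a2) t0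
      field_simp
    have eV : ∀ t : ℂ, t ≠ 0 → Vc e f (g1 t / t ^ (N+1)) (g2 t / t ^ (M+1)) = V t := by
      intro t t0
      simp only [hVdef, hGdef, Vc, div_pow, ← pow_mul]
      have : (N+1) * e = (M+1) * f + d := by have := par_ll h; linarith
      rw [this, pow_add]
      have := pow_ne_zero ((M+1)*f) t0
      field_simp
    have evne : ∀ᶠ s in 𝓝 t, s ≠ 0 := eventually_ne_nhds t0
    have dX : HasDerivAt X _ t := (quot_deriv a1 a2 dy1 dy2 Y1n Y2n).congr_of_eventuallyEq
      (by filter_upwards [evne] with s hs; exact (eX s hs).symm)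
    have dV : HasDerivAt V _ t := (quot_deriv f e dy1 dy2 Y1n Y2n).congr_of_eventuallyEq
      (by filter_upwards [evne] with s hs; exact (eV s hs).symm)
    have dZ : HasDerivAt Z (q * t ^ m) t := by
      have := (hasDerivAt_pow (M*N-1) t).const_add z0
      refine this.congr_deriv ?_
      rw [hqdef, hm]; simp
    have dP := hP.2.2.2 Z V _ _ t dZ dV hZB
    have dr := dX.sub dP
    have dr' : deriv (fun t => X t - P (Z t) (V t)) t = _ := dr.deriv
    rw [dr']
    have fV := flowV h α (Z t) Y1n Y2n
    have fX := flowX h α (Z t) Y1n Y2n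
    have eXt := eX t t0
    have eVt := eV t t0
    rw [← hY1, ← hY2] at eXt eVt
    rw [eXt, eVt] at fV fX
    have eXt' : Y2 ^ a1 / Y1 ^ a2 = X t := eXt
    have eVt' : Y2 ^ f / Y1 ^ e = V t := eVt
    beta_reduce
    rw [← hY1, ← hY2, eXt', eVt', hm2]
    have hVκ : V t ^ κ * X t ^ e2 = t ^ (m+1) * u t := by
      simp only [hVdef, hudef]
      rw [mul_pow, ← pow_mul, ← hq, hm]; ring
    have hVn : V t ^ n = t ^ (d * n) * G t ^ n := by
      simp only [hVdef]; rw [mul_pow, ← pow_mul]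
    have hr := hres (Z t) hZB (V t)
    unfold resid at hr
    have i1 := hD_mul J k l (fun p => c t p * k p) (V t) (X t) (P (Z t) (V t))
    have i2 := hD_mul J k l (c t) (V t) (X t) (P (Z t) (V t))
    have i3 := hD_mul J k (fun p => l p - 1) (fun p => c t p * l p) (V t) (X t) (P (Z t) (V t))
    have i4 := dd_mul e2 (X t) (P (Z t) (V t))
    rw [← hE_eq, ← hE_eq] at i1
    rw [← hX_eq, ← hX_eq] at i3
    rw [hVκ] at fV fX
    have hF1 : t ^ (N+1) / g1 t = Y1⁻¹ := by rw [hY1, inv_div]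
    have hF2 : t ^ (M+1) / g2 t = Y2⁻¹ := by rw [hY2, inv_div]
    have hTT : hE J k l (c t) (V t) (X t) - n * hs J k l (c t) (V t) (X t) + V t * hX J k l (c t) (V t) (X t) * PV (Z t) (V t)
      - V t ^ κ * X t ^ e2 * Pz (Z t) (V t) = (X t - P (Z t) (V t)) * T1 t + V t ^ n * S (Z t) (V t) := by
      rw [← hr]
      simp only [hT1]
      linear_combination i1 - n * i2 + V t * PV (Z t) (V t) * i3 - V t ^ κ * Pz (Z t) (V t) * i4
    rw [hVn, hVκ] at hTT
    apply mul_left_cancel₀ un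
    have RH : u t * (q * T1 t / u t * (X t - P (Z t) (V t)) + (q * G t ^ n * S (Z t) (V t) / u t + ε t) * t ^ (d * n))
      = q * ((X t - P (Z t) (V t)) * T1 t + t ^ (d*n) * G t ^ n * S (Z t) (V t)) + u t * ε t * t ^ (d * n) := by
      field_simp; ring
    rw [RH, ← hTT]
    have hεt : ε t * t ^ (d * n) = t * (X t * (a1 * E2 t / Y2 - a2 * E1 t / Y1) - PV (Z t) (V t) * (V t * (f * E2 t / Y2 - e * E1 t / Y1))) := by
      simp only [hε, hF1, hF2]
      have := pow_ne_zero (d*n) t0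
      field_simp
    rw [mul_assoc (u t), hεt]
    apply mul_left_cancel₀ (pow_ne_zero m t0)
    simp only [hZdef] at fV fX ⊢
    simp only [hcdef, hZdef]
    simp only [mul_add, add_div]
    generalize hs J k l (fun p => α p (z0 + t ^ (M * N - 1))) (V t) (X t) = A1 at *
    generalize hE J k l (fun p => α p (z0 + t ^ (M * N - 1))) (V t) (X t) = A2 at *
    generalize hX J k l (fun p => α p (z0 + t ^ (M * N - 1))) (V t) (X t) = A3 at *
    linear_combination (q * t ^ m) * fX - (q * t ^ m) * PV (z0 + t ^ (M * N - 1)) (V t) * fV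





noncomputable def gp (k₀ : ℤ) (c : ℤ → ℂ) (m : ℕ) (t : ℂ) : ℂ := ∑ k ∈ Finset.range (m + 1), c (k₀ + k) * t ^ k

lemma gp_an (k₀ : ℤ) (c : ℤ → ℂ) (m : ℕ) (x : ℂ) : AC (gp k₀ c m) x := by
  unfold gp
  exact Finset.analyticAt_fun_sum _ fun k _ => analyticAt_const.mul (analyticAt_id.pow k)
lemma gp_zero (k₀ : ℤ) (c : ℤ → ℂ) (m : ℕ) : gp k₀ c m 0 = c k₀ := by
  unfold gp
  rw [Finset.sum_range_succ']
  simp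
lemma trunc_gp (L : ℕ) (c : ℤ → ℂ) (m : ℕ) {t : ℂ} (ht : t ≠ 0) :
    trunc (-((L : ℤ) + 1)) c m t = gp (-((L : ℤ) + 1)) c m t / t ^ (L+1) := by
  unfold trunc gp
  rw [Finset.sum_div]
  refine Finset.sum_congr rfl fun k _ => ?_
  rw [zpow_add₀ ht, zpow_neg, ← Nat.cast_succ, zpow_natCast, zpow_natCast]
  simp only [Nat.succ_eq_add_one]
  field_simp

lemma resonance (h : Par M N d a1 a2 n κ e f e2) (hq : M * N - 1 = d * κ) (hMN : 1 < M * N) (α : ℕ × ℕ → ℂ → ℂ) (z0 : ℂ)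
    (hα : ∀ p ∈ JJ M N, AC (α p) z0) (ha : α (0, N+1) z0 ≠ 0) (hb : α (M+1, 0) z0 ≠ 0)
    (hformal : ∀ c₁L c₂L : ℂ,
      c₁L ^ (M * N - 1) =
          -(α (0, N + 1) z0 * (α (M + 1, 0) z0) ^ N * ((M * N - 1 : ℕ) : ℂ) ^ (N + 1))⁻¹ →
      c₂L = ((M * N - 1 : ℕ) : ℂ) * α (M + 1, 0) z0 * c₁L ^ M →
      ∃ c₁ c₂ : ℤ → ℂ,
        c₁ (-((N : ℤ) + 1)) = c₁L ∧ c₂ (-((M : ℤ) + 1)) = c₂L ∧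
        IsFormalSolution M N α z0 c₁ c₂)
    (X0 : ℂ) (hroot : α (0, N+1) z0 * X0 ^ d + α (M+1, 0) z0 = 0)
    (B : Set ℂ) (hB : IsOpen B) (hz0 : z0 ∈ B) (P Pz PV S : ℂ → ℂ → ℂ) (hP : HD B P Pz PV) (hS : An2 B S)
    (hP0 : P z0 0 = X0)
    (hres : ∀ z ∈ B, ∀ V, resid (JJ M N) (kk n a1 a2) (ll e f) α n κ e2 P Pz PV z V = V ^ n * S z V) : S z0 0 = 0 := by
  have hQ : ((M * N - 1 : ℕ) : ℂ) ≠ 0 := by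
    have : M * N - 1 ≠ 0 := by omega
    exact_mod_cast this
  have hXn : X0 ≠ 0 := by
    rintro rfl
    rw [zero_pow (by have := h.hd; omega)] at hroot
    simp at hroot; exact hb hroot
  obtain ⟨c1, hc1⟩ : ∃ c1 : ℂ, c1 ^ κ = X0 / (((M * N - 1 : ℕ) : ℂ) * α (M+1, 0) z0) ^ a1 :=
    IsAlgClosed.exists_pow_nat_eq _ h.hκ1
  set q : ℂ := ((M * N - 1 : ℕ) : ℂ) with hqd
  set a := α (0, N+1) z0
  set b := α (M+1, 0) z0
  set c2 := q * b * c1 ^ M with hc2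
  have hc1n : c1 ≠ 0 := by
    rintro rfl
    rw [zero_pow (by have := h.hκ1; omega)] at hc1
    exact div_ne_zero hXn (pow_ne_zero _ (mul_ne_zero hQ hb)) hc1.symm
  have hc2n : c2 ≠ 0 := mul_ne_zero (mul_ne_zero hQ hb) (pow_ne_zero _ hc1n)
  have L1 : c1 ^ (M * N - 1) = -(a * b ^ N * q ^ (N+1))⁻¹ := by
    have : X0 ^ d = - (b / a) := by field_simp; linear_combination hroot
    rw [hq, mul_comm, pow_mul, hc1, div_pow, this, ← pow_mul, mul_comm a1 d, ← h.hN1]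
    field_simp
    ring
  have hXc : X0 = Xc a1 a2 c1 c2 := by
    unfold Xc
    have : M * a1 = κ + a2 := by
      have h1 := h.hκ
      have h2 : (M + 1) * a1 = n := by rw [h.hM1, h.hn]; ring
      nlinarith
    rw [hc2, mul_pow, ← pow_mul, this, pow_add, hc1]
    field_simp
  obtain ⟨s1, s2, hs1, hs2, hf⟩ := hformal c1 c2 L1 rfl
  obtain ⟨m, hm1, hm2⟩ := hf.2.2 (d * n)
  refine res_core h hq α z0 hα (gp (-((N : ℤ) + 1)) s1 m) (gp (-((M : ℤ) + 1)) s2 m) (gp_an _ _ _ _) (gp_an _ _ _ _)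
    (by rw [gp_zero, hs1]; exact hc1n) (by rw [gp_zero, hs2]; exact hc2n) X0 (Vc e f c1 c2) (by rw [gp_zero, gp_zero, hs1, hs2]; exact hXc)
    (by rw [gp_zero, gp_zero, hs1, hs2]) ?_ _ _ hm1 hm2 ?_ ?_ B hB hz0 P Pz PV S hP hS hP0 hres
  · apply mul_left_cancel₀ hXn
    have r1 := hX_root h (fun p => α p z0) X0 hroot
    have r2 := chart_y12 h hc1n hc2n
    have r3 := chart2 h hc1n hc2n
    rw [← hXc] at r2 r3
    set G := Vc e f c1 c2
    have r4 : X0 ^ (e * (N+1)) = G ^ n * c2 ^ (N+1) := by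
      rw [pow_mul, ← r3, mul_pow, ← pow_mul, h.hN1, h.hn]; congr 2; ring
    have r5 : c1 * c2 = - q * a * c2 ^ (N+1) := by
      have : c2 ^ N = (q * b) ^ N * (c1 ^ (M * N - 1) * c1) := by
        rw [hc2, mul_pow, ← pow_mul, ← pow_succ, Nat.sub_add_cancel hMN.le]
      rw [pow_succ, this, L1]
      field_simp
      ring
    have e1 : X0 * -(q * hX (JJ M N) (kk n a1 a2) (ll e f) (fun p => α p z0) 0 X0) =
      - q * (X0 * hX (JJ M N) (kk n a1 a2) (ll e f) (fun p => α p z0) 0 X0) := by ring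
    rw [e1, r1, r4]
    linear_combination -(d:ℂ) * r2 + d * G ^ n * r5
  all_goals
    have hne : ∀ᶠ t in 𝓝[≠] (0:ℂ), t ≠ 0 := eventually_mem_nhdsWithin
    filter_upwards [hne] with t ht
    have hev : ∀ᶠ s in 𝓝 t, s ≠ 0 := eventually_ne_nhds ht
  · have h1 : trunc (-((N : ℤ) + 1)) s1 m =ᶠ[𝓝 t] fun t => gp (-((N : ℤ) + 1)) s1 m t / t ^ (N+1) := by
      filter_upwards [hev] with s hs; exact trunc_gp N s1 m hs
    rw [trunc_gp N s1 m ht, trunc_gp M s2 m ht, h1.deriv_eq, ← hqd, add_sub_cancel]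
    exact (((gp_an _ _ _ t).differentiableAt).div (differentiableAt_id.pow _) (pow_ne_zero _ ht)).hasDerivAt
  · have h1 : trunc (-((M : ℤ) + 1)) s2 m =ᶠ[𝓝 t] fun t => gp (-((M : ℤ) + 1)) s2 m t / t ^ (M+1) := by
      filter_upwards [hev] with s hs; exact trunc_gp M s2 m hs
    rw [trunc_gp N s1 m ht, trunc_gp M s2 m ht, h1.deriv_eq, ← hqd, add_sub_cancel]
    exact (((gp_an _ _ _ t).differentiableAt).div (differentiableAt_id.pow _) (pow_ne_zero _ ht)).hasDerivAt




lemma hs_deriv {J : Finset (ℕ × ℕ)} (k l : ℕ × ℕ → ℕ) {α : ℕ × ℕ → ℂ → ℂ} {V Y : ℂ → ℂ} {V' Y' z : ℂ}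
    (hα : ∀ p ∈ J, DifferentiableAt ℂ (α p) z) (hV : HasDerivAt V V' z) (hY : HasDerivAt Y Y' z) (hV0 : V z ≠ 0) :
    HasDerivAt (fun z => hs J k l (fun p => α p z) (V z) (Y z))
      (hs J k l (fun p => deriv (α p) z) (V z) (Y z) + hE J k l (fun p => α p z) (V z) (Y z) * (V' / V z)
        + hX J k l (fun p => α p z) (V z) (Y z) * Y') z := by
  unfold hs hE hX
  have : ∀ p ∈ J, HasDerivAt (fun z => α p z * V z ^ k p * Y z ^ l p)
      (deriv (α p) z * V z ^ k p * Y z ^ l p + α p z * (k p * V z ^ k p) * Y z ^ l p * (V' / V z)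
        + α p z * V z ^ k p * (l p * Y z ^ (l p - 1)) * Y') z := by
    intro p hp
    have := (((hα p hp).hasDerivAt.mul (hV.pow (k p))).mul (hY.pow (l p)))
    refine this.congr_deriv ?_
    simp only [Pi.pow_apply, Pi.mul_apply]
    have e1 : (k p : ℂ) * V z ^ (k p - 1) * V' = k p * V z ^ k p * (V' / V z) := by
      rcases k p with _ | m
      · simp
      · simp only [Nat.add_sub_cancel, pow_succ]; field_simp
    rw [e1]; ring
  have h2 := HasDerivAt.fun_sum this
  refine h2.congr_deriv ?_
  rw [Finset.sum_add_distrib, Finset.sum_add_distrib, Finset.sum_mul, Finset.sum_mul]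


/-- root branch data -/
structure Brn (M N n a1 a2 e f κ e2 : ℕ) (α : ℕ × ℕ → ℂ → ℂ) (B : Set ℂ) (zi ξ : ℂ) (P Pz PV S Q1 : ℂ → ℂ → ℂ) : Prop where
  hd : HD B P Pz PV
  hS : An2 B S
  hQ : An2 B Q1
  h0 : P zi 0 = ξ
  hr : ∀ z ∈ B, ∀ V, resid (JJ M N) (kk n a1 a2) (ll e f) α n κ e2 P Pz PV z V = V ^ (n + κ) * S z V
  hs : ∀ z ∈ B, ∀ V, hs (JJ M N) (kk n a1 a2) (ll e f) (fun p => α p z) V (P z V) = V ^ κ * Q1 z V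

noncomputable def K1 (M N n a1 a2 e f e2 : ℕ) (α : ℕ × ℕ → ℂ → ℂ) (P Pz : ℂ → ℂ → ℂ) (z V X : ℂ) : ℂ :=
  (hD (JJ M N) (kk n a1 a2) (ll e f) (fun p => deriv (α p) z) V X (P z V) + (X ^ e2)⁻¹ * Pz z V *
    (hD (JJ M N) (kk n a1 a2) (fun p => ll e f p - 1) (fun p => α p z * ll e f p) V X (P z V) * P z V ^ e2
      - hX (JJ M N) (kk n a1 a2) (ll e f) (fun p => α p z) V (P z V) * dd e2 X (P z V)))
  / hD (JJ M N) (kk n a1 a2) (ll e f) (fun p => α p z) V X (P z V)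
noncomputable def K2 (M N n a1 a2 e f e2 : ℕ) (α : ℕ × ℕ → ℂ → ℂ) (S : ℂ → ℂ → ℂ) (z V X : ℂ) : ℂ :=
  (X ^ e2)⁻¹ * hX (JJ M N) (kk n a1 a2) (ll e f) (fun p => α p z) V X * S z V

/-- V-scaled difference -/
noncomputable def Wx (M N n a1 a2 e f : ℕ) (α : ℕ × ℕ → ℂ → ℂ) (P : ℂ → ℂ → ℂ) (z V X : ℂ) : ℂ :=
  (X - P z V) * hD (JJ M N) (kk n a1 a2) (ll e f) (fun p => α p z) V X (P z V) / V ^ n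

lemma Vc_deriv (h : PAR) (α : ℕ × ℕ → ℂ → ℂ) (y1 y2 : ℂ → ℂ) (z : ℂ)
    (n1 : y1 z ≠ 0) (n2 : y2 z ≠ 0)
    (h1 : HasDerivAt y1 (F₁ M N α z (y1 z) (y2 z)) z) (h2 : HasDerivAt y2 (F₂ M N α z (y1 z) (y2 z)) z) :
    HasDerivAt (fun z => Vq (y1 z) (y2 z)) (- Vq (y1 z) (y2 z) * HXX (fun p => α p z) (Vq (y1 z) (y2 z)) (Xq (y1 z) (y2 z))
      / (Vq (y1 z) (y2 z) ^ κ * Xq (y1 z) (y2 z) ^ e2)) z := by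
  refine (quot_deriv f e h1 h2 n1 n2).congr_deriv ?_
  have hV := Vc_ne (e := e) (f := f) n1 n2
  have hX := Xc_ne (a1 := a1) (a2 := a2) n1 n2
  rw [eq_div_iff (mul_ne_zero (pow_ne_zero _ hV) (pow_ne_zero _ hX)), ← flowV h α z n1 n2]
  unfold Vc; ring

lemma Xc_deriv (h : PAR) (α : ℕ × ℕ → ℂ → ℂ) (y1 y2 : ℂ → ℂ) (z : ℂ)
    (n1 : y1 z ≠ 0) (n2 : y2 z ≠ 0)
    (h1 : HasDerivAt y1 (F₁ M N α z (y1 z) (y2 z)) z) (h2 : HasDerivAt y2 (F₂ M N α z (y1 z) (y2 z)) z) :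
    HasDerivAt (fun z => Xq (y1 z) (y2 z)) ((HEE (fun p => α p z) (Vq (y1 z) (y2 z)) (Xq (y1 z) (y2 z))
      - n * HSS (fun p => α p z) (Vq (y1 z) (y2 z)) (Xq (y1 z) (y2 z)))
      / (Vq (y1 z) (y2 z) ^ κ * Xq (y1 z) (y2 z) ^ e2)) z := by
  refine (quot_deriv a1 a2 h1 h2 n1 n2).congr_deriv ?_
  have hV := Vc_ne (e := e) (f := f) n1 n2
  have hX := Xc_ne (a1 := a1) (a2 := a2) n1 n2
  rw [eq_div_iff (mul_ne_zero (pow_ne_zero _ hV) (pow_ne_zero _ hX)), ← flowX h α z n1 n2]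
  unfold Xc; ring

local notation "HDD" => hD (JJ M N) (kk n a1 a2) (ll e f)
local notation "BRN" => Brn M N n a1 a2 e f κ e2
lemma Wx_deriv (h : PAR) (α : ℕ × ℕ → ℂ → ℂ) (B : Set ℂ) (zi ξ : ℂ) (P Pz PV S Q1 : ℂ → ℂ → ℂ)
    (hb : BRN α B zi ξ P Pz PV S Q1) (y1 y2 : ℂ → ℂ) (z : ℂ) (hz : z ∈ B)
    (hα : ∀ p ∈ JJ M N, DifferentiableAt ℂ (α p) z)
    (n1 : y1 z ≠ 0) (n2 : y2 z ≠ 0)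
    (h1 : HasDerivAt y1 (F₁ M N α z (y1 z) (y2 z)) z) (h2 : HasDerivAt y2 (F₂ M N α z (y1 z) (y2 z)) z)
    (hne : HDD (fun p => α p z) (Vq (y1 z) (y2 z)) (Xq (y1 z) (y2 z)) (P z (Vq (y1 z) (y2 z))) ≠ 0) :
    HasDerivAt (fun z => Wx M N n a1 a2 e f α P z (Vq (y1 z) (y2 z)) (Xq (y1 z) (y2 z)))
     (K1 M N n a1 a2 e f e2 α P Pz z (Vq (y1 z) (y2 z)) (Xq (y1 z) (y2 z)) *
      Wx M N n a1 a2 e f α P z (Vq (y1 z) (y2 z)) (Xq (y1 z) (y2 z)) + K2 M N n a1 a2 e f e2 α S z (Vq (y1 z) (y2 z)) (Xq (y1 z) (y2 z))) z := by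
  have dV := Vc_deriv h α y1 y2 z n1 n2 h1 h2
  have dX := Xc_deriv h α y1 y2 z n1 n2 h1 h2
  have hV0 := Vc_ne (e := e) (f := f) n1 n2
  have hX0 := Xc_ne (a1 := a1) (a2 := a2) n1 n2
  have hW : ∀ z, Wx M N n a1 a2 e f α P z (Vq (y1 z) (y2 z)) (Xq (y1 z) (y2 z)) =
    (HSS (fun p => α p z) (Vq (y1 z) (y2 z)) (Xq (y1 z) (y2 z))
     - HSS (fun p => α p z) (Vq (y1 z) (y2 z)) (P z (Vq (y1 z) (y2 z)))) / Vq (y1 z) (y2 z) ^ n := by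
    intro z; rw [hD_mul]; rfl
  simp only [hW]
  set V : ℂ → ℂ := fun z => Vq (y1 z) (y2 z) with hVd
  set X : ℂ → ℂ := fun z => Xq (y1 z) (y2 z) with hXd
  have dP := hb.hd.2.2.2 id V 1 _ z (hasDerivAt_id z) dV hz
  have eV : Vq (y1 z) (y2 z) = V z := rfl
  have eX : Xq (y1 z) (y2 z) = X z := rfl
  simp only [id] at dP
  have d1 := hs_deriv (kk n a1 a2) (ll e f) hα dV dX hV0
  have d2 := hs_deriv (kk n a1 a2) (ll e f) hα dV dP hV0
  have d3 := (d1.sub d2).div (dV.pow n) (pow_ne_zero n hV0)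
  refine d3.congr_deriv ?_
  rw [eV] at hV0 hne
  rw [eX] at hX0 hne
  rw [eV, eX]
  simp only [Pi.pow_apply, Pi.sub_apply, Pi.div_apply]
  have hr := hb.hr z hz (V z)
  unfold resid at hr
  have i1 := hD_mul (JJ M N) (kk n a1 a2) (ll e f) (fun p => deriv (α p) z) (V z) (X z) (P z (V z))
  have i2 := hD_mul (JJ M N) (kk n a1 a2) (ll e f) (fun p => α p z) (V z) (X z) (P z (V z))
  have i3 := hD_mul (JJ M N) (kk n a1 a2) (fun p => ll e f p - 1) (fun p => α p z * ll e f p) (V z) (X z) (P z (V z))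
  rw [← hX_eq, ← hX_eq] at i3
  have i4 := dd_mul e2 (X z) (P z (V z))
  unfold K1 K2
  have npow : (n:ℂ) * V z ^ (n-1) = n * V z ^ n / V z := by
    rcases n with _ | m
    · simp
    · simp only [Nat.add_sub_cancel, pow_succ]; field_simp
  rw [npow]
  rw [i2]
  generalize HDD (fun p => deriv (α p) z) (V z) (X z) (P z (V z)) = D1 at *
  generalize HDD (fun p => α p z) (V z) (X z) (P z (V z)) = D2 at *
  generalize hD (JJ M N) (kk n a1 a2) (fun p => ll e f p - 1) (fun p => α p z * ll e f p) (V z) (X z) (P z (V z)) = D3 at *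
  generalize dd e2 (X z) (P z (V z)) = D4 at *
  generalize HSS (fun p => deriv (α p) z) (V z) (X z) = A1 at *
  generalize HSS (fun p => deriv (α p) z) (V z) (P z (V z)) = A2 at *
  generalize HSS (fun p => α p z) (V z) (X z) = A3 at *
  generalize HSS (fun p => α p z) (V z) (P z (V z)) = A4 at *
  generalize HEE (fun p => α p z) (V z) (X z) = A5 at *
  generalize HEE (fun p => α p z) (V z) (P z (V z)) = A6 at *
  generalize HXX (fun p => α p z) (V z) (X z) = A7 at *
  generalize HXX (fun p => α p z) (V z) (P z (V z)) = A8 at *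
  generalize P z (V z) = p at *
  generalize Pz z (V z) = pz at *
  generalize PV z (V z) = pv at *
  generalize S z (V z) = s at *
  generalize hxx : X z = x at *
  generalize hvv : V z = v at *
  have i1' : A1 = A2 + (x - p) * D1 := by linear_combination i1
  have i3' : A7 = A8 + (x - p) * D3 := by linear_combination i3
  have hr' : A6 = v ^ (n+κ) * s - v * (A8 * pv) + n * A4 + v ^ κ * p ^ e2 * pz := by linear_combination hr
  have i2' : A3 = A4 + (x - p) * D2 := by linear_combination i2
  have xe : x ^ e2 ≠ 0 := pow_ne_zero _ hX0
  have vk : v ^ κ ≠ 0 := pow_ne_zero _ hV0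
  have vn : v ^ n ≠ 0 := pow_ne_zero _ hV0
  have i4' : x ^ e2 = p ^ e2 + (x - p) * D4 := by linear_combination i4
  rw [hr', i1', i2']
  rw [pow_add]
  generalize v ^ κ = vκ at *
  generalize v ^ n = vN at *
  generalize x ^ e2 = xe2 at *
  field_simp
  subst i4'
  rw [i3']
  ring




lemma bdd_near {E : Type*} [TopologicalSpace E] {F : E → ℂ} {x₀ : E} (hF : ContinuousAt F x₀) {C : ℝ} (hC : ‖F x₀‖ + 1 ≤ C) :
    ∀ᶠ x in 𝓝 x₀, ‖F x‖ ≤ C := by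
  have : ∀ᶠ x in 𝓝 x₀, ‖F x‖ < ‖F x₀‖ + 1 := hF.norm.eventually_lt continuousAt_const (by linarith)
  exact this.mono fun x hx => by linarith


structure Bx (M N n a1 a2 e f e2 : ℕ) (α : ℕ × ℕ → ℂ → ℂ) (B : Set ℂ) (P Pz S Q1 : ℂ → ℂ → ℂ) (C : ℝ) (z V X : ℂ) : Prop where
  hz : z ∈ B
  k1 : ‖K1 M N n a1 a2 e f e2 α P Pz z V X‖ ≤ C
  k2 : ‖K2 M N n a1 a2 e f e2 α S z V X‖ ≤ C
  d0 : hD (JJ M N) (kk n a1 a2) (ll e f) (fun p => α p z) V X (P z V) ≠ 0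
  d1 : ‖(hD (JJ M N) (kk n a1 a2) (ll e f) (fun p => α p z) V X (P z V))⁻¹‖ ≤ C
  d2 : ‖hD (JJ M N) (kk n a1 a2) (ll e f) (fun p => α p z) V X (P z V)‖ ≤ C
  hq : ‖Q1 z V‖ ≤ C
  x0 : X ≠ 0
  x1 : ‖X‖ ≤ C
  hx : hX (JJ M N) (kk n a1 a2) (ll e f) (fun p => α p z) V X ≠ 0
  x2 : ‖(hE (JJ M N) (kk n a1 a2) (ll e f) (fun p => α p z) V X
      - n * hs (JJ M N) (kk n a1 a2) (ll e f) (fun p => α p z) V X) / X ^ e2‖ ≤ C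
  z1 : ‖hs (JJ M N) (kk n a1 a2) (ll e f) (fun p => deriv (α p) z) V X‖ ≤ C
  p1 : ‖X - P z V‖ ≤ C

lemma root_ne (h : PAR) (c : ℕ × ℕ → ℂ) (hb : c (M+1, 0) ≠ 0) (X : ℂ)
    (hr : c (0, N+1) * X ^ d + c (M+1, 0) = 0) : X ≠ 0 := by
  rintro rfl
  rw [zero_pow (by have := h.hd; omega)] at hr
  simp at hr; exact hb hr

lemma hX_root_ne (h : PAR) (c : ℕ × ℕ → ℂ) (ha : c (0, N+1) ≠ 0) (hb : c (M+1, 0) ≠ 0) (X : ℂ)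
    (hr : c (0, N+1) * X ^ d + c (M+1, 0) = 0) : HXX c 0 X ≠ 0 := by
  intro h0
  have := hX_root h c X hr
  rw [h0, mul_zero] at this
  have hd : (d:ℂ) ≠ 0 := by have := h.hd; exact_mod_cast (by omega : d ≠ 0)
  exact mul_ne_zero (mul_ne_zero hd ha) (pow_ne_zero _ (root_ne h c hb X hr)) this.symm

lemma box_ev (h : PAR) (α : ℕ × ℕ → ℂ → ℂ) (B : Set ℂ) (hB : IsOpen B) (zi ξ : ℂ) (hzi : zi ∈ B)
    (hα : ∀ p ∈ JJ M N, AnalyticOnNhd ℂ (α p) B)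
    (ha : α (0, N+1) zi ≠ 0) (hb0 : α (M+1, 0) zi ≠ 0) (hroot : α (0, N+1) zi * ξ ^ d + α (M+1, 0) zi = 0)
    (P Pz PV S Q1 : ℂ → ℂ → ℂ)
    (hb : BRN α B zi ξ P Pz PV S Q1) :
    ∃ C : ℝ, 1 ≤ C ∧ ∃ η > 0, ∀ z V X, ‖z - zi‖ < η → ‖V‖ < η → ‖X - ξ‖ < η → Bx M N n a1 a2 e f e2 α B P Pz S Q1 C z V X := by
  let x₀ : ℂ × ℂ × ℂ := (zi, 0, ξ)
  have az : AC (fun x : ℂ × ℂ × ℂ => x.1) x₀ := analyticAt_fst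
  have aV : AC (fun x : ℂ × ℂ × ℂ => x.2.1) x₀ := analyticAt_fst.comp analyticAt_snd
  have aX : AC (fun x : ℂ × ℂ × ℂ => x.2.2) x₀ := analyticAt_snd.comp analyticAt_snd
  have cmp : ∀ F : ℂ → ℂ → ℂ, An2 B F → AC (fun x : ℂ × ℂ × ℂ => F x.1 x.2.1) x₀ := by
    intro F hF
    have h1 := hF zi hzi 0
    exact AnalyticAt.comp (f := fun x : ℂ × ℂ × ℂ => (x.1, x.2.1)) (x := x₀) h1 (az.prod aV)
  have aP := cmp P hb.hd.1
  have aPz := cmp Pz hb.hd.2.1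
  have aS := cmp S hb.hS
  have aQ := cmp Q1 hb.hQ
  have ac : ∀ p ∈ JJ M N, AC (fun x : ℂ × ℂ × ℂ => α p x.1) x₀ := fun p hp =>
    AnalyticAt.comp (f := fun x : ℂ × ℂ × ℂ => x.1) (x := x₀) (hα p hp zi hzi) az
  have ac' : ∀ p ∈ JJ M N, AC (fun x : ℂ × ℂ × ℂ => deriv (α p) x.1) x₀ := fun p hp =>
    AnalyticAt.comp (f := fun x : ℂ × ℂ × ℂ => x.1) (x := x₀) (hα p hp zi hzi).deriv az
  have hξ : ξ ≠ 0 := root_ne h (fun p => α p zi) hb0 ξ hroot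
  have hX0 := hX_root_ne h (fun p => α p zi) ha hb0 ξ hroot
  have aD := hD_an (kk n a1 a2) (ll e f) ac aV aX aP
  have aX2 := aX.pow e2
  have hX2 : (x₀.2.2) ^ e2 ≠ 0 := pow_ne_zero _ hξ
  have aXi := aX2.inv hX2
  have ahX := hX_an (kk n a1 a2) (ll e f) ac aV aX
  have ahXP := hX_an (kk n a1 a2) (ll e f) ac aV aP
  have hD0 : HDD (fun p => α p x₀.1) x₀.2.1 x₀.2.2 (P x₀.1 x₀.2.1) ≠ 0 := by
    show HDD (fun p => α p zi) 0 ξ (P zi 0) ≠ 0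
    rw [hb.h0, hD_self]; exact hX0
  have aK1 : AC (fun x : ℂ × ℂ × ℂ => K1 M N n a1 a2 e f e2 α P Pz x.1 x.2.1 x.2.2) x₀ := by
    refine AnalyticAt.div ?_ aD hD0
    refine (hD_an _ _ ac' aV aX aP).add ((aXi.mul aPz).mul (AnalyticAt.sub ?_ ?_))
    · exact (hD_an _ _ (fun p hp => (ac p hp).mul analyticAt_const) aV aX aP).mul (aP.pow e2)
    · exact ahXP.mul (dd_an _ aX aP)
  have aK2 : AC (fun x : ℂ × ℂ × ℂ => K2 M N n a1 a2 e f e2 α S x.1 x.2.1 x.2.2) x₀ :=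
    (aXi.mul ahX).mul aS
  have aF := (((hE_an (kk n a1 a2) (ll e f) ac aV aX).sub ((analyticAt_const (v := (n:ℂ))).mul (hs_an (kk n a1 a2) (ll e f) ac aV aX))).div aX2 hX2)
  have ahz := hs_an (kk n a1 a2) (ll e f) ac' aV aX
  have aXP := aX.sub aP
  have aDi := aD.inv hD0
  obtain ⟨C, hC⟩ : ∃ C : ℝ, ∀ y ∈ ({1, ‖K1 M N n a1 a2 e f e2 α P Pz zi 0 ξ‖ + 1, ‖K2 M N n a1 a2 e f e2 α S zi 0 ξ‖ + 1,
    ‖(HDD (fun p => α p zi) 0 ξ (P zi 0))⁻¹‖ + 1,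
    ‖HDD (fun p => α p zi) 0 ξ (P zi 0)‖ + 1,
    ‖Q1 zi 0‖ + 1, ‖ξ‖ + 1, ‖(HEE (fun p => α p zi) 0 ξ
      - n * HSS (fun p => α p zi) 0 ξ) / ξ ^ e2‖ + 1,
     ‖HSS (fun p => deriv (α p) zi) 0 ξ‖ + 1, ‖ξ - P zi 0‖ + 1} : Set ℝ), y ≤ C := by
    have := (Set.toFinite ({1, ‖K1 M N n a1 a2 e f e2 α P Pz zi 0 ξ‖ + 1, ‖K2 M N n a1 a2 e f e2 α S zi 0 ξ‖ + 1,
    ‖(HDD (fun p => α p zi) 0 ξ (P zi 0))⁻¹‖ + 1,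
    ‖HDD (fun p => α p zi) 0 ξ (P zi 0)‖ + 1,
    ‖Q1 zi 0‖ + 1, ‖ξ‖ + 1, ‖(HEE (fun p => α p zi) 0 ξ
      - n * HSS (fun p => α p zi) 0 ξ) / ξ ^ e2‖ + 1,
     ‖HSS (fun p => deriv (α p) zi) 0 ξ‖ + 1, ‖ξ - P zi 0‖ + 1} : Set ℝ)).bddAbove
    exact this
  have ev : ∀ᶠ x in 𝓝 x₀, Bx M N n a1 a2 e f e2 α B P Pz S Q1 C x.1 x.2.1 x.2.2 := by
    filter_upwards [az.continuousAt.eventually_mem (hB.mem_nhds hzi), bdd_near aK1.continuousAt (hC _ (by simp [x₀])),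
      bdd_near aK2.continuousAt (hC _ (by simp [x₀])), aD.continuousAt.eventually_ne hD0,
      bdd_near aDi.continuousAt (hC _ (by simp [x₀])), bdd_near aD.continuousAt (hC _ (by simp [x₀])),
      bdd_near aQ.continuousAt (hC _ (by simp [x₀])), aX.continuousAt.eventually_ne hξ,
      bdd_near aX.continuousAt (hC _ (by simp [x₀])), ahX.continuousAt.eventually_ne hX0,
      bdd_near aF.continuousAt (hC _ (by simp [x₀])), bdd_near ahz.continuousAt (hC _ (by simp [x₀])),
      bdd_near aXP.continuousAt (hC _ (by simp [x₀]))] with x g1 g2 g3 g4 g5 g6 g7 g8 g9 g10 g11 g12 g13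
    exact ⟨g1, g2, g3, g4, g5, g6, g7, g8, g9, g10, g11, g12, g13⟩
  refine ⟨C, hC 1 (by simp), ?_⟩
  obtain ⟨η, hη, H⟩ := Metric.eventually_nhds_iff.1 ev
  refine ⟨η, hη, fun z V X h1 h2 h3 => H (y := (z, V, X)) ?_⟩
  rw [Prod.dist_eq, Prod.dist_eq]
  simp only [x₀, dist_eq_norm, sub_zero]
  exact max_lt h1 (max_lt h2 h3)

lemma P_close {B : Set ℂ} {P : ℂ → ℂ → ℂ} (hP : An2 B P) {zi : ℂ} (hzi : zi ∈ B) {θ : ℝ} (hθ : 0 < θ) :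
    ∃ η > 0, ∀ z V, ‖z - zi‖ < η → ‖V‖ < η → ‖P z V - P zi 0‖ < θ := by
  have h1 := (hP zi hzi 0).continuousAt
  obtain ⟨η, hη, H⟩ := Metric.continuousAt_iff.1 h1 θ hθ
  refine ⟨η, hη, fun z V h1 h2 => ?_⟩
  have := H (x := (z, V)) (by rw [Prod.dist_eq]; simp only [dist_eq_norm, sub_zero]; exact max_lt h1 h2)
  simpa [dist_eq_norm] using this





lemma branches (h : Par M N d a1 a2 n κ e f e2) (hq : M * N - 1 = d * κ) (hMN : 1 < M * N) (α : ℕ × ℕ → ℂ → ℂ)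
    (Ω : Set ℂ) (hΩ : IsOpen Ω) (hα : ∀ p ∈ JJ M N, AnalyticOnNhd ℂ (α p) Ω) (zi : ℂ) (hzi : zi ∈ Ω)
    (ha : α (0, N+1) zi ≠ 0) (hb : α (M+1, 0) zi ≠ 0)
    (hformal : ∀ z₀ ∈ Ω, α (0, N+1) z₀ ≠ 0 → α (M+1, 0) z₀ ≠ 0 → ∀ c₁L c₂L : ℂ,
      c₁L ^ (M * N - 1) =
          -(α (0, N + 1) z₀ * (α (M + 1, 0) z₀) ^ N * ((M * N - 1 : ℕ) : ℂ) ^ (N + 1))⁻¹ →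
      c₂L = ((M * N - 1 : ℕ) : ℂ) * α (M + 1, 0) z₀ * c₁L ^ M →
      ∃ c₁ c₂ : ℤ → ℂ,
        c₁ (-((N : ℤ) + 1)) = c₁L ∧ c₂ (-((M : ℤ) + 1)) = c₂L ∧
        IsFormalSolution M N α z₀ c₁ c₂) :
    ∃ B, IsOpen B ∧ zi ∈ B ∧ B ⊆ Ω ∧ ∀ ξ, α (0, N+1) zi * ξ ^ d + α (M+1, 0) zi = 0 → 
      ∃ P Pz PV S Q1, Brn M N n a1 a2 e f κ e2 α B zi ξ P Pz PV S Q1 := by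
  have hJ1 : (M+1, 0) ∈ JJ M N := by simp [JJ]
  have hJ2 : (0, N+1) ∈ JJ M N := by simp [JJ]
  have hd0 : (d:ℂ) ≠ 0 := by have := h.hd; exact_mod_cast (by omega : d ≠ 0)
  set ρ : ℂ → ℂ := fun z => (α (M+1, 0) z / α (0, N+1) z) / (α (M+1, 0) zi / α (0, N+1) zi) with hρ
  have hρan : AC ρ zi := ((hα _ hJ1 zi hzi).div (hα _ hJ2 zi hzi) ha).div analyticAt_const (div_ne_zero hb ha)
  have hρ1 : ρ zi = 1 := div_self (div_ne_zero hb ha)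
  have ev : ∀ᶠ z in 𝓝 zi, z ∈ Ω ∧ α (0, N+1) z ≠ 0 ∧ α (M+1, 0) z ≠ 0 ∧ ρ z ∈ Complex.slitPlane := by
    filter_upwards [hΩ.mem_nhds hzi, (hα _ hJ2 zi hzi).continuousAt.eventually_ne ha, (hα _ hJ1 zi hzi).continuousAt.eventually_ne hb,
      hρan.continuousAt.eventually_mem (Complex.isOpen_slitPlane.mem_nhds (by rw [hρ1]; exact Complex.one_mem_slitPlane))] with z g1 g2 g3 g4
    exact ⟨g1, g2, g3, g4⟩
  obtain ⟨B, hB, hBo, hziB⟩ := _root_.eventually_nhds_iff.1 ev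
  refine ⟨B, hBo, hziB, fun z hz => (hB z hz).1, fun ξ hξ => ?_⟩
  set p0 : ℂ → ℂ := fun z => ξ * (ρ z) ^ ((1:ℂ)/d) with hp0
  have hp0i : p0 zi = ξ := by simp [hp0, hρ1]
  have hroot : ∀ z ∈ B, α (0, N+1) z * p0 z ^ d + α (M+1, 0) z = 0 := by
    intro z hz
    have h1 : (ρ z ^ ((1:ℂ)/d)) ^ d = ρ z := by
      rw [one_div]; exact Complex.cpow_nat_inv_pow _ (by have := h.hd; omega)
    simp only [hp0, mul_pow, h1]
    have h2 : ξ ^ d = - (α (M+1, 0) zi / α (0, N+1) zi) := by field_simp; linear_combination hξ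
    rw [h2, hρ]
    have := (hB z hz).2.1
    field_simp
    ring
  have hp0an : AnalyticOnNhd ℂ p0 B := by
    intro z hz
    have hr : AC ρ z := ((hα _ hJ1 z (hB z hz).1).div (hα _ hJ2 z (hB z hz).1) (hB z hz).2.1).div analyticAt_const (div_ne_zero hb ha)
    exact analyticAt_const.mul (hr.cpow analyticAt_const (hB z hz).2.2.2)
  obtain ⟨P, Pz, PV, S, Q1, g1, g2, g3, g4, g5, g6⟩ := exists_P B zi hBo hziB (JJ M N) α (fun p hp z hz => hα p hp z (hB z hz).1) (kk n a1 a2) (ll e f) n κ e2 h.hκ1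
    (by have := h.hκ; omega) p0 hp0an
    (fun z hz => by rw [hs_zero h, add_comm (α _ z), hroot z hz, mul_zero])
    (fun z hz => hX_root_ne h (fun p => α p z) (hB z hz).2.1 (hB z hz).2.2.1 _ (hroot z hz))
    (fun P Pz PV S hP hS hP0 hres z hz => resonance h hq hMN α z (fun p hp => hα p hp z (hB z hz).1) (hB z hz).2.1 (hB z hz).2.2.1
      (hformal z (hB z hz).1 (hB z hz).2.1 (hB z hz).2.2.1) (p0 z) (hroot z hz) B hBo hz P Pz PV S hP hS (hP0 z hz) hres)
  exact ⟨P, Pz, PV, S, Q1, g1, g2, g3, by rw [g4 zi hziB, hp0i], g5, g6⟩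




lemma ms_prod (s : Multiset ℂ) (X : ℂ) (ε : ℝ) (hε : 0 ≤ ε) (h : ∀ ξ ∈ s, ε ≤ ‖X - ξ‖) :
    ε ^ (Multiset.card s) ≤ ‖(s.map (fun ξ => X - ξ)).prod‖ := by
  induction s using Multiset.induction_on with
  | empty => simp
  | cons a s ih =>
    rw [Multiset.card_cons, Multiset.map_cons, Multiset.prod_cons, norm_mul, pow_succ, mul_comm]
    exact mul_le_mul (h a (by simp)) (ih fun ξ hξ => h ξ (Multiset.mem_cons_of_mem hξ)) (by positivity) (by positivity)

lemma root_set (d : ℕ) (hd : 1 ≤ d) (a b : ℂ) (ha : a ≠ 0) : ∃ Rt : Finset ℂ, (∀ ξ, ξ ∈ Rt ↔ a * ξ ^ d + b = 0) ∧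
    ∀ ε : ℝ, 0 ≤ ε → ∀ X, (∀ ξ ∈ Rt, ε ≤ ‖X - ξ‖) → ‖a‖ * ε ^ d ≤ ‖a * X ^ d + b‖ := by
  classical
  set p : Polynomial ℂ := Polynomial.X ^ d + Polynomial.C (b / a) with hp
  have hm : p.Monic := Polynomial.monic_X_pow_add_C _ (by omega)
  have hdeg : p.natDegree = d := Polynomial.natDegree_X_pow_add_C
  have hev : ∀ X, a * p.eval X = a * X ^ d + b := by
    intro X; simp [hp, mul_add]; field_simp
  refine ⟨p.roots.toFinset, fun ξ => ?_, fun ε hε X hX => ?_⟩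
  · rw [Multiset.mem_toFinset, Polynomial.mem_roots hm.ne_zero, Polynomial.IsRoot, ← hev]
    simp [ha]
  · have hs := IsAlgClosed.splits p
    have h1 := hs.eval_eq_prod_roots_of_monic hm X
    rw [← hev, norm_mul, h1]
    have h2 : Multiset.card p.roots = d := by rw [← hdeg]; exact hs.natDegree_eq_card_roots.symm
    gcongr
    have := ms_prod p.roots X ε hε (fun ξ hξ => hX ξ (by simpa using hξ))
    rwa [h2] at this


lemma par_n (h : PAR) : n ≠ 0 := by have := h.hκ; have := h.hκ1; omega

noncomputable def Sz (M N : ℕ) (y1 y2 : ℂ) : ℝ := ‖y1‖ ^ (M+1) + ‖y2‖ ^ (N+1)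

lemma sizeR (h : PAR) (y1 y2 : ℂ) : ∃ R : ℝ, 0 ≤ R ∧ R ^ n = Sz M N y1 y2 ∧ ‖y1‖ ≤ R ^ a1 ∧ ‖y2‖ ≤ R ^ a2 := by
  have h0 : 0 ≤ Sz M N y1 y2 := by unfold Sz; positivity
  have hR : (Sz M N y1 y2 ^ ((n:ℝ)⁻¹)) ^ n = Sz M N y1 y2 := Real.rpow_inv_natCast_pow h0 (par_n h)
  refine ⟨Sz M N y1 y2 ^ ((n:ℝ)⁻¹), by positivity, hR, ?_, ?_⟩
  · refine le_of_pow_le_pow_left₀ (n := M+1) (by omega) (by positivity) ?_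
    rw [← pow_mul, show a1 * (M+1) = n by rw [h.hM1, h.hn]; ring, hR]
    unfold Sz; have : 0 ≤ ‖y2‖ ^ (N+1) := by positivity
    linarith
  · refine le_of_pow_le_pow_left₀ (n := N+1) (by omega) (by positivity) ?_
    rw [← pow_mul, show a2 * (N+1) = n by rw [h.hN1, h.hn]; ring, hR]
    unfold Sz; have : 0 ≤ ‖y1‖ ^ (M+1) := by positivity
    linarith

lemma mono_le (h : PAR) (y1 y2 : ℂ) (hA : 1 ≤ Sz M N y1 y2) {p : ℕ × ℕ} (hp : p ∈ JJ M N) :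
    ‖y1 ^ p.1 * y2 ^ p.2‖ ≤ Sz M N y1 y2 := by
  obtain ⟨R, hR0, hRn, h1, h2⟩ := sizeR h y1 y2
  have hR1 : 1 ≤ R := by
    by_contra hlt
    have := pow_lt_one₀ hR0 (not_le.1 hlt) (par_n h)
    linarith
  have hk := par_kk h hp
  rw [norm_mul, norm_pow, norm_pow]
  calc ‖y1‖ ^ p.1 * ‖y2‖ ^ p.2 ≤ (R ^ a1) ^ p.1 * (R ^ a2) ^ p.2 := by gcongr
    _ = R ^ (p.1 * a1 + p.2 * a2) := by rw [← pow_mul, ← pow_mul, ← pow_add]; ring_nf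
    _ ≤ R ^ n := pow_le_pow_right₀ hR1 (by omega)
    _ = _ := hRn

lemma mono_lt (h : PAR) (θ : ℝ) (hθ : 0 < θ) : ∃ A0 : ℝ, 1 ≤ A0 ∧ ∀ y1 y2 : ℂ, A0 ≤ Sz M N y1 y2 → ∀ p ∈ idxI M N,
    ‖y1 ^ p.1 * y2 ^ p.2‖ ≤ θ * Sz M N y1 y2 := by
  refine ⟨max 1 ((1/θ) ^ n), le_max_left _ _, fun y1 y2 hA p hp => ?_⟩
  obtain ⟨R, hR0, hRn, h1, h2⟩ := sizeR h y1 y2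
  have hR1 : 1 ≤ R := by
    by_contra hlt
    have := pow_lt_one₀ hR0 (not_le.1 hlt) (par_n h)
    have := (le_max_left _ _).trans hA
    linarith
  have hR2 : 1 / θ ≤ R := by
    refine le_of_pow_le_pow_left₀ (n := n) (par_n h) hR0 ?_
    rw [hRn]; exact (le_max_right _ _).trans hA
  have hk := par_idx h hp
  rw [norm_mul, norm_pow, norm_pow]
  calc ‖y1‖ ^ p.1 * ‖y2‖ ^ p.2 ≤ (R ^ a1) ^ p.1 * (R ^ a2) ^ p.2 := by gcongr
    _ = R ^ (p.1 * a1 + p.2 * a2) := by rw [← pow_mul, ← pow_mul, ← pow_add]; ring_nf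
    _ ≤ R ^ (n-1) := pow_le_pow_right₀ hR1 (by omega)
    _ = 1 * R ^ (n-1) := by ring
    _ ≤ (θ * R) * R ^ (n-1) := by
        gcongr
        rw [div_le_iff₀ hθ] at hR2; linarith
    _ = θ * R ^ n := by rw [mul_assoc, ← pow_succ', Nat.sub_add_cancel (by have := par_n h; omega)]
    _ = _ := by rw [hRn]

lemma coef_bdd (J : Finset (ℕ × ℕ)) (α : ℕ × ℕ → ℂ → ℂ) (zi : ℂ) (hα : ∀ p ∈ J, ContinuousAt (α p) zi) :
    ∃ C : ℝ, 0 ≤ C ∧ ∀ᶠ z in 𝓝 zi, ∑ p ∈ J, ‖α p z‖ ≤ C := by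
  have hc : ContinuousAt (fun z => ∑ p ∈ J, ‖α p z‖) zi := by
    simp only [ContinuousAt]
    exact tendsto_finsetSum _ fun p hp => (hα p hp).norm
  refine ⟨∑ p ∈ J, ‖α p zi‖ + 1, by positivity, ?_⟩
  exact (hc.eventually_lt continuousAt_const (by linarith)).mono fun z hz => hz.le

lemma mon_bd (h : PAR) (α : ℕ × ℕ → ℂ → ℂ) (zi : ℂ) (hα : ∀ p ∈ JJ M N, ContinuousAt (α p) zi) :
    ∃ C : ℝ, 0 ≤ C ∧ ∀ᶠ z in 𝓝 zi, ∀ y1 y2, 1 ≤ Sz M N y1 y2 → ‖mon M N (fun p => α p z) y1 y2‖ ≤ C * Sz M N y1 y2 := by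
  obtain ⟨C, hC, ev⟩ := coef_bdd _ α zi hα
  refine ⟨C, hC, ev.mono fun z hz y1 y2 hA => ?_⟩
  unfold mon
  calc _ ≤ ∑ p ∈ JJ M N, ‖α p z * (y1 ^ p.1 * y2 ^ p.2)‖ := norm_sum_le _ _
    _ ≤ ∑ p ∈ JJ M N, ‖α p z‖ * Sz M N y1 y2 := Finset.sum_le_sum fun p hp => by
        rw [norm_mul]; exact mul_le_mul_of_nonneg_left (mono_le h y1 y2 hA hp) (norm_nonneg _)
    _ = (∑ p ∈ JJ M N, ‖α p z‖) * Sz M N y1 y2 := by rw [Finset.sum_mul]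
    _ ≤ _ := by gcongr

lemma far_bd (h : PAR) (α : ℕ × ℕ → ℂ → ℂ) (zi : ℂ) (hα : ∀ p ∈ JJ M N, ContinuousAt (α p) zi)
    (ha : α (0, N+1) zi ≠ 0) (Rt : Finset ℂ)
    (hRt : ∀ ε : ℝ, 0 ≤ ε → ∀ X, (∀ ξ ∈ Rt, ε ≤ ‖X - ξ‖) → ‖α (0, N+1) zi‖ * ε ^ d ≤ ‖α (0, N+1) zi * X ^ d + α (M+1, 0) zi‖)
    (ε : ℝ) (hε : 0 < ε) : ∃ c > 0, ∃ A0 : ℝ, 1 ≤ A0 ∧ ∀ᶠ z in 𝓝 zi, ∀ y1 y2, A0 ≤ Sz M N y1 y2 → (y1 = 0 ∨ ∀ ξ ∈ Rt, ε ≤ ‖Xq y1 y2 - ξ‖) →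
      c * Sz M N y1 y2 ≤ ‖mon M N (fun p => α p z) y1 y2‖ := by
  have hJ1 : (M+1, 0) ∈ JJ M N := by simp [JJ]
  have hJ2 : (0, N+1) ∈ JJ M N := by simp [JJ]
  set a := α (0, N+1) zi
  set b := α (M+1, 0) zi
  have hap : 0 < ‖a‖ := norm_pos_iff.2 ha
  set c0 := ‖a‖ * ε ^ d with hc0
  have hc0p : 0 < c0 := by positivity
  set L := 1 / c0 + 1 / ‖a‖ + ‖b‖ / (‖a‖ * c0) with hL
  have hLp : 0 < L := by positivity
  have key : ∀ X, (∀ ξ ∈ Rt, ε ≤ ‖X - ξ‖) → 1 + ‖X‖ ^ d ≤ L * ‖a * X ^ d + b‖ := by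
    intro X hX
    have h1 := hRt ε hε.le X hX
    rw [← hc0] at h1
    set u := ‖a * X ^ d + b‖
    have h2 : ‖a‖ * ‖X‖ ^ d ≤ u + ‖b‖ := by
      rw [← norm_pow, ← norm_mul]
      calc ‖a * X ^ d‖ = ‖(a * X ^ d + b) - b‖ := by ring_nf
        _ ≤ _ := norm_sub_le _ _
    have h3 : 1 ≤ u / c0 := by rw [le_div_iff₀ hc0p]; linarith
    have h4 : ‖X‖ ^ d ≤ (u + ‖b‖) / ‖a‖ := by rw [le_div_iff₀ hap]; linarith
    have h5 : ‖b‖ / ‖a‖ ≤ ‖b‖ / ‖a‖ * (u / c0) := le_mul_of_one_le_right (by positivity) h3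
    calc 1 + ‖X‖ ^ d ≤ u / c0 + (u / ‖a‖ + ‖b‖ / ‖a‖ * (u / c0)) := by rw [add_div] at h4; linarith
      _ = L * u := by rw [hL]; field_simp; ring
  have key2 : ∀ y1 y2, (y1 = 0 ∨ ∀ ξ ∈ Rt, ε ≤ ‖Xq y1 y2 - ξ‖) → Sz M N y1 y2 ≤ L * ‖a * y2 ^ (N+1) + b * y1 ^ (M+1)‖ := by
    intro y1 y2 hy
    by_cases hy1 : y1 = 0
    · subst hy1
      simp only [Sz, norm_zero, ne_eq, Nat.add_eq_zero_iff, one_ne_zero, and_false, not_false_eq_true, zero_pow, zero_add, mul_zero, add_zero, norm_mul, norm_pow]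
      have : 1 ≤ L * ‖a‖ := by
        have : L * ‖a‖ = ‖a‖ / c0 + 1 + ‖b‖ / c0 := by rw [hL]; field_simp
        rw [this]
        have : 0 ≤ ‖a‖ / c0 := by positivity
        have : 0 ≤ ‖b‖ / c0 := by positivity
        linarith
      calc ‖y2‖ ^ (N+1) ≤ (L * ‖a‖) * ‖y2‖ ^ (N+1) := le_mul_of_one_le_left (by positivity) this
        _ = _ := by ring
    · have h1 := key _ (hy.resolve_left hy1)
      have h2 : Xq y1 y2 ^ d * y1 ^ (M+1) = y2 ^ (N+1) := by
        unfold Xc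
        rw [div_pow, ← pow_mul, ← pow_mul, h.hM1, h.hN1, mul_comm a1 d, mul_comm a2 d]
        field_simp
      have h3 : ‖Xq y1 y2‖ ^ d * ‖y1‖ ^ (M+1) = ‖y2‖ ^ (N+1) := by
        rw [← norm_pow, ← norm_pow, ← norm_mul, h2, norm_pow]
      unfold Sz
      rw [← h3, ← h2]
      calc ‖y1‖ ^ (M+1) + ‖Xq y1 y2‖ ^ d * ‖y1‖ ^ (M+1) = (1 + ‖Xq y1 y2‖ ^ d) * ‖y1‖ ^ (M+1) := by ring
        _ ≤ (L * ‖a * Xq y1 y2 ^ d + b‖) * ‖y1‖ ^ (M+1) := by gcongr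
        _ = L * ‖(a * Xq y1 y2 ^ d + b) * y1 ^ (M+1)‖ := by rw [norm_mul, norm_pow]; ring
        _ = _ := by ring_nf
  obtain ⟨C, hC, evC⟩ := coef_bdd _ α zi hα
  set c := 1 / L with hc
  have hcp : 0 < c := by positivity
  obtain ⟨A0, hA0, hA⟩ := mono_lt h (c / 4 / (C+1)) (by positivity)
  refine ⟨c / 4, by positivity, A0, hA0, ?_⟩
  have e1 : ∀ᶠ z in 𝓝 zi, ‖α (0, N+1) z - a‖ < c / 4 := by
    have := (hα _ hJ2); exact (Metric.tendsto_nhds.1 this (c / 4) (by positivity)).mono fun z hz => by rwa [dist_eq_norm] at hz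
  have e2 : ∀ᶠ z in 𝓝 zi, ‖α (M+1, 0) z - b‖ < c / 4 := by
    have := (hα _ hJ1); exact (Metric.tendsto_nhds.1 this (c / 4) (by positivity)).mono fun z hz => by rwa [dist_eq_norm] at hz
  filter_upwards [evC, e1, e2] with z z1 z2 z3 y1 y2 hAy hy
  have k1 := key2 y1 y2 hy
  have k2 : c * Sz M N y1 y2 ≤ ‖a * y2 ^ (N+1) + b * y1 ^ (M+1)‖ := by
    rw [hc, one_div, inv_mul_le_iff₀ hLp]; exact k1
  have hlow : ‖∑ p ∈ idxI M N, α p z * (y1 ^ p.1 * y2 ^ p.2)‖ ≤ c / 4 * Sz M N y1 y2 := by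
    have hpos : 0 ≤ Sz M N y1 y2 := by unfold Sz; positivity
    calc _ ≤ ∑ p ∈ idxI M N, ‖α p z * (y1 ^ p.1 * y2 ^ p.2)‖ := norm_sum_le _ _
      _ ≤ ∑ p ∈ idxI M N, ‖α p z‖ * (c / 4 / (C+1) * Sz M N y1 y2) := Finset.sum_le_sum fun p hp => by
        rw [norm_mul]; exact mul_le_mul_of_nonneg_left (hA y1 y2 hAy p hp) (norm_nonneg _)
      _ = (∑ p ∈ idxI M N, ‖α p z‖) * (c / 4 / (C+1) * Sz M N y1 y2) := by rw [Finset.sum_mul]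
      _ ≤ (∑ p ∈ JJ M N, ‖α p z‖) * (c / 4 / (C+1) * Sz M N y1 y2) := by
        gcongr
        exact fun p hp => by simp [JJ, hp]
      _ ≤ (C + 1) * (c / 4 / (C+1) * Sz M N y1 y2) := by gcongr; linarith
      _ = _ := by field_simp
  have hmon : mon M N (fun p => α p z) y1 y2 = (a * y2 ^ (N+1) + b * y1 ^ (M+1)) + ((α (0, N+1) z - a) * y2 ^ (N+1)) + ((α (M+1, 0) z - b) * y1 ^ (M+1))
     + ∑ p ∈ idxI M N, α p z * (y1 ^ p.1 * y2 ^ p.2) := by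
    unfold mon; rw [par_sum h]; ring
  have s1 : ‖(α (0, N+1) z - a) * y2 ^ (N+1)‖ + ‖(α (M+1, 0) z - b) * y1 ^ (M+1)‖ ≤ c / 4 * Sz M N y1 y2 := by
    rw [norm_mul, norm_mul, norm_pow, norm_pow, Sz, mul_add, add_comm]
    gcongr
  rw [hmon]
  have t1 := norm_sub_le_norm_add (a * y2 ^ (N+1) + b * y1 ^ (M+1)) ((α (0, N+1) z - a) * y2 ^ (N+1))
  have t2 := norm_sub_le_norm_add ((a * y2 ^ (N+1) + b * y1 ^ (M+1)) + ((α (0, N+1) z - a) * y2 ^ (N+1))) ((α (M+1, 0) z - b) * y1 ^ (M+1))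
  have t3 := norm_sub_le_norm_add ((a * y2 ^ (N+1) + b * y1 ^ (M+1)) + ((α (0, N+1) z - a) * y2 ^ (N+1)) + ((α (M+1, 0) z - b) * y1 ^ (M+1))) (∑ p ∈ idxI M N, α p z * (y1 ^ p.1 * y2 ^ p.2))
  have hpos : 0 ≤ c * Sz M N y1 y2 := by unfold Sz; positivity
  linarith




lemma lip_of_deriv {f : ℂ → ℂ} {f' z0 : ℂ} (hf : HasDerivAt f f' z0) : ∀ᶠ z in 𝓝 z0, ‖f z - f z0‖ ≤ (‖f'‖ + 1) * ‖z - z0‖ := by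
  have := (hasDerivAt_iff_isLittleO.1 hf).def (c := 1) one_pos
  filter_upwards [this] with z hz
  have e : f z - f z0 = (f z - f z0 - (z - z0) • f') + (z - z0) • f' := by ring
  rw [e]
  refine (norm_add_le _ _).trans ?_
  rw [norm_smul]
  linarith

noncomputable def chi (ε t : ℝ) : ℝ := max 0 (min 1 (2 - 2 * t / ε))
lemma chi_nn (ε t : ℝ) : 0 ≤ chi ε t := le_max_left _ _
lemma chi_le (ε t : ℝ) : chi ε t ≤ 1 := max_le zero_le_one (min_le_left _ _)
lemma chi_one {ε t : ℝ} (hε : 0 < ε) (ht : t ≤ ε / 2) : chi ε t = 1 := by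
  have : 2 * t / ε ≤ 1 := by rw [div_le_one hε]; linarith
  unfold chi; rw [min_eq_left (by linarith), max_eq_right zero_le_one]
lemma chi_zero {ε t : ℝ} (hε : 0 < ε) (ht : ε ≤ t) : chi ε t = 0 := by
  have : 2 ≤ 2 * t / ε := by rw [le_div_iff₀ hε]; linarith
  unfold chi; exact max_eq_left ((min_le_right _ _).trans (by linarith))
lemma chi_lip {ε : ℝ} (hε : 0 < ε) (s t : ℝ) : |chi ε s - chi ε t| ≤ 2 / ε * |s - t| := by
  unfold chi
  have h1 := abs_max_sub_max_le_abs (min 1 (2 - 2 * s / ε)) (min 1 (2 - 2 * t / ε)) 0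
  have h2 := abs_min_sub_min_le_max 1 (2 - 2 * s / ε) 1 (2 - 2 * t / ε)
  rw [max_comm 0, max_comm 0]
  refine h1.trans (h2.trans ?_)
  rw [sub_self, abs_zero, max_eq_right (abs_nonneg _)]
  have : 2 - 2 * s / ε - (2 - 2 * t / ε) = -(2 / ε * (s - t)) := by ring
  rw [this, abs_neg, abs_mul, abs_of_pos (by positivity : 0 < 2 / ε)]


/-- glued corrections, one branch -/
noncomputable def Gx (M N n a1 a2 e f : ℕ) (α : ℕ × ℕ → ℂ → ℂ) (P : ℂ → ℂ → ℂ) (y1 y2 : ℂ → ℂ) (z : ℂ) : ℂ :=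
  mon M N (fun p => α p z) (y1 z) (y2 z) - Wx M N n a1 a2 e f α P z (Vc e f (y1 z) (y2 z)) (Xc a1 a2 (y1 z) (y2 z))

noncomputable def Dx (M N n a1 a2 e f : ℕ) (α : ℕ × ℕ → ℂ → ℂ) (P : ℂ → ℂ → ℂ) (ε : ℝ) (ξ : ℂ) (y1 y2 : ℂ → ℂ) (z : ℂ) : ℂ :=
  mon M N (fun p => α p z) (y1 z) (y2 z) - (chi ε ‖Xc a1 a2 (y1 z) (y2 z) - ξ‖ : ℂ) * Gx M N n a1 a2 e f α P y1 y2 z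

lemma mid_lower (h : PAR) (α : ℕ × ℕ → ℂ → ℂ) (B : Set ℂ) (zi ξ : ℂ) (P Pz PV S Q1 : ℂ → ℂ → ℂ)
    (hb : BRN α B zi ξ P Pz PV S Q1) (C ε : ℝ) (hC : 1 ≤ C) (hε : 0 < ε)
    (y1 y2 : ℂ → ℂ) (z : ℂ)
    (hbx : Bx M N n a1 a2 e f e2 α B P Pz S Q1 C z (Vq (y1 z) (y2 z)) (Xq (y1 z) (y2 z)))
    (n1 : y1 z ≠ 0) (n2 : y2 z ≠ 0) (hV1 : ‖Vq (y1 z) (y2 z)‖ ≤ 1) :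
    ‖Gx M N n a1 a2 e f α P y1 y2 z‖ ≤ C * ‖Vq (y1 z) (y2 z)‖ ^ κ * (‖Vq (y1 z) (y2 z)‖ ^ n)⁻¹ ∧
    ‖Wx M N n a1 a2 e f α P z (Vq (y1 z) (y2 z)) (Xq (y1 z) (y2 z))‖ ≤ C * C * (‖Vq (y1 z) (y2 z)‖ ^ n)⁻¹ ∧
    (‖P z (Vq (y1 z) (y2 z)) - ξ‖ ≤ ε / 6 → ‖Vq (y1 z) (y2 z)‖ ≤ ε / (6 * C * C) → ε / 2 ≤ ‖Xq (y1 z) (y2 z) - ξ‖ →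
      ε / (6 * C) * (‖Vq (y1 z) (y2 z)‖ ^ n)⁻¹ ≤ ‖Dx M N n a1 a2 e f α P ε ξ y1 y2 z‖) := by
  have hV0 := Vc_ne (e := e) (f := f) n1 n2
  have hm := chart_mon h (fun p => α p z) n1 n2
  have hG : Gx M N n a1 a2 e f α P y1 y2 z = Vq (y1 z) (y2 z) ^ κ * Q1 z (Vq (y1 z) (y2 z)) / Vq (y1 z) (y2 z) ^ n := by
    have := hD_mul (JJ M N) (kk n a1 a2) (ll e f) (fun p => α p z) (Vq (y1 z) (y2 z)) (Xq (y1 z) (y2 z)) (P z (Vq (y1 z) (y2 z)))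
    unfold Gx Wx
    rw [← this, hb.hs z hbx.hz, ← hm]
    field_simp; ring
  have g1 : ‖Gx M N n a1 a2 e f α P y1 y2 z‖ ≤ C * ‖Vq (y1 z) (y2 z)‖ ^ κ * (‖Vq (y1 z) (y2 z)‖ ^ n)⁻¹ := by
    rw [hG, norm_div, norm_mul, norm_pow, norm_pow, div_eq_mul_inv, mul_comm C]
    gcongr; exact hbx.hq
  refine ⟨g1, ?_, ?_⟩
  · unfold Wx
    rw [norm_div, norm_mul, norm_pow, div_eq_mul_inv]
    gcongr
    · exact hbx.p1
    · exact hbx.d2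
  · intro hP hVs hX
    set v := ‖Vq (y1 z) (y2 z)‖ with hv
    have hvp : 0 < v := norm_pos_iff.2 hV0
    have hri : 0 < (v ^ n)⁻¹ := by positivity
    have w1 : ε / (3 * C) * (v ^ n)⁻¹ ≤ ‖Wx M N n a1 a2 e f α P z (Vq (y1 z) (y2 z)) (Xq (y1 z) (y2 z))‖ := by
      unfold Wx
      rw [norm_div, norm_mul, norm_pow, ← hv]
      have d1 := hbx.d1
      have hdp := norm_pos_iff.2 hbx.d0
      rw [norm_inv, inv_le_comm₀ hdp (by linarith)] at d1
      have x1 : ε / 3 ≤ ‖Xq (y1 z) (y2 z) - P z (Vq (y1 z) (y2 z))‖ := by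
        have := norm_sub_le_norm_sub_add_norm_sub (Xq (y1 z) (y2 z)) (P z (Vq (y1 z) (y2 z))) ξ
        linarith
      have e0 : ε / (3 * C) * (v ^ n)⁻¹ = (ε / 3) * C⁻¹ * (v ^ n)⁻¹ := by field_simp
      rw [e0, ← div_eq_mul_inv (ε / 3 * C⁻¹)]
      gcongr
    have hκ1 : v ^ κ ≤ v := pow_le_of_le_one hvp.le hV1 (by have := h.hκ1; omega)
    have g2 : ‖Gx M N n a1 a2 e f α P y1 y2 z‖ ≤ ε / (6 * C) * (v ^ n)⁻¹ := by
      refine g1.trans ?_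
      gcongr
      calc C * v ^ κ ≤ C * (ε / (6 * C * C)) := by gcongr; linarith
        _ = _ := by field_simp
    have hDx : Wx M N n a1 a2 e f α P z (Vq (y1 z) (y2 z)) (Xq (y1 z) (y2 z)) = Dx M N n a1 a2 e f α P ε ξ y1 y2 z
       - ((1 - chi ε ‖Xq (y1 z) (y2 z) - ξ‖ : ℝ) : ℂ) * Gx M N n a1 a2 e f α P y1 y2 z := by
      unfold Dx
      have : Gx M N n a1 a2 e f α P y1 y2 z = mon M N (fun p => α p z) (y1 z) (y2 z) - Wx M N n a1 a2 e f α P z (Vq (y1 z) (y2 z)) (Xq (y1 z) (y2 z)) := rfl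
      push_cast
      linear_combination this
    have t := norm_sub_le (Dx M N n a1 a2 e f α P ε ξ y1 y2 z) (((1 - chi ε ‖Xq (y1 z) (y2 z) - ξ‖ : ℝ) : ℂ) * Gx M N n a1 a2 e f α P y1 y2 z)
    rw [← hDx, norm_mul, Complex.norm_real, Real.norm_eq_abs] at t
    have c1 : |1 - chi ε ‖Xq (y1 z) (y2 z) - ξ‖| ≤ 1 := by
      rw [abs_le]; constructor <;> linarith [chi_nn ε ‖Xq (y1 z) (y2 z) - ξ‖, chi_le ε ‖Xq (y1 z) (y2 z) - ξ‖]
    have c2 : |1 - chi ε ‖Xq (y1 z) (y2 z) - ξ‖| * ‖Gx M N n a1 a2 e f α P y1 y2 z‖ ≤ ‖Gx M N n a1 a2 e f α P y1 y2 z‖ :=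
      mul_le_of_le_one_left (norm_nonneg _) c1
    have e3 : ε / (3 * C) * (v ^ n)⁻¹ = ε / (6 * C) * (v ^ n)⁻¹ + ε / (6 * C) * (v ^ n)⁻¹ := by field_simp; norm_num
    linarith

lemma loc_branch (h : PAR) (α : ℕ × ℕ → ℂ → ℂ) (B : Set ℂ) (zi ξ : ℂ) (P Pz PV S Q1 : ℂ → ℂ → ℂ)
    (hb : BRN α B zi ξ P Pz PV S Q1) (C ε : ℝ) (hC : 1 ≤ C) (hε : 0 < ε) : ∃ C' : ℝ, 0 ≤ C' ∧ ∀
    (y1 y2 : ℂ → ℂ) (z : ℂ),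
    Bx M N n a1 a2 e f e2 α B P Pz S Q1 C z (Vq (y1 z) (y2 z)) (Xq (y1 z) (y2 z)) →
    (∀ p ∈ JJ M N, DifferentiableAt ℂ (α p) z) →
    y1 z ≠ 0 → y2 z ≠ 0 → HasDerivAt y1 (F₁ M N α z (y1 z) (y2 z)) z → HasDerivAt y2 (F₂ M N α z (y1 z) (y2 z)) z →
    ‖Vq (y1 z) (y2 z)‖ ≤ 1 →
    ‖P z (Vq (y1 z) (y2 z)) - ξ‖ ≤ ε / 6 → ‖Vq (y1 z) (y2 z)‖ ≤ ε / (6 * C * C) → 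
    ∀ᶠ w in 𝓝 z, ‖Dx M N n a1 a2 e f α P ε ξ y1 y2 w - Dx M N n a1 a2 e f α P ε ξ y1 y2 z‖ ≤ C' * (‖Dx M N n a1 a2 e f α P ε ξ y1 y2 z‖ + 1) * ‖w - z‖ := by
  set L := (C + 1) + (C + C * (C * C) + C + 1) + 2 / ε * ((C + 1) * C) with hL
  have hLp : 0 ≤ L := by positivity
  refine ⟨(C + 1) + L * (6 * C / ε), by positivity, fun y1 y2 z hbx hα n1 n2 h1 h2 hV1 hP hVs => ?_⟩
  obtain ⟨g1, g2, g3⟩ := mid_lower h α B zi ξ P Pz PV S Q1 hb C ε hC hε y1 y2 z hbx n1 n2 hV1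
  have dW := Wx_deriv h α B zi ξ P Pz PV S Q1 hb y1 y2 z hbx.hz hα n1 n2 h1 h2 hbx.d0
  have dX := Xc_deriv h α y1 y2 z n1 n2 h1 h2
  have dH := mon_deriv α y1 y2 h z hα h1 h2
  have hm := chart_mon h (fun p => deriv (α p) z) n1 n2
  have hV0 := Vc_ne (e := e) (f := f) n1 n2
  set Wd := K1 M N n a1 a2 e f e2 α P Pz z (Vq (y1 z) (y2 z)) (Xq (y1 z) (y2 z)) *
      Wx M N n a1 a2 e f α P z (Vq (y1 z) (y2 z)) (Xq (y1 z) (y2 z)) + K2 M N n a1 a2 e f e2 α S z (Vq (y1 z) (y2 z)) (Xq (y1 z) (y2 z)) with hWd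
  have hWdb : ‖Wd‖ ≤ C * ‖Wx M N n a1 a2 e f α P z (Vq (y1 z) (y2 z)) (Xq (y1 z) (y2 z))‖ + C := by
    refine (norm_add_le _ _).trans ?_
    rw [norm_mul]
    gcongr
    · exact hbx.k1
    · exact hbx.k2
  by_cases hX : ‖Xq (y1 z) (y2 z) - ξ‖ < ε / 2
  · have ev : ∀ᶠ w in 𝓝 z, ‖Xq (y1 w) (y2 w) - ξ‖ < ε / 2 :=
      ((dX.continuousAt.sub continuousAt_const).norm).eventually_lt continuousAt_const hX
    have hDW : ∀ w, ‖Xq (y1 w) (y2 w) - ξ‖ < ε / 2 → Dx M N n a1 a2 e f α P ε ξ y1 y2 w =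
        Wx M N n a1 a2 e f α P w (Vq (y1 w) (y2 w)) (Xq (y1 w) (y2 w)) := by
      intro w hw; unfold Dx Gx; rw [chi_one hε hw.le]; push_cast; ring
    filter_upwards [ev, lip_of_deriv dW] with w w1 w2
    rw [hDW w w1, hDW z hX]
    refine w2.trans ?_
    gcongr
    set u := ‖Wx M N n a1 a2 e f α P z (Vq (y1 z) (y2 z)) (Xq (y1 z) (y2 z))‖
    have hu : 0 ≤ u := norm_nonneg _
    have : 0 ≤ L * (6 * C / ε) * (u + 1) := by positivity
    nlinarith
  · have hX' := not_lt.1 hX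
    have low := g3 hP hVs hX'
    have dG : HasDerivAt (Gx M N n a1 a2 e f α P y1 y2) (mon M N (fun p => deriv (α p) z) (y1 z) (y2 z) - Wd) z := dH.sub dW
    have chl := chi_lip hε
    set v := ‖Vq (y1 z) (y2 z)‖ with hv
    have hvp : 0 < v := norm_pos_iff.2 hV0
    have hr1 : 1 ≤ (v ^ n)⁻¹ := (one_le_inv₀ (by positivity)).2 (pow_le_one₀ hvp.le hV1)
    set r := (v ^ n)⁻¹ with hr
    have hHd : ‖mon M N (fun p => deriv (α p) z) (y1 z) (y2 z)‖ ≤ C * r := by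
      have z1 := hbx.z1
      rw [← hm, norm_mul, norm_pow, ← hv] at z1
      rw [hr, ← div_eq_mul_inv, le_div_iff₀ (by positivity)]; linarith
    have hWd2 : ‖Wd‖ ≤ C * (C * C) * r + C * r := by
      refine hWdb.trans ?_
      calc _ ≤ C * (C * C * r) + C * r := by gcongr; nlinarith
        _ = _ := by ring
    have hGd : ‖mon M N (fun p => deriv (α p) z) (y1 z) (y2 z) - Wd‖ ≤ (C + C * (C * C) + C) * r := by
      refine (norm_sub_le _ _).trans ?_
      linarith
    set Xd := (HEE (fun p => α p z) (Vq (y1 z) (y2 z)) (Xq (y1 z) (y2 z))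
      - n * HSS (fun p => α p z) (Vq (y1 z) (y2 z)) (Xq (y1 z) (y2 z)))
      / (Vq (y1 z) (y2 z) ^ κ * Xq (y1 z) (y2 z) ^ e2) with hXd
    have hXdb : (‖Xd‖ + 1) * v ^ κ ≤ C + 1 := by
      have x2 := hbx.x2
      have : ‖Xd‖ * v ^ κ ≤ C := by
        rw [hv, ← norm_pow, ← norm_mul]
        refine le_of_eq_of_le ?_ x2
        congr 1
        rw [hXd]
        have := hbx.x0
        field_simp
      have : v ^ κ ≤ 1 := pow_le_one₀ hvp.le hV1
      linarith
    filter_upwards [lip_of_deriv dH, lip_of_deriv dG, lip_of_deriv dX] with w w1 w2 w3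
    have hc : |chi ε ‖Xq (y1 w) (y2 w) - ξ‖ - chi ε ‖Xq (y1 z) (y2 z) - ξ‖| ≤ 2 / ε * ((‖Xd‖ + 1) * ‖w - z‖) := by
      refine (chl _ _).trans ?_
      gcongr
      refine (abs_norm_sub_norm_le _ _).trans (le_trans (le_of_eq ?_) w3)
      congr 1; ring
    have eD : Dx M N n a1 a2 e f α P ε ξ y1 y2 w - Dx M N n a1 a2 e f α P ε ξ y1 y2 z =
      (mon M N (fun p => α p w) (y1 w) (y2 w) - mon M N (fun p => α p z) (y1 z) (y2 z))
      - ((chi ε ‖Xq (y1 w) (y2 w) - ξ‖ : ℝ) : ℂ) * (Gx M N n a1 a2 e f α P y1 y2 w - Gx M N n a1 a2 e f α P y1 y2 z)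
      - ((chi ε ‖Xq (y1 w) (y2 w) - ξ‖ - chi ε ‖Xq (y1 z) (y2 z) - ξ‖ : ℝ) : ℂ) * Gx M N n a1 a2 e f α P y1 y2 z := by
      unfold Dx; push_cast; ring
    have hρ : 0 ≤ ‖w - z‖ := norm_nonneg _
    have b2 : ‖((chi ε ‖Xq (y1 w) (y2 w) - ξ‖ : ℝ) : ℂ) * (Gx M N n a1 a2 e f α P y1 y2 w - Gx M N n a1 a2 e f α P y1 y2 z)‖ ≤ (C + C * (C * C) + C + 1) * r * ‖w - z‖ := by
      rw [norm_mul, Complex.norm_real, Real.norm_eq_abs, abs_of_nonneg (chi_nn _ _)]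
      refine (mul_le_of_le_one_left (norm_nonneg _) (chi_le _ _)).trans (w2.trans ?_)
      gcongr
      linarith
    have b3 : ‖((chi ε ‖Xq (y1 w) (y2 w) - ξ‖ - chi ε ‖Xq (y1 z) (y2 z) - ξ‖ : ℝ) : ℂ) * Gx M N n a1 a2 e f α P y1 y2 z‖ ≤ 2 / ε * ((C + 1) * C) * r * ‖w - z‖ := by
      rw [norm_mul, Complex.norm_real, Real.norm_eq_abs]
      calc _ ≤ 2 / ε * ((‖Xd‖ + 1) * ‖w - z‖) * (C * v ^ κ * r) := by gcongr
        _ = 2 / ε * (((‖Xd‖ + 1) * v ^ κ) * C) * r * ‖w - z‖ := by ring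
        _ ≤ _ := by gcongr
    have b1 : ‖mon M N (fun p => α p w) (y1 w) (y2 w) - mon M N (fun p => α p z) (y1 z) (y2 z)‖ ≤ (C + 1) * r * ‖w - z‖ := by
      refine w1.trans ?_
      gcongr; linarith
    have tot : ‖Dx M N n a1 a2 e f α P ε ξ y1 y2 w - Dx M N n a1 a2 e f α P ε ξ y1 y2 z‖ ≤ L * r * ‖w - z‖ := by
      rw [eD]
      refine (norm_sub_le _ _).trans ((add_le_add (norm_sub_le _ _) le_rfl).trans ?_)
      rw [hL]
      linarith
    refine tot.trans (mul_le_mul_of_nonneg_right ?_ hρ)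
    set u := ‖Dx M N n a1 a2 e f α P ε ξ y1 y2 z‖
    have hu : 0 ≤ u := norm_nonneg _
    have hru : r ≤ 6 * C / ε * u := by
      have e0 : 6 * C / ε * (ε / (6 * C) * r) = r := by field_simp
      rw [← e0]; gcongr
    calc L * r ≤ L * (6 * C / ε * u) := by gcongr
      _ ≤ (C + 1) * (u + 1) + L * (6 * C / ε) * (u + 1) := by
        have : 0 ≤ L * (6 * C / ε) := by positivity
        nlinarith
      _ = ((C + 1) + L * (6 * C / ε)) * (u + 1) := by ring




lemma V_small (h : PAR) (Mx v0 : ℝ) (hMx : 0 ≤ Mx) (hv0 : 0 < v0) : ∃ A1 : ℝ, ∀ y1 y2 : ℂ, y1 ≠ 0 → y2 ≠ 0 →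
    ‖Xq y1 y2‖ ≤ Mx → A1 < Sz M N y1 y2 → ‖Vq y1 y2‖ < v0 := by
  refine ⟨(Mx ^ f / v0 ^ a1) ^ (M+1) + (Mx ^ e / v0 ^ a2) ^ (N+1), fun y1 y2 n1 n2 hX hS => ?_⟩
  by_contra hv
  have hv := not_lt.1 hv
  have c1 := congrArg norm (chart1 h n1 n2)
  have c2 := congrArg norm (chart2 h n1 n2)
  rw [norm_mul, norm_pow, norm_pow] at c1 c2
  have b1 : ‖y1‖ ≤ Mx ^ f / v0 ^ a1 := by
    rw [le_div_iff₀ (by positivity)]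
    calc ‖y1‖ * v0 ^ a1 ≤ ‖y1‖ * ‖Vq y1 y2‖ ^ a1 := by gcongr
      _ = ‖Xq y1 y2‖ ^ f := by rw [← c1]; ring
      _ ≤ _ := by gcongr
  have b2 : ‖y2‖ ≤ Mx ^ e / v0 ^ a2 := by
    rw [le_div_iff₀ (by positivity)]
    calc ‖y2‖ * v0 ^ a2 ≤ ‖y2‖ * ‖Vq y1 y2‖ ^ a2 := by gcongr
      _ = ‖Xq y1 y2‖ ^ e := by rw [← c2]; ring
      _ ≤ _ := by gcongr
  have : Sz M N y1 y2 ≤ (Mx ^ f / v0 ^ a1) ^ (M+1) + (Mx ^ e / v0 ^ a2) ^ (N+1) := by unfold Sz; gcongr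
  linarith

lemma Xc_cont (h : PAR) {y1 y2 : ℂ → ℂ} {z : ℂ} (h1 : ContinuousAt y1 z) (h2 : ContinuousAt y2 z) (n1 : y1 z ≠ 0) :
    ContinuousAt (fun z => Xq (y1 z) (y2 z)) z := by
  unfold Xc; exact (h2.pow _).div (h1.pow _) (pow_ne_zero _ n1)

lemma far_ev (h : PAR) {y1 y2 : ℂ → ℂ} {z : ℂ} (h1 : ContinuousAt y1 z) (h2 : ContinuousAt y2 z)
    (hS : 1 ≤ Sz M N (y1 z) (y2 z)) (Rt : Finset ℂ) (ε : ℝ) (hξ : ∀ ξ ∈ Rt, ε < ‖ξ‖)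
    (hfar : ∀ ξ ∈ Rt, ε < ‖Xq (y1 z) (y2 z) - ξ‖) : ∀ᶠ w in 𝓝 z, ∀ ξ ∈ Rt, ε < ‖Xq (y1 w) (y2 w) - ξ‖ := by
  by_cases n1 : y1 z = 0
  · have n2 : y2 z ≠ 0 := by
      intro h0
      rw [Sz, n1, h0] at hS
      simp at hS
      linarith
    rw [Finset.eventually_all]
    intro ξ hx
    have : ∀ᶠ w in 𝓝 z, ‖y1 w ^ a2‖ * (ε + ‖ξ‖) < ‖y2 w ^ a1‖ := by
      refine ((h1.pow a2).norm.mul continuousAt_const).eventually_lt (h2.pow a1).norm ?_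
      show ‖y1 z ^ a2‖ * (ε + ‖ξ‖) < ‖y2 z ^ a1‖
      rw [n1, zero_pow (by have := h.ha2; omega)]; simp only [norm_zero, zero_mul]
      exact norm_pos_iff.2 (pow_ne_zero _ n2)
    filter_upwards [this] with w hw
    by_cases nw : y1 w = 0
    · unfold Xc; rw [nw, zero_pow (by have := h.ha2; omega)]; simpa using hξ ξ hx
    · have hp : 0 < ‖y1 w ^ a2‖ := norm_pos_iff.2 (pow_ne_zero _ nw)
      have : ε + ‖ξ‖ < ‖Xq (y1 w) (y2 w)‖ := by
        unfold Xc; rw [norm_div, lt_div_iff₀ hp]; linarith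
      have := norm_sub_norm_le (Xq (y1 w) (y2 w)) ξ
      linarith
  · rw [Finset.eventually_all]
    intro ξ hx
    exact continuousAt_const.eventually_lt ((Xc_cont h h1 h2 n1).sub continuousAt_const).norm (hfar ξ hx)

lemma W_bounded (h : PAR) (α : ℕ × ℕ → ℂ → ℂ) (B : Set ℂ) (hB : IsOpen B) (γ : ℝ → ℂ) (hzi : γ 1 ∈ B)
    (hα : ∀ p ∈ JJ M N, AnalyticOnNhd ℂ (α p) B)
    (ha : α (0, N+1) (γ 1) ≠ 0) (hb0 : α (M+1, 0) (γ 1) ≠ 0)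
    (hbr : ∀ ξ, α (0, N+1) (γ 1) * ξ ^ d + α (M+1, 0) (γ 1) = 0 → ∃ P Pz PV S Q1 : ℂ → ℂ → ℂ, BRN α B (γ 1) ξ P Pz PV S Q1)
    (hγ : ContinuousOn γ (Set.Icc 0 1)) (hvar : eVariationOn γ (Set.Icc 0 1) ≠ ⊤)
    (y1 y2 : ℂ → ℂ)
    (hy : ∀ s ∈ Set.Ico (0:ℝ) 1, HasDerivAt y1 (F₁ M N α (γ s) (y1 (γ s)) (y2 (γ s))) (γ s) ∧ HasDerivAt y2 (F₂ M N α (γ s) (y1 (γ s)) (y2 (γ s))) (γ s))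
    (hS : Tendsto (fun s => Sz M N (y1 (γ s)) (y2 (γ s))) (𝓝[<] 1) atTop) :
    ∃ ξ, α (0, N+1) (γ 1) * ξ ^ d + α (M+1, 0) (γ 1) = 0 ∧ ∃ P Pz PV S Q1 : ℂ → ℂ → ℂ, BRN α B (γ 1) ξ P Pz PV S Q1 ∧
      Tendsto (fun s => Vq (y1 (γ s)) (y2 (γ s))) (𝓝[<] 1) (𝓝 0) ∧ ∃ s1 : ℝ, 0 ≤ s1 ∧ s1 < 1 ∧ ∃ K : ℝ, ∀ s ∈ Set.Ico s1 1,
        γ s ∈ B ∧ y1 (γ s) ≠ 0 ∧ y2 (γ s) ≠ 0 ∧ HXX (fun p => α p (γ s)) (Vq (y1 (γ s)) (y2 (γ s))) (Xq (y1 (γ s)) (y2 (γ s))) ≠ 0 ∧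
        ‖(Xq (y1 (γ s)) (y2 (γ s)) - P (γ s) (Vq (y1 (γ s)) (y2 (γ s)))) / Vq (y1 (γ s)) (y2 (γ s)) ^ n‖ ≤ K := by
  classical
  set zi := γ 1 with hzid
  obtain ⟨Rt, hRt, hRt2⟩ := root_set d h.hd _ (α (M+1, 0) zi) ha
  choose! P Pz PV S Q1 hBr using hbr
  have hbox : ∀ ξ, ∃ C : ℝ, ∃ η : ℝ, ξ ∈ Rt → 1 ≤ C ∧ 0 < η ∧ ∀ z V X, ‖z - zi‖ < η → ‖V‖ < η → ‖X - ξ‖ < η → Bx M N n a1 a2 e f e2 α B (P ξ) (Pz ξ) (S ξ) (Q1 ξ) C z V X := by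
    intro ξ
    by_cases hξ : ξ ∈ Rt
    · obtain ⟨C, h1, η, h2, h3⟩ := box_ev h α B hB zi ξ hzi hα ha hb0 ((hRt ξ).1 hξ) _ _ _ _ _ (hBr ξ ((hRt ξ).1 hξ))
      exact ⟨C, η, fun _ => ⟨h1, h2, h3⟩⟩
    · exact ⟨0, 0, fun hh => absurd hh hξ⟩
  choose C η hbox using hbox
  have lin : ∀ (c b : ℝ), 0 < b → ∀ᶠ x in 𝓝[>] (0:ℝ), c * x < b := by
    intro c b hb
    have : ContinuousAt (fun x : ℝ => c * x) 0 := by fun_prop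
    exact (this.eventually_lt continuousAt_const (by simpa using hb)).filter_mono nhdsWithin_le_nhds
  have hξ0 : ∀ ξ ∈ Rt, ξ ≠ 0 := fun ξ hξ => root_ne h (fun p => α p zi) hb0 ξ ((hRt ξ).1 hξ)
  obtain ⟨ε, hε, he1⟩ : ∃ ε : ℝ, 0 < ε ∧ ∀ ξ ∈ Rt, 2 * ε < η ξ ∧ 2 * ε < ‖ξ‖ ∧ ∀ ξ' ∈ Rt, ξ' ≠ ξ → 4 * ε < ‖ξ - ξ'‖ := by
    have : ∀ᶠ ε in 𝓝[>] (0:ℝ), ∀ ξ ∈ Rt, 2 * ε < η ξ ∧ 2 * ε < ‖ξ‖ ∧ ∀ ξ' ∈ Rt, ξ' ≠ ξ → 4 * ε < ‖ξ - ξ'‖ := by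
      rw [Finset.eventually_all]
      intro ξ hξ
      refine (lin _ _ (hbox ξ hξ).2.1).and ((lin _ _ (norm_pos_iff.2 (hξ0 ξ hξ))).and ?_)
      rw [Finset.eventually_all]
      intro ξ' hξ'
      by_cases hne : ξ' = ξ
      · simp [hne]
      · exact (lin 4 _ (norm_pos_iff.2 (sub_ne_zero.2 (Ne.symm hne)))).mono fun x hx _ => hx
    obtain ⟨ε, h1, h2⟩ := (this.and self_mem_nhdsWithin).exists
    exact ⟨ε, h2, h1⟩
  have hPc : ∀ ξ, ∃ η' : ℝ, ξ ∈ Rt → 0 < η' ∧ ∀ z V, ‖z - zi‖ < η' → ‖V‖ < η' → ‖P ξ z V - ξ‖ < ε / 6 := by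
    intro ξ
    by_cases hξ : ξ ∈ Rt
    · have hbb := (hBr ξ ((hRt ξ).1 hξ))
      obtain ⟨η', h1, h2⟩ := P_close hbb.hd.1 hzi (by positivity : 0 < ε / 6)
      rw [hbb.h0] at h2
      exact ⟨η', fun _ => ⟨h1, h2⟩⟩
    · exact ⟨0, fun hh => absurd hh hξ⟩
  choose η' hPc using hPc
  obtain ⟨v0, hv0, hv1⟩ : ∃ v : ℝ, 0 < v ∧ ∀ ξ ∈ Rt, 1 * v < η ξ ∧ 1 * v < η' ξ ∧ 1 * v < 1 ∧ 1 * v < ε / (6 * C ξ * C ξ) := by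
    have : ∀ᶠ v in 𝓝[>] (0:ℝ), ∀ ξ ∈ Rt, 1 * v < η ξ ∧ 1 * v < η' ξ ∧ 1 * v < 1 ∧ 1 * v < ε / (6 * C ξ * C ξ) := by
      rw [Finset.eventually_all]
      intro ξ hξ
      have := (hbox ξ hξ).1
      exact (lin _ _ (hbox ξ hξ).2.1).and ((lin _ _ (hPc ξ hξ).1).and ((lin _ _ one_pos).and (lin _ _ (by positivity))))
    obtain ⟨ε, h1, h2⟩ := (this.and self_mem_nhdsWithin).exists
    exact ⟨ε, h2, h1⟩
  have hlb : ∀ ξ, ∃ C' : ℝ, 0 ≤ C' ∧ (ξ ∈ Rt → ∀ z, Bx M N n a1 a2 e f e2 α B (P ξ) (Pz ξ) (S ξ) (Q1 ξ) (C ξ) z (Vq (y1 z) (y2 z)) (Xq (y1 z) (y2 z)) →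
    (∀ p ∈ JJ M N, DifferentiableAt ℂ (α p) z) →
    y1 z ≠ 0 → y2 z ≠ 0 → HasDerivAt y1 (F₁ M N α z (y1 z) (y2 z)) z → HasDerivAt y2 (F₂ M N α z (y1 z) (y2 z)) z →
    ‖Vq (y1 z) (y2 z)‖ ≤ 1 →
    ‖P ξ z (Vq (y1 z) (y2 z)) - ξ‖ ≤ ε / 6 → ‖Vq (y1 z) (y2 z)‖ ≤ ε / (6 * C ξ * C ξ) → 
    ∀ᶠ w in 𝓝 z, ‖Dx M N n a1 a2 e f α (P ξ) ε ξ y1 y2 w - Dx M N n a1 a2 e f α (P ξ) ε ξ y1 y2 z‖ ≤ C' * (‖Dx M N n a1 a2 e f α (P ξ) ε ξ y1 y2 z‖ + 1) * ‖w - z‖) := by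
    intro ξ
    by_cases hξ : ξ ∈ Rt
    · obtain ⟨C', h1, h2⟩ := loc_branch h α B zi ξ _ _ _ _ _ (hBr ξ ((hRt ξ).1 hξ)) (C ξ) ε (hbox ξ hξ).1 hε
      exact ⟨C', h1, fun _ => h2 y1 y2⟩
    · exact ⟨0, le_rfl, fun hh => absurd hh hξ⟩
  choose C' hC'0 hlb using hlb
  obtain ⟨Mx, hMx0, hMx⟩ : ∃ Mx : ℝ, 0 ≤ Mx ∧ ∀ X ξ, ξ ∈ Rt → ‖X - ξ‖ ≤ ε → ‖X‖ ≤ Mx := by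
    refine ⟨(∑ ξ ∈ Rt, ‖ξ‖) + ε, by positivity, fun X ξ hξ hX => ?_⟩
    have h1 : ‖ξ‖ ≤ ∑ ξ ∈ Rt, ‖ξ‖ := Finset.single_le_sum (f := fun ξ : ℂ => ‖ξ‖) (fun _ _ => norm_nonneg _) hξ
    have h2 := norm_sub_norm_le X ξ
    linarith
  obtain ⟨A1, hA1⟩ := V_small h Mx v0 hMx0 hv0
  have hαc : ∀ p ∈ JJ M N, ContinuousAt (α p) zi := fun p hp => (hα p hp zi hzi).continuousAt
  have hαd : ∀ p ∈ JJ M N, ContinuousAt (deriv (α p)) zi := fun p hp => (hα p hp zi hzi).deriv.continuousAt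
  obtain ⟨cF, hcF, A0, hA0, evF⟩ := far_bd h α zi hαc ha Rt hRt2 ε hε
  obtain ⟨CH, hCH, evH⟩ := mon_bd h (fun p => deriv (α p)) zi hαd
  have hγ1 : Tendsto γ (𝓝[<] 1) (𝓝 zi) := by
    have := (hγ 1 (by simp)).tendsto
    refine this.mono_left ?_
    rw [nhdsWithin_le_iff]
    exact mem_of_superset (Ioo_mem_nhdsLT (zero_lt_one' ℝ)) fun s hs => ⟨hs.1.le, hs.2.le⟩
  -- pointwise facts along the path
  have hsep : ∀ X ξ, ξ ∈ Rt → ‖X - ξ‖ < 2 * ε → ∀ ξ' ∈ Rt, ξ' ≠ ξ → ε ≤ ‖X - ξ'‖ := by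
    intro X ξ hξ hX ξ' hξ' hne
    have h1 := (he1 ξ hξ).2.2 ξ' hξ' hne
    have h2 := norm_sub_le_norm_sub_add_norm_sub ξ X ξ'
    rw [norm_sub_rev ξ X] at h2
    linarith
  set W : ℂ → ℂ := fun z => mon M N (fun p => α p z) (y1 z) (y2 z) - ∑ ξ ∈ Rt, (chi ε ‖Xq (y1 z) (y2 z) - ξ‖ : ℂ) * Gx M N n a1 a2 e f α (P ξ) y1 y2 z with hW
  have hWD : ∀ z ξ, ξ ∈ Rt → ‖Xq (y1 z) (y2 z) - ξ‖ < 2 * ε → W z = Dx M N n a1 a2 e f α (P ξ) ε ξ y1 y2 z := by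
    intro z ξ hξ hX
    simp only [hW, Dx]
    rw [Finset.sum_eq_single_of_mem ξ hξ]
    intro ξ' hξ' hne
    rw [chi_zero hε (hsep _ ξ hξ hX ξ' hξ' hne)]; simp
  have hWH : ∀ z, (∀ ξ ∈ Rt, ε < ‖Xq (y1 z) (y2 z) - ξ‖) → W z = mon M N (fun p => α p z) (y1 z) (y2 z) := by
    intro z hX
    simp only [hW]
    rw [Finset.sum_eq_zero, sub_zero]
    intro ξ hξ
    rw [chi_zero hε (hX ξ hξ).le]; simp
  have hnz : ∀ z ξ, ξ ∈ Rt → ‖Xq (y1 z) (y2 z) - ξ‖ ≤ ε → y1 z ≠ 0 ∧ y2 z ≠ 0 := by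
    intro z ξ hξ hX
    have h0 : Xq (y1 z) (y2 z) ≠ 0 := by
      intro h0; rw [h0, zero_sub, norm_neg] at hX
      linarith [(he1 ξ hξ).2.1]
    constructor
    · intro h1; apply h0; unfold Xc; rw [h1, zero_pow (by have := h.ha2; omega), div_zero]
    · intro h1; apply h0; unfold Xc; rw [h1, zero_pow (by have := h.ha1; omega), zero_div]
  have ev0 : ∀ᶠ s in 𝓝[<] (1:ℝ), ‖γ s - zi‖ < v0 ∧ γ s ∈ B ∧ A0 ≤ Sz M N (y1 (γ s)) (y2 (γ s)) ∧ A1 < Sz M N (y1 (γ s)) (y2 (γ s)) ∧ 0 < s ∧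
     (∀ y1 y2, A0 ≤ Sz M N y1 y2 → (y1 = 0 ∨ ∀ ξ ∈ Rt, ε ≤ ‖Xq y1 y2 - ξ‖) → cF * Sz M N y1 y2 ≤ ‖mon M N (fun p => α p (γ s)) y1 y2‖) ∧
     (∀ y1 y2, 1 ≤ Sz M N y1 y2 → ‖mon M N (fun p => deriv (α p) (γ s)) y1 y2‖ ≤ CH * Sz M N y1 y2) := by
    have q1 : ∀ᶠ s in 𝓝[<] (1:ℝ), ‖γ s - zi‖ < v0 := by
      have := Metric.tendsto_nhds.1 hγ1 v0 hv0
      exact this.mono fun s hs => by rwa [dist_eq_norm] at hs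
    have q2 : ∀ᶠ s in 𝓝[<] (1:ℝ), (0:ℝ) < s := mem_of_superset (Ioo_mem_nhdsLT (zero_lt_one' ℝ)) fun s hs => hs.1
    exact q1.and ((hγ1.eventually (hB.mem_nhds hzi)).and ((hS.eventually_ge_atTop A0).and ((hS.eventually_gt_atTop A1).and (q2.and
      ((hγ1.eventually evF).and (hγ1.eventually evH))))))
  obtain ⟨s0', hs0', hs0⟩ := (mem_nhdsLT_iff_exists_Ioo_subset).1 ev0
  set s0 := (s0' + 1) / 2 with hs0d
  have hs0l : s0' < s0 := by have : s0' < 1 := hs0'; rw [hs0d]; linarith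
  have hs01 : s0 < 1 := by have : s0' < 1 := hs0'; rw [hs0d]; linarith
  have ev1 : ∀ s ∈ Set.Ico s0 1, _ := fun s (hs : s ∈ Set.Ico s0 1) => hs0 ⟨hs0l.trans_le hs.1, hs.2⟩
  have s0p : 0 < s0 := (ev1 s0 ⟨le_rfl, hs01⟩).2.2.2.2.1
  have hgood : ∀ s ∈ Set.Ico s0 1, ∀ ξ ∈ Rt, ‖Xq (y1 (γ s)) (y2 (γ s)) - ξ‖ ≤ ε →
      y1 (γ s) ≠ 0 ∧ y2 (γ s) ≠ 0 ∧ ‖Vq (y1 (γ s)) (y2 (γ s))‖ < v0 ∧ 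
      Bx M N n a1 a2 e f e2 α B (P ξ) (Pz ξ) (S ξ) (Q1 ξ) (C ξ) (γ s) (Vq (y1 (γ s)) (y2 (γ s))) (Xq (y1 (γ s)) (y2 (γ s))) ∧
      ‖P ξ (γ s) (Vq (y1 (γ s)) (y2 (γ s))) - ξ‖ ≤ ε / 6 := by
    intro s hs ξ hξ hX
    obtain ⟨n1, n2⟩ := hnz (γ s) ξ hξ hX
    have ev := ev1 s hs
    have hV := hA1 _ _ n1 n2 (hMx _ ξ hξ hX) ev.2.2.2.1
    have hv := hv1 ξ hξ
    simp only [one_mul] at hv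
    exact ⟨n1, n2, hV, (hbox ξ hξ).2.2 _ _ _ (ev.1.trans hv.1) (hV.trans hv.1) (by linarith [(he1 ξ hξ).1]),
      ((hPc ξ hξ).2 _ _ (ev.1.trans hv.2.1) (hV.trans hv.2.1)).le⟩
  have hαdf : ∀ s ∈ Set.Ico s0 1, ∀ p ∈ JJ M N, DifferentiableAt ℂ (α p) (γ s) := fun s hs p hp => (hα p hp _ (ev1 s hs).2.1).differentiableAt
  have hyI : ∀ s ∈ Set.Ico s0 1, _ := fun s (hs : s ∈ Set.Ico s0 1) => hy s ⟨s0p.le.trans hs.1, hs.2⟩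
  have hlipW : ∀ s ∈ Set.Ico s0 1, ∀ᶠ z in 𝓝 (γ s), ‖W z - W (γ s)‖ ≤ (∑ ξ ∈ Rt, C' ξ + (CH / cF + 1)) * (‖W (γ s)‖ + 1) * ‖z - γ s‖ := by
    intro s hs
    have ev := ev1 s hs
    obtain ⟨h1, h2⟩ := hyI s hs
    have hCs : 0 ≤ ∑ ξ ∈ Rt, C' ξ := Finset.sum_nonneg fun _ _ => hC'0 _
    have hCF : 0 ≤ CH / cF := by positivity
    by_cases hn : ∃ ξ ∈ Rt, ‖Xq (y1 (γ s)) (y2 (γ s)) - ξ‖ ≤ ε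
    · obtain ⟨ξ, hξ, hX⟩ := hn
      obtain ⟨n1, n2, hV, hbx, hP⟩ := hgood s hs ξ hξ hX
      have hv := hv1 ξ hξ
      simp only [one_mul] at hv
      have L := hlb ξ hξ (γ s) hbx (hαdf s hs) n1 n2 h1 h2 (by linarith) hP (by linarith)
      have hX3 : ‖Xq (y1 (γ s)) (y2 (γ s)) - ξ‖ < 2 * ε := by linarith
      have evX : ∀ᶠ w in 𝓝 (γ s), ‖Xq (y1 w) (y2 w) - ξ‖ < 2 * ε :=
        ((Xc_cont h h1.continuousAt h2.continuousAt n1).sub continuousAt_const).norm.eventually_lt continuousAt_const hX3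
      filter_upwards [L, evX] with w w1 w2
      rw [hWD w ξ hξ w2, hWD (γ s) ξ hξ (by linarith)]
      refine w1.trans ?_
      have : C' ξ ≤ ∑ ξ ∈ Rt, C' ξ := Finset.single_le_sum (f := C') (fun ξ _ => hC'0 ξ) hξ
      gcongr; linarith
    · push Not at hn
      have hS1 : 1 ≤ Sz M N (y1 (γ s)) (y2 (γ s)) := hA0.trans ev.2.2.1
      have evX := far_ev h h1.continuousAt h2.continuousAt hS1 Rt ε (fun ξ hξ => by linarith [(he1 ξ hξ).2.1]) hn
      have dH := mon_deriv α y1 y2 h (γ s) (hαdf s hs) h1 h2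
      filter_upwards [evX, lip_of_deriv dH] with w w1 w2
      rw [hWH w w1, hWH (γ s) hn]
      refine w2.trans ?_
      have b1 := ev.2.2.2.2.2.2 _ _ hS1
      have b2 := ev.2.2.2.2.2.1 _ _ ev.2.2.1 (Or.inr fun ξ hξ => (hn ξ hξ).le)
      have b3 : Sz M N (y1 (γ s)) (y2 (γ s)) ≤ ‖mon M N (fun p => α p (γ s)) (y1 (γ s)) (y2 (γ s))‖ / cF := by
        rw [le_div_iff₀ hcF]; linarith
      set u := ‖mon M N (fun p => α p (γ s)) (y1 (γ s)) (y2 (γ s))‖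
      have hu : 0 ≤ u := norm_nonneg _
      have b4 : CH * Sz M N (y1 (γ s)) (y2 (γ s)) ≤ CH / cF * u := by
        calc _ ≤ CH * (u / cF) := by gcongr
          _ = _ := by ring
      gcongr
      nlinarith
  obtain ⟨K, hK⟩ := path_gronwall γ s0 hs01 (hγ.mono fun s hs => ⟨s0p.le.trans hs.1, hs.2.le⟩)
    (ne_top_of_le_ne_top hvar (eVariationOn.mono _ (Set.Icc_subset_Icc_left s0p.le))) W _ (by
      have hCs : 0 ≤ ∑ ξ ∈ Rt, C' ξ := Finset.sum_nonneg fun _ _ => hC'0 _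
      positivity) hlipW
  -- small V on mid region
  obtain ⟨v2, hv2, hv2'⟩ : ∃ v : ℝ, 0 < v ∧ ∀ ξ ∈ Rt, 6 * C ξ * (K + 1) * v ^ n < ε := by
    have : ∀ᶠ v in 𝓝[>] (0:ℝ), ∀ ξ ∈ Rt, 6 * C ξ * (K + 1) * v ^ n < ε := by
      rw [Finset.eventually_all]
      intro ξ hξ
      have : ContinuousAt (fun x : ℝ => 6 * C ξ * (K + 1) * x ^ n) 0 := by fun_prop
      exact (this.eventually_lt continuousAt_const (by simpa [par_n h] using hε)).filter_mono nhdsWithin_le_nhds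
    obtain ⟨ε, h1, h2⟩ := (this.and self_mem_nhdsWithin).exists
    exact ⟨ε, h2, h1⟩
  obtain ⟨A2, hA2⟩ := V_small h Mx v2 hMx0 hv2
  have evn : ∀ᶠ s in 𝓝[<] (1:ℝ), s ∈ Set.Ico s0 1 ∧ ∃ ξ ∈ Rt, ‖Xq (y1 (γ s)) (y2 (γ s)) - ξ‖ < ε / 2 := by
    have q2 : ∀ᶠ s in 𝓝[<] (1:ℝ), s ∈ Set.Ico s0 1 := mem_of_superset (Ioo_mem_nhdsLT hs01) fun s hs => ⟨hs.1.le, hs.2⟩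
    filter_upwards [q2, hS.eventually_gt_atTop A2, hS.eventually_gt_atTop (K / cF)] with s hs sA sK
    refine ⟨hs, ?_⟩
    have ev := ev1 s hs
    have hKs := hK s hs
    by_cases hn : ∃ ξ ∈ Rt, ‖Xq (y1 (γ s)) (y2 (γ s)) - ξ‖ ≤ ε
    · obtain ⟨ξ, hξ, hX⟩ := hn
      refine ⟨ξ, hξ, ?_⟩
      by_contra hX2
      have hX2 := not_lt.1 hX2
      obtain ⟨n1, n2, hV, hbx, hP⟩ := hgood s hs ξ hξ hX
      have hv := hv1 ξ hξ
      simp only [one_mul] at hv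
      have hC1 := (hbox ξ hξ).1
      have lo := (mid_lower h α B zi ξ _ _ _ _ _ (hBr ξ ((hRt ξ).1 hξ)) (C ξ) ε hC1 hε y1 y2 (γ s) hbx n1 n2 (by linarith)).2.2 hP (by linarith) hX2
      rw [← hWD (γ s) ξ hξ (by linarith)] at lo
      have hVp := norm_pos_iff.2 (Vc_ne (e := e) (f := f) n1 n2)
      have hVs := hA2 _ _ n1 n2 (hMx _ ξ hξ hX) sA
      have l2 : ε / (6 * C ξ) * (‖Vq (y1 (γ s)) (y2 (γ s))‖ ^ n)⁻¹ ≤ K := lo.trans hKs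
      rw [← div_eq_mul_inv, div_le_iff₀ (by positivity), div_le_iff₀ (by positivity)] at l2
      have l3 : ‖Vq (y1 (γ s)) (y2 (γ s))‖ ^ n ≤ v2 ^ n := by gcongr
      have hK0 : 0 ≤ K := (norm_nonneg _).trans hKs
      have l4 := hv2' ξ hξ
      have l5 : K * ‖Vq (y1 (γ s)) (y2 (γ s))‖ ^ n * (6 * C ξ) ≤ (K + 1) * v2 ^ n * (6 * C ξ) := by gcongr; linarith
      linarith
    · push Not at hn
      exfalso
      rw [hWH (γ s) hn] at hKs
      have b2 := ev.2.2.2.2.2.1 _ _ ev.2.2.1 (Or.inr fun ξ hξ => (hn ξ hξ).le)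
      rw [div_lt_iff₀ hcF] at sK
      linarith
  obtain ⟨s1', hs1', hs1⟩ := (mem_nhdsLT_iff_exists_Ioo_subset).1 evn
  set s1 := (s1' + 1) / 2 with hs1d
  have hs1l : s1' < s1 := by have : s1' < 1 := hs1'; rw [hs1d]; linarith
  have hs11 : s1 < 1 := by have : s1' < 1 := hs1'; rw [hs1d]; linarith
  have ev2 : ∀ s ∈ Set.Ico s1 1, s ∈ Set.Ico s0 1 ∧ ∃ ξ ∈ Rt, ‖Xq (y1 (γ s)) (y2 (γ s)) - ξ‖ < ε / 2 :=
    fun s hs => hs1 ⟨hs1l.trans_le hs.1, hs.2⟩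
  obtain ⟨hs1I, ξ, hξ, hX1⟩ := ev2 s1 ⟨le_rfl, hs11⟩
  have hcon : ∀ s ∈ Set.Ico s1 1, ‖Xq (y1 (γ s)) (y2 (γ s)) - ξ‖ < ε / 2 := by
    have hc : ContinuousOn (fun s => Xq (y1 (γ s)) (y2 (γ s))) (Set.Ico s1 1) := by
      intro s hs
      obtain ⟨hs', ξ', hξ', hX'⟩ := ev2 s hs
      obtain ⟨h1, h2⟩ := hyI s hs'
      have n1 := (hnz (γ s) ξ' hξ' (by linarith)).1
      have hg : ContinuousWithinAt γ (Set.Ico s1 1) s := (hγ s ⟨s0p.le.trans hs'.1, hs.2.le⟩).mono fun t ht => ⟨s0p.le.trans (hs1I.1.trans ht.1), ht.2.le⟩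
      exact (Xc_cont h h1.continuousAt h2.continuousAt n1).comp_continuousWithinAt hg
    have himg := (isPreconnected_Ico (a := s1) (b := 1)).image _ hc
    have hsub := IsPreconnected.subset_left_of_subset_union (s := (fun s => Xq (y1 (γ s)) (y2 (γ s))) '' Set.Ico s1 1) (u := ball ξ (ε/2)) (v := ⋃ ξ' ∈ Rt.erase ξ, ball ξ' (ε/2)) isOpen_ball (isOpen_biUnion fun _ _ => isOpen_ball)
      (by
        rw [Set.disjoint_left]
        intro X hX hX'
        simp only [Set.mem_iUnion, Finset.mem_erase, mem_ball, dist_eq_norm, exists_prop] at hX hX'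
        obtain ⟨ξ', ⟨hne, hξ'⟩, hX''⟩ := hX'
        have := hsep X ξ hξ (by linarith) ξ' hξ' hne
        linarith)
      (by
        rintro _ ⟨s, hs, rfl⟩
        obtain ⟨_, ξ', hξ', hX'⟩ := ev2 s hs
        by_cases he : ξ' = ξ
        · left; rw [mem_ball, dist_eq_norm, ← he]; exact hX'
        · right; simp only [Set.mem_iUnion, Finset.mem_erase, mem_ball, dist_eq_norm, exists_prop]
          exact ⟨ξ', ⟨he, hξ'⟩, hX'⟩)
      ⟨_, Set.mem_image_of_mem _ (⟨le_rfl, hs11⟩ : s1 ∈ Set.Ico s1 1), by rw [mem_ball, dist_eq_norm]; exact hX1⟩ himg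
    intro s hs
    have := hsub (Set.mem_image_of_mem _ hs)
    rwa [mem_ball, dist_eq_norm] at this
  have evI : ∀ᶠ s in 𝓝[<] (1:ℝ), s ∈ Set.Ico s1 1 := mem_of_superset (Ioo_mem_nhdsLT hs11) fun s hs => ⟨hs.1.le, hs.2⟩
  refine ⟨ξ, (hRt ξ).1 hξ, P ξ, Pz ξ, PV ξ, S ξ, Q1 ξ, hBr ξ ((hRt ξ).1 hξ), ?_, s1, s0p.le.trans hs1I.1, hs11, K * C ξ, ?_⟩
  · rw [Metric.tendsto_nhds]
    intro v hv
    obtain ⟨A3, hA3⟩ := V_small h Mx v hMx0 hv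
    filter_upwards [evI, hS.eventually_gt_atTop A3] with s hs sA
    have hX := hcon s hs
    obtain ⟨n1, n2⟩ := hnz (γ s) ξ hξ (by linarith)
    rw [dist_zero_right]
    exact hA3 _ _ n1 n2 (hMx _ ξ hξ (by linarith)) sA
  · intro s hs
    have hX := hcon s hs
    have hs' := (ev2 s hs).1
    obtain ⟨n1, n2, hV, hbx, hP⟩ := hgood s hs' ξ hξ (by linarith)
    refine ⟨hbx.hz, n1, n2, hbx.hx, ?_⟩
    have hKs := hK s hs'
    rw [hWD (γ s) ξ hξ (by linarith)] at hKs
    have eD : Dx M N n a1 a2 e f α (P ξ) ε ξ y1 y2 (γ s) = Wx M N n a1 a2 e f α (P ξ) (γ s) (Vq (y1 (γ s)) (y2 (γ s))) (Xq (y1 (γ s)) (y2 (γ s))) := by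
      unfold Dx Gx; rw [chi_one hε hX.le]; push_cast; ring
    rw [eD, Wx] at hKs
    have d0 := hbx.d0
    have d1 := hbx.d1
    set D := HDD (fun p => α p (γ s)) (Vq (y1 (γ s)) (y2 (γ s))) (Xq (y1 (γ s)) (y2 (γ s))) (P ξ (γ s) (Vq (y1 (γ s)) (y2 (γ s))))
    have : (Xq (y1 (γ s)) (y2 (γ s)) - P ξ (γ s) (Vq (y1 (γ s)) (y2 (γ s)))) / Vq (y1 (γ s)) (y2 (γ s)) ^ n =
      ((Xq (y1 (γ s)) (y2 (γ s)) - P ξ (γ s) (Vq (y1 (γ s)) (y2 (γ s)))) * D / Vq (y1 (γ s)) (y2 (γ s)) ^ n) * D⁻¹ := by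
      field_simp
    rw [this, norm_mul]
    have hK0 : 0 ≤ K := (norm_nonneg _).trans hKs
    gcongr



lemma inv_chart (κ : ℕ) (hκ : 1 ≤ κ) (F g : ℂ → ℂ) (hF : AnalyticAt ℂ F 0) (hg : AnalyticAt ℂ g 0) (hg0 : g 0 ≠ 0)
    (h : ∀ᶠ V in 𝓝 (0:ℂ), HasDerivAt F (V ^ (κ-1) * g V) V) :
    ∃ q Λ : ℂ → ℂ, AnalyticAt ℂ q 0 ∧ AnalyticAt ℂ Λ 0 ∧ q 0 ≠ 0 ∧
      ∀ᶠ V in 𝓝 (0:ℂ), (V * q V) ^ κ = F V - F 0 ∧ Λ (V * q V) = V := by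
  have o1 : analyticOrderAt (deriv F) 0 = ((κ-1 : ℕ) : ℕ∞) := by
    rw [hF.deriv.analyticOrderAt_eq_natCast]
    exact ⟨g, hg, hg0, by filter_upwards [h] with V hV; simp [hV.deriv]⟩
  have o2 := hF.analyticOrderAt_deriv_add_one
  rw [o1] at o2
  have o3 : analyticOrderAt (fun z => F z - F 0) 0 = (κ : ℕ∞) := by
    rw [← o2]; norm_cast; omega
  have hFs : AnalyticAt ℂ (fun z => F z - F 0) 0 := hF.sub analyticAt_const
  rw [hFs.analyticOrderAt_eq_natCast] at o3
  obtain ⟨k, hk, hk0, hk1⟩ := o3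
  simp only [sub_zero, smul_eq_mul] at hk1
  obtain ⟨c, hc⟩ := IsAlgClosed.exists_pow_nat_eq (k 0) (by omega : 0 < κ)
  have hc0 : c ≠ 0 := by rintro rfl; rw [zero_pow (by omega)] at hc; exact hk0 hc.symm
  have hκ0 : (κ:ℂ) ≠ 0 := by exact_mod_cast (by omega : κ ≠ 0)
  have kd : AnalyticAt ℂ (fun V => k V / k 0) 0 := hk.div analyticAt_const hk0
  have kl : AnalyticAt ℂ (fun V => Complex.log (k V / k 0)) 0 := by
    refine kd.clog ?_
    simp [hk0]
  have hq : AnalyticAt ℂ (fun V => c * Complex.exp (Complex.log (k V / k 0) / κ)) 0 :=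
    analyticAt_const.mul (kl.div analyticAt_const hκ0).cexp
  set q : ℂ → ℂ := fun V => c * Complex.exp (Complex.log (k V / k 0) / κ) with hqd
  have hq0 : q 0 ≠ 0 := mul_ne_zero hc0 (Complex.exp_ne_zero _)
  have hΘ : AnalyticAt ℂ (fun V => V * q V) 0 := analyticAt_id.mul hq
  have hd : HasDerivAt (fun V => V * q V) (q 0) 0 := by
    refine ((hasDerivAt_id (0:ℂ)).mul hq.differentiableAt.hasDerivAt).congr_deriv ?_
    simp
  have hd' : deriv (fun V => V * q V) 0 ≠ 0 := by rw [hd.deriv]; exact hq0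
  have hL := hΘ.analyticAt_localInverse hd'
  have hli := (hΘ.hasStrictDerivAt).hasStrictFDerivAt_equiv hd' |>.eventually_left_inverse
  refine ⟨q, _, hq, by simpa using hL, hq0, ?_⟩
  have hkn : ∀ᶠ V in 𝓝 (0:ℂ), k V ≠ 0 := hk.continuousAt.eventually_ne hk0
  filter_upwards [hk1, hli, hkn] with V h1 h2 h3
  refine ⟨?_, h2⟩
  rw [h1, mul_pow, hqd]
  congr 1
  simp only [mul_pow, hc, ← Complex.exp_nat_mul]
  rw [mul_div_cancel₀ _ hκ0, Complex.exp_log (div_ne_zero h3 hk0)]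
  field_simp



noncomputable def ee (l : ℕ) (x y : ℂ) : ℂ := ∑ i ∈ Finset.range l, x ^ i * dd (l-1-i) x y
lemma ee_mul (l : ℕ) (x y : ℂ) : (l:ℂ) * x ^ (l-1) - dd l x y = (x-y) * ee l x y := by
  have : (l:ℂ) * x ^ (l-1) = ∑ i ∈ Finset.range l, x ^ i * x ^ (l-1-i) := by
    rw [← dd_self]; rfl
  rw [this, dd, ee, ← Finset.sum_sub_distrib, Finset.mul_sum]
  refine Finset.sum_congr rfl fun i _ => ?_
  linear_combination x ^ i * dd_mul (l-1-i) x y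
noncomputable def h3 (J : Finset (ℕ × ℕ)) (k l : ℕ × ℕ → ℕ) (c : ℕ × ℕ → ℂ) (V x y : ℂ) : ℂ :=
  ∑ p ∈ J, c p * V ^ k p * ee (l p) x y
lemma h3_mul (J : Finset (ℕ × ℕ)) (k l : ℕ × ℕ → ℕ) (c : ℕ × ℕ → ℂ) (V x y : ℂ) :
    hX J k l c V x - hD J k l c V x y = (x-y) * h3 J k l c V x y := by
  unfold hX hD h3
  rw [← Finset.sum_sub_distrib, Finset.mul_sum]
  refine Finset.sum_congr rfl fun p _ => ?_
  linear_combination (c p * V ^ k p) * ee_mul (l p) x y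
lemma hDE_V (J : Finset (ℕ × ℕ)) (k l : ℕ × ℕ → ℕ) (c : ℕ × ℕ → ℂ) (V x y : ℂ) :
    hD J k l (fun p => c p * k p) V x y = V * hD J (fun p => k p - 1) l (fun p => c p * k p) V x y := by
  unfold hD
  rw [Finset.mul_sum]
  refine Finset.sum_congr rfl fun p _ => ?_
  rcases hk : k p with _ | m
  · simp [hk]
  · simp only [hk, Nat.add_sub_cancel, pow_succ]; ring

section
variable {E : Type*} [NormedAddCommGroup E] [NormedSpace ℂ E] {x₀ : E}
lemma h3_an {J : Finset (ℕ × ℕ)} (k l : ℕ × ℕ → ℕ) {c : E → ℕ × ℕ → ℂ} {V x y : E → ℂ}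
    (hc : ∀ p ∈ J, AnalyticAt ℂ (fun t => c t p) x₀) (hV : AnalyticAt ℂ V x₀) (hx : AnalyticAt ℂ x x₀)
    (hy : AnalyticAt ℂ y x₀) :
    AnalyticAt ℂ (fun t => h3 J k l (c t) (V t) (x t) (y t)) x₀ := by
  unfold h3 ee
  exact Finset.analyticAt_fun_sum _ fun p hp => ((hc p hp).mul (hV.pow _)).mul
    (Finset.analyticAt_fun_sum _ fun i _ => (hx.pow i).mul (dd_an _ hx hy))
end


noncomputable def Tx (J : Finset (ℕ × ℕ)) (k l : ℕ × ℕ → ℕ) (n κ e2 : ℕ) (c : ℕ × ℕ → ℂ) (V X P Pz PV w : ℂ) : ℂ :=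
  hD J (fun p => k p - 1) l (fun p => c p * k p) V X P - V ^ (κ-1) * Pz * dd e2 X P
    + PV * hD J k (fun p => l p - 1) (fun p => c p * l p) V X P + n * V ^ (n-1) * w * h3 J k l c V X P

lemma w_alg (J : Finset (ℕ × ℕ)) (k l : ℕ × ℕ → ℕ) (n κ e2 : ℕ) (hn : 1 ≤ n) (hκ : 1 ≤ κ) (c : ℕ × ℕ → ℂ) (V X P Pz PV S w : ℂ)
    (hV : V ≠ 0) (hXn : X ≠ 0) (hh : hX J k l c V X ≠ 0) (hw : X = P + V ^ n * w)
    (hr : hE J k l c V P + V * (hX J k l c V P * PV) - n * hs J k l c V P - V ^ κ * P ^ e2 * Pz = V ^ (n+κ) * S) :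
    ((hE J k l c V X - n * hs J k l c V X) / (V ^ κ * X ^ e2) - (Pz + PV * (-V * hX J k l c V X / (V ^ κ * X ^ e2)))) / V ^ n
      - n * w * (-V * hX J k l c V X / (V ^ κ * X ^ e2)) / V
    = (-V * hX J k l c V X / (V ^ κ * X ^ e2)) * (-(V ^ (κ-1) * S + w * Tx J k l n κ e2 c V X P Pz PV w) / hX J k l c V X) := by
  have q1 := hD_mul J k l (fun p => c p * k p) V X P
  rw [← hE_eq, ← hE_eq, hDE_V] at q1
  have q2 := hD_mul J k l c V X P
  have q3 := hD_mul J k (fun p => l p - 1) (fun p => c p * l p) V X P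
  rw [← hX_eq, ← hX_eq] at q3
  have q4 := h3_mul J k l c V X P
  have q5 := dd_mul e2 X P
  have v1 : V ^ n = V ^ (n-1) * V := by rw [← pow_succ]; congr 1; omega
  have v2 : V ^ κ = V ^ (κ-1) * V := by rw [← pow_succ]; congr 1; omega
  have hxp : X - P = V ^ n * w := by rw [hw]; ring
  rw [hxp] at q1 q2 q3 q4 q5
  have hVκ := pow_ne_zero κ hV
  have hVn := pow_ne_zero n hV
  have hXe := pow_ne_zero e2 hXn
  have key : hE J k l c V X - n * hs J k l c V X - V ^ κ * X ^ e2 * Pz + PV * V * hX J k l c V X + n * w * V ^ n * hX J k l c V X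
      = V ^ n * (V * (V ^ (κ-1) * S + w * Tx J k l n κ e2 c V X P Pz PV w)) := by
    unfold Tx
    rw [pow_add] at hr
    linear_combination hr + q1 - n * q2 + PV * V * q3 + n * w * V ^ n * q4 - V ^ κ * Pz * q5 
      + (n * w * V ^ n * w * h3 J k l c V X P) * v1 + (V ^ n * S - V ^ n * w * Pz * dd e2 X P) * v2
  have lhs : ((hE J k l c V X - n * hs J k l c V X) / (V ^ κ * X ^ e2) - (Pz + PV * (-V * hX J k l c V X / (V ^ κ * X ^ e2)))) / V ^ n
      - n * w * (-V * hX J k l c V X / (V ^ κ * X ^ e2)) / V = (hE J k l c V X - n * hs J k l c V X - V ^ κ * X ^ e2 * Pz + PV * V * hX J k l c V X + n * w * V ^ n * hX J k l c V X) / (V ^ κ * X ^ e2 * V ^ n) := by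
    field_simp; ring
  rw [lhs, key]
  field_simp

noncomputable def ff (M N n a1 a2 e f κ e2 : ℕ) (α : ℕ × ℕ → ℂ → ℂ) (P Pz PV S : ℂ → ℂ → ℂ) (x : ℂ × ℂ × ℂ) : ℂ × ℂ :=
  (-(x.1 ^ (κ-1) * (P x.2.1 x.1 + x.1 ^ n * x.2.2) ^ e2) / hX (JJ M N) (kk n a1 a2) (ll e f) (fun p => α p x.2.1) x.1 (P x.2.1 x.1 + x.1 ^ n * x.2.2),
   -(x.1 ^ (κ-1) * S x.2.1 x.1 + x.2.2 * Tx (JJ M N) (kk n a1 a2) (ll e f) n κ e2 (fun p => α p x.2.1) x.1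
      (P x.2.1 x.1 + x.1 ^ n * x.2.2) (P x.2.1 x.1) (Pz x.2.1 x.1) (PV x.2.1 x.1) x.2.2)
      / hX (JJ M N) (kk n a1 a2) (ll e f) (fun p => α p x.2.1) x.1 (P x.2.1 x.1 + x.1 ^ n * x.2.2))

lemma ff_an (h : PAR) (α : ℕ × ℕ → ℂ → ℂ) (B : Set ℂ) (zi ξ : ℂ) (hzi : zi ∈ B)
    (hα : ∀ p ∈ JJ M N, AnalyticOnNhd ℂ (α p) B)
    (ha : α (0, N+1) zi ≠ 0) (hb0 : α (M+1, 0) zi ≠ 0) (hroot : α (0, N+1) zi * ξ ^ d + α (M+1, 0) zi = 0)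
    (P Pz PV S Q1 : ℂ → ℂ → ℂ) (hn : n ≠ 0)
    (hb : BRN α B zi ξ P Pz PV S Q1) (w : ℂ) :
    AC (ff M N n a1 a2 e f κ e2 α P Pz PV S) (0, (zi, w)) := by
  let x₀ : ℂ × ℂ × ℂ := (0, zi, w)
  have aV : AC (fun x : ℂ × ℂ × ℂ => x.1) x₀ := analyticAt_fst
  have az : AC (fun x : ℂ × ℂ × ℂ => x.2.1) x₀ := analyticAt_fst.comp analyticAt_snd
  have aw : AC (fun x : ℂ × ℂ × ℂ => x.2.2) x₀ := analyticAt_snd.comp analyticAt_snd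
  have cmp : ∀ F : ℂ → ℂ → ℂ, An2 B F → AC (fun x : ℂ × ℂ × ℂ => F x.2.1 x.1) x₀ := by
    intro F hF
    have h1 := hF zi hzi 0
    exact AnalyticAt.comp (f := fun x : ℂ × ℂ × ℂ => (x.2.1, x.1)) (x := x₀) h1 (az.prod aV)
  have aP := cmp P hb.hd.1
  have aPz := cmp Pz hb.hd.2.1
  have aPV := cmp PV hb.hd.2.2.1
  have aS := cmp S hb.hS
  have ac : ∀ p ∈ JJ M N, AC (fun x : ℂ × ℂ × ℂ => α p x.2.1) x₀ := fun p hp =>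
    AnalyticAt.comp (f := fun x : ℂ × ℂ × ℂ => x.2.1) (x := x₀) (hα p hp zi hzi) az
  have aX : AC (fun x : ℂ × ℂ × ℂ => P x.2.1 x.1 + x.1 ^ n * x.2.2) x₀ := aP.add ((aV.pow n).mul aw)
  have ahX := hX_an (kk n a1 a2) (ll e f) ac aV aX
  have hX0 : HXX (fun p => α p x₀.2.1) x₀.1 (P x₀.2.1 x₀.1 + x₀.1 ^ n * x₀.2.2) ≠ 0 := by
    show HXX (fun p => α p zi) 0 (P zi 0 + 0 ^ n * w) ≠ 0
    rw [hb.h0, zero_pow hn, zero_mul, add_zero]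
    exact hX_root_ne h (fun p => α p zi) ha hb0 ξ hroot
  have aT : AC (fun x : ℂ × ℂ × ℂ => Tx (JJ M N) (kk n a1 a2) (ll e f) n κ e2 (fun p => α p x.2.1) x.1
      (P x.2.1 x.1 + x.1 ^ n * x.2.2) (P x.2.1 x.1) (Pz x.2.1 x.1) (PV x.2.1 x.1) x.2.2) x₀ := by
    unfold Tx
    refine AnalyticAt.add (AnalyticAt.add (AnalyticAt.sub ?_ ?_) ?_) ?_
    · exact hD_an _ _ (fun p hp => (ac p hp).mul analyticAt_const) aV aX aP
    · exact ((aV.pow _).mul aPz).mul (dd_an _ aX aP)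
    · exact aPV.mul (hD_an _ _ (fun p hp => (ac p hp).mul analyticAt_const) aV aX aP)
    · exact ((analyticAt_const.mul (aV.pow _)).mul aw).mul (h3_an _ _ ac aV aX aP)
  refine AnalyticAt.prod ?_ ?_
  · exact (((aV.pow _).mul (aX.pow _)).neg).div ahX hX0
  · exact ((((aV.pow _).mul aS).add (aw.mul aT)).neg).div ahX hX0

lemma loc_flow (h : PAR) (hn : 1 ≤ n) (α : ℕ × ℕ → ℂ → ℂ) (B : Set ℂ) (zi ξ : ℂ)
    (P Pz PV S Q1 : ℂ → ℂ → ℂ)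
    (hb : BRN α B zi ξ P Pz PV S Q1) (y1 y2 : ℂ → ℂ) (z : ℂ) (hz : z ∈ B)
    (n1 : y1 z ≠ 0) (n2 : y2 z ≠ 0)
    (h1 : HasDerivAt y1 (F₁ M N α z (y1 z) (y2 z)) z) (h2 : HasDerivAt y2 (F₂ M N α z (y1 z) (y2 z)) z)
    (hh : HXX (fun p => α p z) (Vq (y1 z) (y2 z)) (Xq (y1 z) (y2 z)) ≠ 0) :
    HasDerivAt (fun z => (z, (Xq (y1 z) (y2 z) - P z (Vq (y1 z) (y2 z))) / Vq (y1 z) (y2 z) ^ n))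
      ((- Vq (y1 z) (y2 z) * HXX (fun p => α p z) (Vq (y1 z) (y2 z)) (Xq (y1 z) (y2 z))
      / (Vq (y1 z) (y2 z) ^ κ * Xq (y1 z) (y2 z) ^ e2)) •
        ff M N n a1 a2 e f κ e2 α P Pz PV S (Vq (y1 z) (y2 z), (z, (Xq (y1 z) (y2 z) - P z (Vq (y1 z) (y2 z))) / Vq (y1 z) (y2 z) ^ n))) z := by
  have dV := Vc_deriv h α y1 y2 z n1 n2 h1 h2
  have dX := Xc_deriv h α y1 y2 z n1 n2 h1 h2
  have hV := Vc_ne (e := e) (f := f) n1 n2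
  have hXn := Xc_ne (a1 := a1) (a2 := a2) n1 n2
  have hVn := pow_ne_zero n hV
  have dP := hb.hd.2.2.2 (fun z => z) _ _ _ z (hasDerivAt_id z) dV hz
  have dw := (dX.sub dP).div (dV.pow n) hVn
  have hr := hb.hr z hz (Vq (y1 z) (y2 z))
  unfold resid at hr
  have hκ := h.hκ1
  refine ((hasDerivAt_id z).prodMk dw).congr_deriv ?_
  simp only [Pi.pow_apply, Pi.sub_apply]
  set V := Vq (y1 z) (y2 z) with hVd
  set X := Xq (y1 z) (y2 z) with hXd
  set w := (X - P z V) / V ^ n with hw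
  have hxw : P z V + V ^ n * w = X := by rw [hw]; field_simp; ring
  have := w_alg (JJ M N) (kk n a1 a2) (ll e f) n κ e2 hn hκ (fun p => α p z) V X (P z V) (Pz z V) (PV z V) (S z V) w hV hXn hh hxw.symm hr
  unfold ff
  simp only [hxw]
  refine Prod.ext ?_ ?_
  · simp only [Prod.smul_mk, smul_eq_mul]
    have v2 : V ^ κ = V ^ (κ-1) * V := by rw [← pow_succ]; congr 1; omega
    rw [v2]
    have := pow_ne_zero (κ-1) hV
    field_simp
  · simp only [Prod.smul_mk, smul_eq_mul]
    rw [← this]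
    have v1 : V ^ n = V ^ (n-1) * V := by rw [← pow_succ]; congr 1; omega
    have hv3 := pow_ne_zero (n-1) hV
    have hxe := pow_ne_zero e2 hXn
    have hvk := pow_ne_zero κ hV
    have hx2 : X - P z V = V ^ n * w := by rw [← hxw]; ring
    rw [hx2]
    generalize HXX (fun p => α p z) V X = H at *
    generalize V ^ κ * X ^ e2 = D at *
    generalize -V * H / D = DV
    generalize HEE (fun p => α p z) V X = E1
    rw [v1]
    field_simp




lemma cluster_fst {X Y : ℂ} {b : ℂ × ℂ} (g : ℝ → ℂ × ℂ) (hb : MapClusterPt b (𝓝[<] (1:ℝ)) g)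
    (h : Tendsto (fun s => (g s).1) (𝓝[<] (1:ℝ)) (𝓝 X)) : b.1 = X := by
  have h1 : MapClusterPt b.1 (𝓝[<] (1:ℝ)) (Prod.fst ∘ g) := hb.continuousAt_comp continuous_fst.continuousAt
  have h2 : ClusterPt b.1 (𝓝 X) := ClusterPt.mono h1 h
  exact eq_of_nhds_neBot h2

lemma final_chart (h : PAR) (α : ℕ × ℕ → ℂ → ℂ) (B : Set ℂ) (hB : IsOpen B)
    (γ : ℝ → ℂ) (ξ : ℂ) (hzi : γ 1 ∈ B)
    (hα : ∀ p ∈ JJ M N, AnalyticOnNhd ℂ (α p) B)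
    (ha : α (0, N+1) (γ 1) ≠ 0) (hb0 : α (M+1, 0) (γ 1) ≠ 0) (hroot : α (0, N+1) (γ 1) * ξ ^ d + α (M+1, 0) (γ 1) = 0)
    (P Pz PV S Q1 : ℂ → ℂ → ℂ)
    (hb : BRN α B (γ 1) ξ P Pz PV S Q1)
    (hγ : ContinuousOn γ (Set.Icc 0 1)) (U : Set ℂ) (hU : IsOpen U) (hγU : γ '' Set.Ico 0 1 ⊆ U)
    (y1 y2 : ℂ → ℂ) (hy1 : AnalyticOnNhd ℂ y1 U) (hy2 : AnalyticOnNhd ℂ y2 U)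
    (hode : ∀ z ∈ U, HasDerivAt y1 (F₁ M N α z (y1 z) (y2 z)) z ∧ HasDerivAt y2 (F₂ M N α z (y1 z) (y2 z)) z)
    (hV0 : Tendsto (fun s => Vq (y1 (γ s)) (y2 (γ s))) (𝓝[<] 1) (𝓝 0))
    (s1 : ℝ) (hs0 : 0 ≤ s1) (hs1 : s1 < 1) (K : ℝ)
    (hK : ∀ s ∈ Set.Ico s1 1, γ s ∈ B ∧ y1 (γ s) ≠ 0 ∧ y2 (γ s) ≠ 0 ∧
      HXX (fun p => α p (γ s)) (Vq (y1 (γ s)) (y2 (γ s))) (Xq (y1 (γ s)) (y2 (γ s))) ≠ 0 ∧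
      ‖(Xq (y1 (γ s)) (y2 (γ s)) - P (γ s) (Vq (y1 (γ s)) (y2 (γ s)))) / Vq (y1 (γ s)) (y2 (γ s)) ^ n‖ ≤ K) :
    ∃ τ : ℝ → ℂ, ∃ Φ1 Φ2 : ℂ → ℂ, AC Φ1 0 ∧ AC Φ2 0 ∧ Tendsto τ (𝓝[<] 1) (𝓝 0) ∧
      ∀ᶠ s in 𝓝[<] (1:ℝ), ContinuousAt τ s ∧ τ s ≠ 0 ∧ τ s ^ κ = γ s - γ 1 ∧
      y1 (γ s) * τ s ^ a1 = Φ1 (τ s) ∧ y2 (γ s) * τ s ^ a2 = Φ2 (τ s) := by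
  have hn := par_n h
  have hκ := h.hκ1
  have hev : ∀ᶠ s in 𝓝[<] (1:ℝ), s ∈ Set.Ico s1 1 := by
    filter_upwards [Ioo_mem_nhdsLT hs1] with s hs using ⟨hs.1.le, hs.2⟩
  have hevo : ∀ᶠ s in 𝓝[<] (1:ℝ), s ∈ Set.Ioo s1 1 := Ioo_mem_nhdsLT hs1
  have hγ1 : Tendsto γ (𝓝[<] 1) (𝓝 (γ 1)) := by
    have h1 := hγ 1 (by simp)
    refine h1.mono_left ?_
    rw [← nhdsWithin_Ioo_eq_nhdsLT (zero_lt_one)]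
    exact nhdsWithin_mono _ fun s hs => ⟨hs.1.le, hs.2.le⟩
  let w : ℂ → ℂ × ℂ := fun z => (z, (Xq (y1 z) (y2 z) - P z (Vq (y1 z) (y2 z))) / Vq (y1 z) (y2 z) ^ n)
  obtain ⟨b, hbcl⟩ : ∃ b, MapClusterPt b (𝓝[<] (1:ℝ)) (fun s => w (γ s)) := by
    have hc : IsCompact (closedBall (γ 1) 1 ×ˢ closedBall (0:ℂ) K) :=
      (isCompact_closedBall _ _).prod (isCompact_closedBall _ _)
    have hm : ∀ᶠ s in 𝓝[<] (1:ℝ), w (γ s) ∈ closedBall (γ 1) 1 ×ˢ closedBall (0:ℂ) K := by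
      filter_upwards [hev, hγ1.eventually (closedBall_mem_nhds _ one_pos)] with s h1 h2
      refine ⟨h2, ?_⟩
      rw [mem_closedBall_zero_iff]
      exact (hK s h1).2.2.2.2
    obtain ⟨b, -, hb⟩ := hc.exists_mapClusterPt (f := 𝓝[<] (1:ℝ)) (u := fun s => w (γ s)) (by rw [le_principal_iff]; exact hm)
    exact ⟨b, hb⟩
  have hb1 : b.1 = γ 1 := cluster_fst (X := γ 1) (Y := 0) (fun s => w (γ s)) hbcl hγ1
  have hff : AC (ff M N n a1 a2 e f κ e2 α P Pz PV S) (0, b) := by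
    have := ff_an h α B (γ 1) ξ hzi hα ha hb0 hroot P Pz PV S Q1 hn hb b.2
    rwa [← hb1] at this
  have sU : ∀ s ∈ Set.Ico s1 1, γ s ∈ U := fun s hs => hγU ⟨s, ⟨hs0.trans hs.1, hs.2⟩, rfl⟩
  have Van : ∀ s ∈ Set.Ico s1 1, AC (fun z => Vq (y1 z) (y2 z)) (γ s) := by
    intro s hs
    unfold Vc
    exact ((hy2 _ (sU s hs)).pow _).div ((hy1 _ (sU s hs)).pow _) (pow_ne_zero _ (hK s hs).2.1)
  have Xan : ∀ s ∈ Set.Ico s1 1, AC (fun z => Xq (y1 z) (y2 z)) (γ s) := by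
    intro s hs
    unfold Xc
    exact ((hy2 _ (sU s hs)).pow _).div ((hy1 _ (sU s hs)).pow _) (pow_ne_zero _ (hK s hs).2.1)
  obtain ⟨Y, hYa, hYd, hYe⟩ := painleve (ff M N n a1 a2 e f κ e2 α P Pz PV S) 0 b hff γ s1 hs1
    (hγ.mono fun s hs => ⟨hs0.trans hs.1, hs.2.le⟩) (fun z => Vq (y1 z) (y2 z))
    (fun z => - Vq (y1 z) (y2 z) * HXX (fun p => α p z) (Vq (y1 z) (y2 z)) (Xq (y1 z) (y2 z))
      / (Vq (y1 z) (y2 z) ^ κ * Xq (y1 z) (y2 z) ^ e2)) w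
    (by
      intro s hs
      obtain ⟨k1, k2, k3, k4, -⟩ := hK s hs
      have hXan := hX_an (E := ℂ) (J := JJ M N) (kk n a1 a2) (ll e f) (c := fun z p => α p z) (fun p hp => hα p hp _ k1) (Van s hs) (Xan s hs)
      filter_upwards [hB.mem_nhds k1, hU.mem_nhds (sU s hs), (hy1 _ (sU s hs)).continuousAt.eventually_ne k2,
        (hy2 _ (sU s hs)).continuousAt.eventually_ne k3, hXan.continuousAt.eventually_ne k4] with z m1 m2 m3 m4 m5
      exact ⟨Vc_deriv h α y1 y2 z m3 m4 (hode z m2).1 (hode z m2).2,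
        loc_flow h (by omega) α B (γ 1) ξ P Pz PV S Q1 hb y1 y2 z m1 m3 m4 (hode z m2).1 (hode z m2).2 m5⟩)
    hV0 hbcl
  have hY0 : (Y 0).1 = γ 1 := by
    have h1 : Tendsto (fun s => Y (Vq (y1 (γ s)) (y2 (γ s)))) (𝓝[<] 1) (𝓝 (Y 0)) := hYa.continuousAt.tendsto.comp hV0
    have h2 : Tendsto (fun s => w (γ s)) (𝓝[<] 1) (𝓝 (Y 0)) := h1.congr' (by filter_upwards [hYe] with s hs using hs.symm)
    have h3 : Tendsto (fun s => (w (γ s)).1) (𝓝[<] 1) (𝓝 (Y 0).1) := (continuous_fst.tendsto _).comp h2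
    exact tendsto_nhds_unique h3 hγ1
  have aY1 : AC (fun V => (Y V).1) 0 := AnalyticAt.comp (f := Y) (x := 0) analyticAt_fst hYa
  have aY2 : AC (fun V => (Y V).2) 0 := AnalyticAt.comp (f := Y) (x := 0) analyticAt_snd hYa
  have aP : AC (fun V => P (Y V).1 V) 0 := by
    have h1 := hb.hd.1 (γ 1) hzi 0
    rw [← hY0] at h1
    exact AnalyticAt.comp (f := fun V => ((Y V).1, V)) (x := (0:ℂ)) h1 (aY1.prod analyticAt_id)
  let XX : ℂ → ℂ := fun V => P (Y V).1 V + V ^ n * (Y V).2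
  have aXX : AC XX 0 := aP.add ((analyticAt_id.pow n).mul aY2)
  have hXX0 : XX 0 = ξ := by simp [XX, hY0, hb.h0, hn]
  have hξ : ξ ≠ 0 := root_ne h (fun p => α p (γ 1)) hb0 ξ hroot
  let H : ℂ → ℂ := fun V => HXX (fun p => α p (Y V).1) V (XX V)
  have aH : AC H 0 := by
    refine hX_an (E := ℂ) (J := JJ M N) (kk n a1 a2) (ll e f) (c := fun V p => α p (Y V).1) (fun p hp => ?_) analyticAt_id aXX
    have h1 := hα p hp _ hzi
    rw [← hY0] at h1
    exact AnalyticAt.comp (f := fun V => (Y V).1) (x := (0:ℂ)) h1 aY1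
  have hH0 : H 0 ≠ 0 := by
    simp only [H, hXX0, hY0]
    exact hX_root_ne h (fun p => α p (γ 1)) ha hb0 ξ hroot
  obtain ⟨q, Λ, aq, aΛ, hq0, hqΛ⟩ := inv_chart κ hκ (fun V => (Y V).1) (fun V => -(XX V) ^ e2 / H V) aY1
    ((aXX.pow e2).neg.div aH hH0) (div_ne_zero (neg_ne_zero.2 (pow_ne_zero _ (by rw [hXX0]; exact hξ))) hH0)
    (by
      filter_upwards [hYd] with V hV
      refine (HasFDerivAt.comp_hasDerivAt V (hasFDerivAt_fst (𝕜 := ℂ) (p := Y V)) hV).congr_deriv ?_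
      simp only [ContinuousLinearMap.coe_fst', ff, XX, H]
      ring)
  have hΛ0 : Λ 0 = 0 := by simpa using hqΛ.self_of_nhds.2
  have hqn : ∀ᶠ V in 𝓝 (0:ℂ), q V ≠ 0 := aq.continuousAt.eventually_ne hq0
  have aXL : AC (fun t => XX (Λ t)) 0 := by
    refine AnalyticAt.comp (f := Λ) (x := (0:ℂ)) (g := XX) ?_ aΛ
    rw [hΛ0]; exact aXX
  have aqL : AC (fun t => q (Λ t)) 0 := by
    refine AnalyticAt.comp (f := Λ) (x := (0:ℂ)) (g := q) ?_ aΛ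
    rw [hΛ0]; exact aq
  refine ⟨fun s => Vq (y1 (γ s)) (y2 (γ s)) * q (Vq (y1 (γ s)) (y2 (γ s))),
    fun t => XX (Λ t) ^ f * q (Λ t) ^ a1, fun t => XX (Λ t) ^ e * q (Λ t) ^ a2,
    (aXL.pow _).mul (aqL.pow _), (aXL.pow _).mul (aqL.pow _), ?_, ?_⟩
  · have := hV0.mul (aq.continuousAt.tendsto.comp hV0)
    simpa using this
  filter_upwards [hevo, hYe, hV0.eventually hqΛ, hV0.eventually hqn, hV0.eventually aq.eventually_analyticAt] with s i1 i2 i3 i4 i5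
  have i0 : s ∈ Set.Ico s1 1 := ⟨i1.1.le, i1.2⟩
  obtain ⟨k1, k2, k3, k4, -⟩ := hK s i0
  have hVn : Vq (y1 (γ s)) (y2 (γ s)) ≠ 0 := Vc_ne k2 k3
  have hγs : ContinuousAt γ s := hγ.continuousAt (Icc_mem_nhds (hs0.trans_lt i1.1) i1.2)
  have cV : ContinuousAt (fun s => Vq (y1 (γ s)) (y2 (γ s))) s :=
    ContinuousAt.comp (f := γ) (g := fun z => Vq (y1 z) (y2 z)) (x := s) (Van s i0).continuousAt hγs
  have hY1 : (Y (Vq (y1 (γ s)) (y2 (γ s)))).1 = γ s := by rw [← i2]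
  have hXs : XX (Vq (y1 (γ s)) (y2 (γ s))) = Xq (y1 (γ s)) (y2 (γ s)) := by
    simp only [XX]
    rw [← i2]
    simp only [w]
    rw [mul_div_cancel₀ _ (pow_ne_zero n hVn)]; ring
  refine ⟨cV.mul (ContinuousAt.comp (f := fun s => Vq (y1 (γ s)) (y2 (γ s))) (g := q) (x := s) i5.continuousAt cV), mul_ne_zero hVn i4, ?_, ?_, ?_⟩
  · rw [i3.1, hY1, hY0]
  · rw [i3.2, hXs, ← chart1 h k2 k3]; ring
  · rw [i3.2, hXs, ← chart2 h k2 k3]; ring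
end



lemma regular_case (M N κ c1 c2 : ℕ) (hκ : κ ≠ 0) (α : ℕ × ℕ → ℂ → ℂ) (γ : ℝ → ℂ)
    (hα : ∀ p ∈ JJ M N, AnalyticAt ℂ (α p) (γ 1))
    (hγ : ContinuousOn γ (Set.Icc 0 1)) (hne : ∀ s ∈ Set.Ico (0 : ℝ) 1, γ s ≠ γ 1)
    (U : Set ℂ) (hU : IsOpen U) (hγU : γ '' Set.Ico 0 1 ⊆ U)
    (y1 y2 : ℂ → ℂ)
    (hode : ∀ z ∈ U, HasDerivAt y1 (F₁ M N α z (y1 z) (y2 z)) z ∧ HasDerivAt y2 (F₂ M N α z (y1 z) (y2 z)) z)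
    (hS : ¬ Tendsto (fun s => Sz M N (y1 (γ s)) (y2 (γ s))) (𝓝[<] 1) atTop) :
    ∃ τ : ℝ → ℂ, ∃ Φ1 Φ2 : ℂ → ℂ, AnalyticAt ℂ Φ1 0 ∧ AnalyticAt ℂ Φ2 0 ∧ Tendsto τ (𝓝[<] 1) (𝓝 0) ∧
      ∀ᶠ s in 𝓝[<] (1:ℝ), ContinuousAt τ s ∧ τ s ≠ 0 ∧ τ s ^ κ = γ s - γ 1 ∧
      y1 (γ s) * τ s ^ c1 = Φ1 (τ s) ∧ y2 (γ s) * τ s ^ c2 = Φ2 (τ s) := by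
  have hγ1 : Tendsto γ (𝓝[<] 1) (𝓝 (γ 1)) := by
    have h1 := hγ 1 (by simp)
    refine h1.mono_left ?_
    rw [← nhdsWithin_Ioo_eq_nhdsLT (zero_lt_one)]
    exact nhdsWithin_mono _ fun s hs => ⟨hs.1.le, hs.2.le⟩
  have bd : ∀ (y : ℂ) (m : ℕ) (b : ℝ), ‖y‖ ^ (m+1) ≤ b → ‖y‖ ≤ max 1 b := by
    intro y m b hy
    rcases le_total ‖y‖ 1 with h1 | h1
    · exact h1.trans (le_max_left _ _)
    · exact ((le_self_pow₀ h1 (by omega)).trans hy).trans (le_max_right _ _)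
  obtain ⟨b, hbcl⟩ : ∃ b, MapClusterPt b (𝓝[<] (1:ℝ)) (fun s => (y1 (γ s), y2 (γ s))) := by
    rw [Filter.tendsto_atTop] at hS
    simp only [not_forall, not_eventually, not_le] at hS
    obtain ⟨R, hR⟩ := hS
    have hc : IsCompact (closedBall (0:ℂ) (max 1 R) ×ˢ closedBall (0:ℂ) (max 1 R)) :=
      (isCompact_closedBall _ _).prod (isCompact_closedBall _ _)
    have hm : ∃ᶠ s in 𝓝[<] (1:ℝ), (y1 (γ s), y2 (γ s)) ∈ closedBall (0:ℂ) (max 1 R) ×ˢ closedBall (0:ℂ) (max 1 R) := by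
      refine hR.mono fun s hs => ?_
      unfold Sz at hs
      have p1 : 0 ≤ ‖y1 (γ s)‖ ^ (M+1) := by positivity
      have p2 : 0 ≤ ‖y2 (γ s)‖ ^ (N+1) := by positivity
      refine ⟨?_, ?_⟩
      · rw [mem_closedBall_zero_iff]; exact bd _ M R (by linarith)
      · rw [mem_closedBall_zero_iff]; exact bd _ N R (by linarith)
    obtain ⟨b, -, hb⟩ := hc.exists_mapClusterPt_of_frequently hm
    exact ⟨b, hb⟩
  let ff0 : ℂ × ℂ × ℂ → ℂ × ℂ := fun x => (F₁ M N α x.1 x.2.1 x.2.2, F₂ M N α x.1 x.2.1 x.2.2)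
  have hff : AnalyticAt ℂ ff0 (γ 1, b) := by
    let x₀ : ℂ × ℂ × ℂ := (γ 1, b)
    have az : AnalyticAt ℂ (fun x : ℂ × ℂ × ℂ => x.1) x₀ := analyticAt_fst
    have a1 : AnalyticAt ℂ (fun x : ℂ × ℂ × ℂ => x.2.1) x₀ := analyticAt_fst.comp analyticAt_snd
    have a2 : AnalyticAt ℂ (fun x : ℂ × ℂ × ℂ => x.2.2) x₀ := analyticAt_snd.comp analyticAt_snd
    have ac : ∀ p ∈ JJ M N, AnalyticAt ℂ (fun x : ℂ × ℂ × ℂ => α p x.1) x₀ := fun p hp =>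
      AnalyticAt.comp (f := fun x : ℂ × ℂ × ℂ => x.1) (x := x₀) (hα p hp) az
    have hi : ∀ p ∈ idxI M N, p ∈ JJ M N := fun p hp => by simp [JJ, hp]
    refine AnalyticAt.prod ?_ ?_
    · unfold F₁
      exact ((analyticAt_const.mul (ac _ (by simp [JJ]))).mul (a2.pow _)).add
        (Finset.analyticAt_fun_sum _ fun p hp => ((analyticAt_const.mul (ac p (hi p hp))).mul (a1.pow _)).mul (a2.pow _))
    · unfold F₂
      exact ((analyticAt_const.mul (ac _ (by simp [JJ]))).mul (a1.pow _)).neg.sub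
        (Finset.analyticAt_fun_sum _ fun p hp => ((analyticAt_const.mul (ac p (hi p hp))).mul (a1.pow _)).mul (a2.pow _))
  obtain ⟨Y, hYa, -, hYe⟩ := painleve ff0 (γ 1) b hff γ 0 one_pos (hγ.mono fun s hs => ⟨hs.1, hs.2.le⟩)
    (fun z => z) (fun _ => 1) (fun z => (y1 z, y2 z))
    (by
      intro s hs
      filter_upwards [hU.mem_nhds (hγU ⟨s, hs, rfl⟩)] with z hz
      refine ⟨hasDerivAt_id z, ?_⟩
      rw [one_smul]
      exact (hode z hz).1.prodMk (hode z hz).2) hγ1 hbcl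
  obtain ⟨τ, hτ0, hτ⟩ := root_lift κ hκ γ hγ hne
  have aL : AnalyticAt ℂ (fun t : ℂ => γ 1 + t ^ κ) 0 := analyticAt_const.add (analyticAt_id.pow κ)
  have aY : AnalyticAt ℂ (fun t : ℂ => Y (γ 1 + t ^ κ)) 0 := by
    refine AnalyticAt.comp (f := fun t : ℂ => γ 1 + t ^ κ) (x := (0:ℂ)) (g := Y) ?_ aL
    simpa [hκ] using hYa
  have aY1 : AnalyticAt ℂ (fun t : ℂ => (Y (γ 1 + t ^ κ)).1) 0 :=
    AnalyticAt.comp (f := fun t : ℂ => Y (γ 1 + t ^ κ)) (x := (0:ℂ)) analyticAt_fst aY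
  have aY2 : AnalyticAt ℂ (fun t : ℂ => (Y (γ 1 + t ^ κ)).2) 0 :=
    AnalyticAt.comp (f := fun t : ℂ => Y (γ 1 + t ^ κ)) (x := (0:ℂ)) analyticAt_snd aY
  refine ⟨τ, fun t => (Y (γ 1 + t ^ κ)).1 * t ^ c1, fun t => (Y (γ 1 + t ^ κ)).2 * t ^ c2,
    aY1.mul (analyticAt_id.pow _), aY2.mul (analyticAt_id.pow _), hτ0, ?_⟩
  filter_upwards [hYe, Ioo_mem_nhdsLT (zero_lt_one)] with s h1 h2
  obtain ⟨t1, t2, t3⟩ := hτ s h2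
  refine ⟨t1, t2, t3, ?_, ?_⟩
  · beta_reduce; rw [t3, add_sub_cancel, ← h1]
  · beta_reduce; rw [t3, add_sub_cancel, ← h1]



/-- Main theorem: if the Hamiltonian system admits formal algebraic series solutions
with every admissible pair of leading coefficients at every point of `Ω \ Φ`, then any
solution that can be analytically continued along a finite-length curve `γ ⊆ Ω` up to,
but not including, its endpoint `z_∞ = γ 1 ∈ Ω \ Φ` is represented near `z_∞` by
convergent series `y₁ = ∑_{k ≥ −(N+1)/d} C_{1,k} (z−z_∞)^{kd/(MN−1)}`,
`y₂ = ∑_{k ≥ −(M+1)/d} C_{2,k} (z−z_∞)^{kd/(MN−1)}`, `d = gcd{M+1, N+1, MN−1}`,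
in a punctured branched neighbourhood of `z_∞`; i.e. every movable singularity
reached along a rectifiable curve is at most an algebraic branch point. -/
theorem movable_singularities_algebraic
    (M N : ℕ) (hM : 0 < M) (hN : 0 < N) (hMN : 1 < M * N)
    (Ω : Set ℂ) (hΩ : IsOpen Ω)
    (α : ℕ × ℕ → ℂ → ℂ)
    (hα : ∀ p ∈ insert (M + 1, 0) (insert (0, N + 1) (idxI M N)),
      AnalyticOnNhd ℂ (α p) Ω)
    (Φ : Set ℂ)
    (hΦ : Φ = {z ∈ Ω | α (M + 1, 0) z = 0 ∨ α (0, N + 1) z = 0})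
    -- existence of formal series solutions for every admissible leading coefficient
    (hformal : ∀ z₀ ∈ Ω \ Φ, ∀ c₁L c₂L : ℂ,
      c₁L ^ (M * N - 1) =
          -(α (0, N + 1) z₀ * (α (M + 1, 0) z₀) ^ N * ((M * N - 1 : ℕ) : ℂ) ^ (N + 1))⁻¹ →
      c₂L = ((M * N - 1 : ℕ) : ℂ) * α (M + 1, 0) z₀ * c₁L ^ M →
      ∃ c₁ c₂ : ℤ → ℂ,
        c₁ (-((N : ℤ) + 1)) = c₁L ∧ c₂ (-((M : ℤ) + 1)) = c₂L ∧
        IsFormalSolution M N α z₀ c₁ c₂)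
    -- the finite-length curve
    (γ : ℝ → ℂ) (hγc : ContinuousOn γ (Set.Icc 0 1))
    (hγΩ : γ '' Set.Icc 0 1 ⊆ Ω)
    (hlen : eVariationOn γ (Set.Icc 0 1) ≠ ⊤)
    (hend : γ 1 ∈ Ω \ Φ)
    (hne : ∀ s ∈ Set.Ico (0 : ℝ) 1, γ s ≠ γ 1)
    -- a solution analytic along the curve up to, but not including, the endpoint
    (U : Set ℂ) (hU : IsOpen U) (hUΩ : U ⊆ Ω) (hγU : γ '' Set.Ico 0 1 ⊆ U)
    (y₁ y₂ : ℂ → ℂ)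
    (hy₁ : AnalyticOnNhd ℂ y₁ U) (hy₂ : AnalyticOnNhd ℂ y₂ U)
    (hode : ∀ z ∈ U,
      deriv y₁ z = F₁ M N α z (y₁ z) (y₂ z) ∧
      deriv y₂ z = F₂ M N α z (y₁ z) (y₂ z)) :
    -- conclusion: algebraic (Puiseux) expansion at `z_∞ = γ 1`
    ∃ r > (0 : ℝ), ∃ C₁ C₂ : ℕ → ℂ,
      (∀ t : ℂ, ‖t‖ < r →
        Summable (fun k : ℕ => C₁ k * t ^ k) ∧ Summable fun k : ℕ => C₂ k * t ^ k) ∧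
      ∃ δ ∈ Set.Ioo (0 : ℝ) 1, ∃ τ : ℝ → ℂ,
        ContinuousOn τ (Set.Ico (1 - δ) 1) ∧
        ∀ s ∈ Set.Ico (1 - δ) 1,
          τ s ≠ 0 ∧ ‖τ s‖ < r ∧
          τ s ^ ((M * N - 1) / Nat.gcd (Nat.gcd (M + 1) (N + 1)) (M * N - 1)) = γ s - γ 1 ∧
          HasSum (fun k : ℕ => C₁ k * τ s ^ k)
            (y₁ (γ s) * τ s ^ ((N + 1) / Nat.gcd (Nat.gcd (M + 1) (N + 1)) (M * N - 1))) ∧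
          HasSum (fun k : ℕ => C₂ k * τ s ^ k)
            (y₂ (γ s) * τ s ^ ((M + 1) / Nat.gcd (Nat.gcd (M + 1) (N + 1)) (M * N - 1))) := by
  obtain ⟨n, κ, e, f, e2, h, hκ, hq⟩ := par_exists M N hM hN hMN
  have hzΩ : γ 1 ∈ Ω := hend.1
  have hnΦ : ∀ z ∈ Ω, α (0, N+1) z ≠ 0 → α (M+1, 0) z ≠ 0 → z ∈ Ω \ Φ := by
    intro z hz h1 h2
    refine ⟨hz, ?_⟩
    rw [hΦ]
    rintro ⟨-, h3 | h3⟩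
    · exact h2 h3
    · exact h1 h3
  have hb0 : α (M+1, 0) (γ 1) ≠ 0 := fun h0 => hend.2 (by rw [hΦ]; exact ⟨hzΩ, Or.inl h0⟩)
  have ha : α (0, N+1) (γ 1) ≠ 0 := fun h0 => hend.2 (by rw [hΦ]; exact ⟨hzΩ, Or.inr h0⟩)
  have hode' : ∀ z ∈ U, HasDerivAt y₁ (F₁ M N α z (y₁ z) (y₂ z)) z ∧ HasDerivAt y₂ (F₂ M N α z (y₁ z) (y₂ z)) z := by
    intro z hz
    rw [← (hode z hz).1, ← (hode z hz).2]
    exact ⟨(hy₁ z hz).differentiableAt.hasDerivAt, (hy₂ z hz).differentiableAt.hasDerivAt⟩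
  rw [← hκ]
  by_cases hS : Tendsto (fun s => Sz M N (y₁ (γ s)) (y₂ (γ s))) (𝓝[<] 1) atTop
  · obtain ⟨B, hB, hzB, hBΩ, hbr⟩ := branches h hq hMN α Ω hΩ hα (γ 1) hzΩ ha hb0
      (fun z hz h1 h2 => hformal z (hnΦ z hz h1 h2))
    have hαB : ∀ p ∈ JJ M N, AnalyticOnNhd ℂ (α p) B := fun p hp => (hα p hp).mono hBΩ
    obtain ⟨ξ, hξ, P, Pz, PV, S, Q1, hb, hV, s1, hs0, hs1, K, hK⟩ := W_bounded h α B hB γ hzB hαB ha hb0 hbr hγc hlen y₁ y₂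
      (fun s hs => hode' _ (hγU ⟨s, hs, rfl⟩)) hS
    obtain ⟨τ, Φ1, Φ2, c1, c2, c3, c4⟩ := final_chart h α B hB γ ξ hzB hαB ha hb0 hξ P Pz PV S Q1 hb hγc U hU hγU y₁ y₂ hy₁ hy₂ hode'
      hV s1 hs0 hs1 K hK
    exact output_lemma κ _ _ γ (fun s => y₁ (γ s)) (fun s => y₂ (γ s)) τ Φ1 Φ2 c1 c2 c3 c4
  · have hκ0 : κ ≠ 0 := by have := h.hκ1; omega
    obtain ⟨τ, Φ1, Φ2, c1, c2, c3, c4⟩ := regular_case M N κ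
      ((N + 1) / Nat.gcd (Nat.gcd (M + 1) (N + 1)) (M * N - 1))
      ((M + 1) / Nat.gcd (Nat.gcd (M + 1) (N + 1)) (M * N - 1)) hκ0 α γ (fun p hp => hα p hp _ hzΩ) hγc hne U hU hγU y₁ y₂ hode' hS
    exact output_lemma κ _ _ γ (fun s => y₁ (γ s)) (fun s => y₂ (γ s)) τ Φ1 Φ2 c1 c2 c3 c4
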